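/- Let d > 1 be a cube-free integer of one of the following forms, where p is a prime ≡ 4 or 7 (mod 9), q is a prime ≡ 2 or 5 (mod 9), and e, e₁, f₁ ∈ {1, 2}: (a) d = p^{e₁}; (b) d = 3^{e} p^{e₁}; (c) d = p^{e₁} q^{f₁} ≡ ±1 (mod 9); and set c = 3 in cases (a), (b) and c = q in case (c). Then: (i) the conjunction 'Q = 1 and C_{k,3} is cyclic of order 3' holds if and only if c is not a cubic residue modulo p; (ii) if Q = 3 and C_{k,3} ≅ ℤ/3ℤ × ℤ/3ℤ, then c is a cubic residue modulo p; (iii) L is of principal factorization type α if and only if Q = 1, and of type β if and only if Q = 3. -/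

import Mathlib

open IntermediateField NumberField
open scoped nonZeroDivisors

set_option synthInstance.maxHeartbeats 1000000
set_option maxHeartbeats 2000000

noncomputable section

instance : Fact (Nat.Prime 3) := ⟨by norm_num⟩

/-- A positive integer is cube-free if no prime cube divides it. -/
def IsCubeFree (d : ℕ) : Prop := ∀ p : ℕ, p.Prime → ¬ (p ^ 3 ∣ d)

/-- The primitive cube root of unity `ζ₃ = e^{2πi/3}`. -/
def zeta3 : ℂ := Complex.exp (2 * Real.pi * Complex.I / 3)

lemma zeta3_isPrimitiveRoot : IsPrimitiveRoot zeta3 3 := by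
  simpa [zeta3] using Complex.isPrimitiveRoot_exp 3 (by norm_num)

lemma isIntegral_zeta3 : IsIntegral ℚ zeta3 :=
  (zeta3_isPrimitiveRoot.isIntegral (by norm_num)).tower_top

/-- The real cube root of `d`, as a complex number. -/
def cbrt (d : ℕ) : ℂ := ((d : ℝ) ^ ((3 : ℝ)⁻¹) : ℝ)

lemma cbrt_pow_three (d : ℕ) : (cbrt d) ^ 3 = (d : ℂ) := by
  have h : ((d : ℝ) ^ ((3 : ℝ)⁻¹)) ^ (3 : ℕ) = (d : ℝ) := by
    rw [← Real.rpow_natCast ((d : ℝ) ^ ((3 : ℝ)⁻¹)) 3, ← Real.rpow_mul (by positivity)]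
    norm_num
  calc (cbrt d) ^ 3 = (((((d : ℝ) ^ ((3 : ℝ)⁻¹)) ^ (3:ℕ) : ℝ)) : ℂ) := by
        push_cast [cbrt]; ring
    _ = ((d : ℝ) : ℂ) := by rw [h]
    _ = (d : ℂ) := by norm_num

lemma isIntegral_cbrt (d : ℕ) : IsIntegral ℚ (cbrt d) := by
  have h : IsIntegral ℤ (cbrt d) := by
    refine ⟨Polynomial.X ^ 3 - Polynomial.C (d : ℤ), ?_, ?_⟩
    · exact Polynomial.monic_X_pow_sub_C _ (by norm_num)
    · simp [Polynomial.eval₂, cbrt_pow_three d]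
  exact h.tower_top

/-- `k = ℚ(∛d, ζ₃)`, the normal closure of the pure cubic field `ℚ(∛d)`,
realized as a subfield of `ℂ`. -/
def Kc (d : ℕ) : IntermediateField ℚ ℂ := ℚ⟮cbrt d, zeta3⟯

instance (d : ℕ) : NumberField (Kc d) where
  to_finiteDimensional := by
    apply IntermediateField.finiteDimensional_adjoin
    rintro x (rfl | rfl)
    · exact isIntegral_cbrt d
    · exact isIntegral_zeta3

lemma zeta3_mem (d : ℕ) : zeta3 ∈ Kc d :=
  IntermediateField.subset_adjoin _ _ (by simp)

lemma cbrt_mem (d : ℕ) : cbrt d ∈ Kc d :=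
  IntermediateField.subset_adjoin _ _ (by simp)

/-- `ζ₃` as an element of `k`. -/
def zetaK (d : ℕ) : Kc d := ⟨zeta3, zeta3_mem d⟩

/-- `∛d` as an element of `k`. -/
def cbrtK (d : ℕ) : Kc d := ⟨cbrt d, cbrt_mem d⟩

/-- `k₀ = ℚ(ζ₃)` realized as a subfield of `k`. -/
def k0S (d : ℕ) : IntermediateField ℚ (Kc d) := ℚ⟮zetaK d⟯

/-- `L = ℚ(∛d)` realized as a subfield of `k`. -/
def LS (d : ℕ) : IntermediateField ℚ (Kc d) := ℚ⟮cbrtK d⟯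

instance (d : ℕ) : NumberField ↥(k0S d) where
instance (d : ℕ) : NumberField ↥(LS d) where

/-- `ζ₃` as an element of `k₀ ⊆ k`. -/
def zetaK0 (d : ℕ) : ↥(k0S d) := ⟨zetaK d, IntermediateField.mem_adjoin_simple_self ℚ (zetaK d)⟩

/-- `∛d` as an element of `L ⊆ k`. -/
def cbrtL (d : ℕ) : ↥(LS d) := ⟨cbrtK d, IntermediateField.mem_adjoin_simple_self ℚ (cbrtK d)⟩

-- Shortcut instances (these hold by instance search; they are registered to speed up
-- elaboration).
instance (priority := 10000) (d : ℕ) : IsDedekindDomain (𝓞 ↥(Kc d)) := inferInstance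
instance (priority := 10000) (d : ℕ) : IsDedekindDomain (𝓞 ↥(LS d)) := inferInstance
instance (priority := 10000) (d : ℕ) : Algebra (𝓞 ↥(Kc d)) ↥(Kc d) := inferInstance
instance (priority := 10000) (d : ℕ) : Algebra (𝓞 ↥(LS d)) ↥(LS d) := inferInstance
instance (priority := 10000) (d : ℕ) : Module (𝓞 ↥(Kc d)) ↥(Kc d) := Algebra.toModule
instance (priority := 10000) (d : ℕ) : Module (𝓞 ↥(LS d)) ↥(LS d) := Algebra.toModule
instance (priority := 10000) (d : ℕ) : IsFractionRing (𝓞 ↥(Kc d)) ↥(Kc d) := inferInstance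
instance (priority := 10000) (d : ℕ) : IsFractionRing (𝓞 ↥(LS d)) ↥(LS d) := inferInstance
instance (priority := 10000) (d : ℕ) : Algebra ↥(k0S d) ↥(Kc d) := inferInstance
instance (priority := 10000) (d : ℕ) : Algebra ↥(LS d) ↥(Kc d) := inferInstance
instance (priority := 10000) (d : ℕ) :
    CommGroup ((FractionalIdeal (𝓞 ↥(Kc d))⁰ ↥(Kc d))ˣ) := inferInstance
instance (priority := 10000) (d : ℕ) :
    CommGroup ((FractionalIdeal (𝓞 ↥(LS d))⁰ ↥(LS d))ˣ) := inferInstance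

/-- The subgroup `N_{k/k₀}(E_k)` of `E_{k₀}` consisting of relative norms of units of `k`. -/
def unitNormSubgroup (d : ℕ) : Subgroup ((𝓞 ↥(k0S d))ˣ) :=
  Subgroup.closure
    {u | ∃ v : (𝓞 ↥(Kc d))ˣ,
      Algebra.norm ↥(k0S d) ((v : 𝓞 ↥(Kc d)) : ↥(Kc d)) = ((u : 𝓞 ↥(k0S d)) : ↥(k0S d))}

/-- The unit norm index `(E_{k₀} : N_{k/k₀}(E_k))`. -/
def unitNormIndex (d : ℕ) : ℕ := (unitNormSubgroup d).index

/-- The subgroup `E₀ = ⟨E_{k₀}, E_L, E_{L^σ}, E_{L^{σ²}}⟩` of `E_k` generated by the units of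
all proper subfields of `k`. -/
def subfieldUnits (d : ℕ) (σ : ↥(Kc d) ≃ₐ[ℚ] ↥(Kc d)) : Subgroup ((𝓞 ↥(Kc d))ˣ) :=
  Subgroup.closure
    {u | ((u : 𝓞 ↥(Kc d)) : ↥(Kc d)) ∈ k0S d ∨
         ((u : 𝓞 ↥(Kc d)) : ↥(Kc d)) ∈ LS d ∨
         ((u : 𝓞 ↥(Kc d)) : ↥(Kc d)) ∈ (LS d).map (σ : ↥(Kc d) →ₐ[ℚ] ↥(Kc d)) ∨
         ((u : 𝓞 ↥(Kc d)) : ↥(Kc d)) ∈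
           (LS d).map ((σ * σ : ↥(Kc d) ≃ₐ[ℚ] ↥(Kc d)) : ↥(Kc d) →ₐ[ℚ] ↥(Kc d))}

/-- The subfield unit index `Q = (E_k : E₀)`. -/
def subfieldUnitIndex (d : ℕ) (σ : ↥(Kc d) ≃ₐ[ℚ] ↥(Kc d)) : ℕ := (subfieldUnits d σ).index

/-- `𝒫_k^G`: the group of `σ`-invariant (ambiguous) principal fractional ideals of `k`. -/
def ambPrincipalK (d : ℕ) (σ : ↥(Kc d) ≃ₐ[ℚ] ↥(Kc d)) :
    Subgroup ((FractionalIdeal (𝓞 ↥(Kc d))⁰ ↥(Kc d))ˣ) :=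
  Subgroup.closure
    {I | ∃ x : (↥(Kc d))ˣ, I = toPrincipalIdeal (𝓞 ↥(Kc d)) ↥(Kc d) x ∧
      FractionalIdeal.spanSingleton (𝓞 ↥(Kc d))⁰ (σ (x : ↥(Kc d))) =
        FractionalIdeal.spanSingleton (𝓞 ↥(Kc d))⁰ (x : ↥(Kc d))}

/-- `𝒫_{k₀}`: the group of principal fractional ideals of `k` extended from `k₀`,
i.e. generated by nonzero elements of `k₀`. -/
def principalFromK0 (d : ℕ) : Subgroup ((FractionalIdeal (𝓞 ↥(Kc d))⁰ ↥(Kc d))ˣ) :=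
  Subgroup.closure
    {I | ∃ y : (↥(Kc d))ˣ, ((y : ↥(Kc d)) ∈ k0S d) ∧
      I = toPrincipalIdeal (𝓞 ↥(Kc d)) ↥(Kc d) y}

/-- The quotient `𝒫_k^G/𝒫_{k₀}` of primitive ambiguous principal ideals of `k/k₀`. -/
def ambPrincipalQuot (d : ℕ) (σ : ↥(Kc d) ≃ₐ[ℚ] ↥(Kc d)) :=
  ↥(ambPrincipalK d σ) ⧸ (principalFromK0 d).subgroupOf (ambPrincipalK d σ)

instance (d : ℕ) (σ : ↥(Kc d) ≃ₐ[ℚ] ↥(Kc d)) : CommGroup (ambPrincipalQuot d σ) := by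
  unfold ambPrincipalQuot; infer_instance

/-- `𝒫_L^G`: the group of principal fractional ideals of `L` whose extension to `k`
is `σ`-invariant. -/
def ambPrincipalL (d : ℕ) (σ : ↥(Kc d) ≃ₐ[ℚ] ↥(Kc d)) :
    Subgroup ((FractionalIdeal (𝓞 ↥(LS d))⁰ ↥(LS d))ˣ) :=
  Subgroup.closure
    {I | ∃ x : (↥(LS d))ˣ, I = toPrincipalIdeal (𝓞 ↥(LS d)) ↥(LS d) x ∧
      FractionalIdeal.spanSingleton (𝓞 ↥(Kc d))⁰ (σ (algebraMap ↥(LS d) ↥(Kc d) (x : ↥(LS d)))) =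
        FractionalIdeal.spanSingleton (𝓞 ↥(Kc d))⁰ (algebraMap ↥(LS d) ↥(Kc d) (x : ↥(LS d)))}

/-- `𝒫_ℚ = 𝓘_ℚ`: the group of fractional ideals of `L` generated by nonzero rational
numbers. -/
def principalFromQ (d : ℕ) : Subgroup ((FractionalIdeal (𝓞 ↥(LS d))⁰ ↥(LS d))ˣ) :=
  Subgroup.closure
    {I | ∃ r : ℚˣ,
      I = toPrincipalIdeal (𝓞 ↥(LS d)) ↥(LS d) (Units.map (algebraMap ℚ ↥(LS d)).toMonoidHom r)}

/-- The quotient `𝒫_L^G/𝒫_ℚ` of absolute principal factors. -/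
def absPrincipalFactors (d : ℕ) (σ : ↥(Kc d) ≃ₐ[ℚ] ↥(Kc d)) :=
  ↥(ambPrincipalL d σ) ⧸ (principalFromQ d).subgroupOf (ambPrincipalL d σ)

instance (d : ℕ) (σ : ↥(Kc d) ≃ₐ[ℚ] ↥(Kc d)) : CommGroup (absPrincipalFactors d σ) := by
  unfold absPrincipalFactors; infer_instance

/-- The kernel of the homomorphism `𝒫_k^G/𝒫_{k₀} → 𝓘_L^G/𝓘_ℚ` induced by the relative norm
`N_{k/L}`: the class of an ambiguous principal ideal `(x)` of `k` lies in the kernel if and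
only if the norm `N_{k/L}(x)` generates an ideal of `L` lying in `𝓘_ℚ`, i.e. differs from a
rational number by a unit of `𝓞_L`. -/
def relPrincipalFactors (d : ℕ) (σ : ↥(Kc d) ≃ₐ[ℚ] ↥(Kc d)) :
    Subgroup (ambPrincipalQuot d σ) :=
  Subgroup.closure
    {c | ∃ (x : (↥(Kc d))ˣ)
        (h : FractionalIdeal.spanSingleton (𝓞 ↥(Kc d))⁰ (σ (x : ↥(Kc d))) =
          FractionalIdeal.spanSingleton (𝓞 ↥(Kc d))⁰ (x : ↥(Kc d))),
      QuotientGroup.mk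
        (⟨toPrincipalIdeal (𝓞 ↥(Kc d)) ↥(Kc d) x,
          Subgroup.subset_closure ⟨x, rfl, h⟩⟩ : ↥(ambPrincipalK d σ)) = c ∧
      ∃ (r : ℚˣ) (u : (𝓞 ↥(LS d))ˣ),
        Algebra.norm ↥(LS d) (x : ↥(Kc d)) =
          algebraMap ℚ ↥(LS d) (r : ℚ) * ((u : 𝓞 ↥(LS d)) : ↥(LS d))}

/-- An abelian group with an action of the symmetric group on three letters, generated by `s` of
order three and `t` of order two, together with distinguished elements `n` and `z` playing the
roles of `-1` and `ζ₃` in the unit group of the normal closure of a pure cubic field. -/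
structure UnitAction (E : Type*) [CommGroup E] where
  s : E →* E
  t : E →* E
  n : E
  z : E
  s_s_s : ∀ u, s (s (s u)) = u
  t_t : ∀ u, t (t u) = u
  s_t : ∀ u, s (t u) = t (s (s u))
  n_mul_n : n * n = 1
  n_ne_one : n ≠ 1
  z_pow : z ^ 3 = 1
  s_n : s n = n
  t_n : t n = n
  s_z : s z = z
  t_z : t z = z⁻¹
  norm_mem : ∀ u, u * s u * s (s u) = 1 ∨ u * s u * s (s u) = n
  fixed : ∀ u, s u = u → ∃ i j : ℕ, u = n ^ i * z ^ j

namespace UnitAction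

variable {E : Type*} [CommGroup E] (D : UnitAction E)

/-- The twisted involution `u ↦ (στ u)⁻¹`. -/
def r : E →* E := (D.s.comp D.t)⁻¹

lemma r_apply (u : E) : D.r u = (D.s (D.t u))⁻¹ := rfl

/-- The subgroup generated by `-1` and the elements `σ w / w`. -/
def Y : Subgroup E := Subgroup.zpowers D.n ⊔ (D.s / MonoidHom.id E).range

lemma zpow_n (i : ℤ) : D.n ^ i = 1 ∨ D.n ^ i = D.n := by
  have h2 : D.n ^ (2 : ℤ) = 1 := by rw [zpow_two, D.n_mul_n]
  rcases Int.even_or_odd' i with ⟨k, rfl | rfl⟩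
  · left; rw [zpow_mul, h2, one_zpow]
  · right; rw [zpow_add, zpow_mul, h2]; simp

lemma mem_Y {u : E} : u ∈ D.Y ↔ ∃ w, u = D.s w / w ∨ u = D.n * (D.s w / w) := by
  rw [Y, Subgroup.mem_sup]
  constructor
  · rintro ⟨a, ⟨i, rfl⟩, b, ⟨w, rfl⟩, rfl⟩
    refine ⟨w, ?_⟩
    rcases D.zpow_n i with h | h <;> simp [h]
  · rintro ⟨w, rfl | rfl⟩
    · exact ⟨1, one_mem _, _, ⟨w, rfl⟩, by simp⟩
    · exact ⟨D.n, Subgroup.mem_zpowers _, _, ⟨w, rfl⟩, by simp⟩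

lemma n_mem : D.n ∈ D.Y := D.mem_Y.2 ⟨1, Or.inr (by simp)⟩

lemma s_div_mem (w : E) : D.s w / w ∈ D.Y := D.mem_Y.2 ⟨w, Or.inl rfl⟩

lemma div_s_mem (w : E) : w / D.s w ∈ D.Y := by
  rw [← inv_div]; exact inv_mem (D.s_div_mem w)

lemma s_s_t (u : E) : D.s (D.s (D.t u)) = D.t (D.s u) := by
  rw [D.s_t, D.s_t, D.s_s_s]

lemma s_t_s (u : E) : D.s (D.t (D.s u)) = D.t u := by
  rw [D.s_t, D.s_s_s]

lemma r_r (u : E) : D.r (D.r u) = u := by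
  simp only [r_apply, map_inv, inv_inv]
  rw [D.s_t, D.s_s_t, D.s_t, D.t_t]
  exact D.s_s_s u

lemma r_n : D.r D.n = D.n := by
  rw [r_apply, D.t_n, D.s_n, inv_eq_iff_mul_eq_one, D.n_mul_n]

lemma r_z : D.r D.z = D.z := by
  rw [r_apply, D.t_z, map_inv, D.s_z, inv_inv]

lemma r_div (w : E) : D.r (D.s w / w) = D.s (D.t w) / D.t w := by
  simp only [r_apply, map_div]
  rw [D.s_t_s, inv_div_inv]

lemma r_mem {u : E} (hu : u ∈ D.Y) : D.r u ∈ D.Y := by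
  obtain ⟨w, rfl | rfl⟩ := D.mem_Y.1 hu
  · rw [D.r_div]; exact D.s_div_mem _
  · rw [map_mul, D.r_div, D.r_n]; exact mul_mem D.n_mem (D.s_div_mem _)

lemma norm_mem_Y (u : E) : u * D.s u * D.s (D.s u) ∈ D.Y := by
  rcases D.norm_mem u with h | h <;> rw [h]
  · exact one_mem _
  · exact D.n_mem

lemma pow_three_mem (u : E) : u ^ 3 ∈ D.Y := by
  have h : u ^ 3 = (u * D.s u * D.s (D.s u)) * ((u / D.s u) * (u / D.s u) * (D.s u / D.s (D.s u))) := by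
    apply Additive.ofMul.injective
    simp only [ofMul_mul, ofMul_div, ofMul_inv, ofMul_pow]
    abel
  rw [h]
  exact mul_mem (D.norm_mem_Y u) (mul_mem (mul_mem (D.div_s_mem u) (D.div_s_mem u)) (D.div_s_mem _))

/-- The units whose class modulo `Y` is fixed by the twisted involution. -/
def plus : Subgroup E where
  carrier := {u | u / D.r u ∈ D.Y}
  one_mem' := by simp
  mul_mem' {a b} ha hb := by
    simp only [Set.mem_ofPred_eq, map_mul] at *
    rw [mul_div_mul_comm]; exact mul_mem ha hb
  inv_mem' {a} ha := by
    simp only [Set.mem_ofPred_eq, map_inv] at *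
    rw [← inv_div_inv, inv_inv, inv_inv]
    simpa [div_eq_mul_inv, mul_comm] using inv_mem ha

/-- The units whose class modulo `Y` is inverted by the twisted involution. -/
def minus : Subgroup E where
  carrier := {u | u * D.r u ∈ D.Y}
  one_mem' := by simp
  mul_mem' {a b} ha hb := by
    simp only [Set.mem_ofPred_eq, map_mul] at *
    rw [mul_mul_mul_comm]; exact mul_mem ha hb
  inv_mem' {a} ha := by
    simp only [Set.mem_ofPred_eq, map_inv] at *
    rw [← mul_inv]; exact inv_mem ha

lemma mem_plus {u : E} : u ∈ D.plus ↔ u / D.r u ∈ D.Y := Iff.rfl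

lemma mem_minus {u : E} : u ∈ D.minus ↔ u * D.r u ∈ D.Y := Iff.rfl

lemma Y_le_plus : D.Y ≤ D.plus := fun _ hu => D.mem_plus.2 (div_mem hu (D.r_mem hu))

lemma Y_le_minus : D.Y ≤ D.minus := fun _ hu => D.mem_minus.2 (mul_mem hu (D.r_mem hu))

lemma mem_of_sq_mem {u : E} (h : u ^ 2 ∈ D.Y) : u ∈ D.Y := by
  have h3 := D.pow_three_mem u
  have : u = u ^ 3 / u ^ 2 := by rw [pow_succ u 2]; simp
  rw [this]; exact Subgroup.div_mem _ h3 h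

lemma plus_inf_minus : D.plus ⊓ D.minus = D.Y := by
  refine le_antisymm ?_ (le_inf D.Y_le_plus D.Y_le_minus)
  rintro u ⟨h1, h2⟩
  apply D.mem_of_sq_mem
  have := mul_mem (D.mem_plus.1 h1) (D.mem_minus.1 h2)
  convert this using 1
  apply Additive.ofMul.injective
  simp only [ofMul_mul, ofMul_div, ofMul_inv, ofMul_pow]
  abel

lemma mul_r_mem_plus (u : E) : u * D.r u ∈ D.plus := by
  rw [mem_plus, map_mul, D.r_r, mul_comm, div_self']; exact one_mem _

lemma div_r_mem_minus (u : E) : u / D.r u ∈ D.minus := by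
  rw [mem_minus, map_div, D.r_r, div_mul_div_cancel, div_self']; exact one_mem _

lemma plus_sup_minus : D.plus ⊔ D.minus = ⊤ := by
  rw [eq_top_iff]
  rintro u -
  have : u = (u * D.r u) ^ 2 * ((u / D.r u) ^ 2 * (u ^ 3)⁻¹) := by
    apply Additive.ofMul.injective
    simp only [ofMul_mul, ofMul_div, ofMul_inv, ofMul_pow]
    abel
  rw [this]
  exact Subgroup.mul_mem_sup (pow_mem (D.mul_r_mem_plus u) 2)
    (mul_mem (pow_mem (D.div_r_mem_minus u) 2) (inv_mem (D.Y_le_minus (D.pow_three_mem u))))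

lemma relIndex_plus : D.Y.relIndex D.plus = D.minus.index := by
  rw [← D.plus_inf_minus, Subgroup.inf_relIndex_left, ← Subgroup.relIndex_sup_right,
    D.plus_sup_minus, Subgroup.relIndex_top_right]

lemma relIndex_minus_mul : D.Y.relIndex D.minus * D.minus.index = D.Y.index :=
  Subgroup.relIndex_mul_index D.Y_le_minus

lemma z_mem_plus : D.z ∈ D.plus := by
  rw [mem_plus, D.r_z, div_self']; exact one_mem _

/-- If `σ w / w` is fixed by the twisted involution, `w` may be chosen fixed by `τ`. -/
lemma exists_fixed_of_r_eq {w : E} (h : D.r (D.s w / w) = D.s w / w) :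
    ∃ v, D.t v = v ∧ D.s v / v = D.s w / w ∧ ∃ j : ℕ, v = w * D.z ^ j := by
  rw [D.r_div] at h
  have h1 : D.s (D.t w / w) = D.t w / w := by
    rw [map_div, div_eq_div_iff_mul_eq_mul] at *
    rw [h, mul_comm, mul_comm]
  obtain ⟨i, j, hij⟩ := D.fixed _ h1
  have htw : D.t w = D.n ^ i * D.z ^ j * w := by rw [← hij]; simp
  have hv : D.t (w * D.z ^ (2 * j)) = D.n ^ i * (w * D.z ^ (2 * j)) := by
    rw [map_mul, map_pow, D.t_z, htw]
    have : (D.z⁻¹) ^ (2 * j) = D.z ^ j := by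
      rw [inv_pow, inv_eq_iff_mul_eq_one, ← pow_add, show 2 * j + j = 3 * j by ring, pow_mul,
        D.z_pow, one_pow]
    rw [this]
    have h4 : D.z ^ j * D.z ^ j = D.z ^ (2 * j) := by rw [two_mul, pow_add]
    rw [← h4]
    simp only [mul_assoc, mul_comm, mul_left_comm]
  set v := w * D.z ^ (2 * j) with hvd
  have hn : D.n ^ i = 1 := by
    have hN := D.norm_mem v
    have hcube : (D.n ^ i) ^ 3 = D.n ^ i := by
      rw [← pow_mul, mul_comm, pow_mul]; congr 1
      rw [pow_succ, pow_two, D.n_mul_n, one_mul]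
    have hN2 : D.t (v * D.s v * D.s (D.s v)) = D.n ^ i * (v * D.s v * D.s (D.s v)) := by
      have e1 : D.t (D.s v) = D.n ^ i * D.s (D.s v) := by
        rw [← D.s_s_t, hv, map_mul, map_mul]; simp [D.s_n]
      have e2 : D.t (D.s (D.s v)) = D.n ^ i * D.s v := by
        rw [← D.s_t, hv, map_mul]; simp [D.s_n]
      rw [map_mul, map_mul, e1, e2, hv]
      nth_rewrite 4 [← hcube]
      apply Additive.ofMul.injective
      simp only [ofMul_mul, ofMul_div, ofMul_inv, ofMul_pow]
      abel
    rcases hN with h | h <;> rw [h] at hN2 <;> simp [D.t_n] at hN2 <;> simp [hN2]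
  rw [hn, one_mul] at hv
  refine ⟨v, hv, ?_, _, hvd⟩
  rw [hvd, map_mul, map_pow, D.s_z, mul_div_mul_right_eq_div]

lemma norm_div (w : E) : (D.s w / w) * D.s (D.s w / w) * D.s (D.s (D.s w / w)) = 1 := by
  simp only [map_div, D.s_s_s]
  apply Additive.ofMul.injective
  simp only [ofMul_mul, ofMul_div, ofMul_one]
  abel

/-- A norm-one element of `Y` is of the form `σ w / w`. -/
lemma exists_eq_div {u : E} (hu : u ∈ D.Y) (h1 : u * D.s u * D.s (D.s u) = 1) :
    ∃ w, u = D.s w / w := by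
  obtain ⟨w, h | h⟩ := D.mem_Y.1 hu
  · exact ⟨w, h⟩
  · exfalso
    rw [h] at h1
    have := D.norm_div w
    simp only [map_mul, D.s_n] at h1
    have h2 : D.n * D.n * D.n *
      ((D.s w / w) * D.s (D.s w / w) * D.s (D.s (D.s w / w))) = 1 := by
      rw [← h1]; simp only [mul_assoc, mul_comm, mul_left_comm]
    rw [this, D.n_mul_n] at h2
    exact D.n_ne_one (by simpa using h2)

lemma norm_r (u : E) : D.r u * D.s (D.r u) * D.s (D.s (D.r u)) =
    (D.t (u * D.s u * D.s (D.s u)))⁻¹ := by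
  simp only [r_apply, map_inv, map_mul, D.s_t, D.s_s_s, ← mul_inv]
  congr 1
  simp only [mul_comm, mul_left_comm]

lemma norm_mul_r (u : E) :
    (u * D.r u) * D.s (u * D.r u) * D.s (D.s (u * D.r u)) = 1 := by
  have h : (u * D.r u) * D.s (u * D.r u) * D.s (D.s (u * D.r u)) = (u * D.s u * D.s (D.s u)) *
      (D.r u * D.s (D.r u) * D.s (D.s (D.r u))) := by
    simp only [map_mul]
    simp only [mul_assoc, mul_comm, mul_left_comm]
  rw [h, D.norm_r]
  rcases D.norm_mem u with h | h <;> rw [h] <;> simp [D.t_n]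

/-- For `u` in the minus part, `u · ρ(u)` comes from a `τ`-invariant element. -/
lemma exists_fixed_of_mem_minus {u : E} (hu : u ∈ D.minus) :
    ∃ v, D.t v = v ∧ u * D.r u = D.s v / v := by
  obtain ⟨w, hw⟩ := D.exists_eq_div (D.mem_minus.1 hu) (D.norm_mul_r u)
  have hr : D.r (D.s w / w) = D.s w / w := by
    rw [← hw, map_mul, D.r_r, mul_comm]
  obtain ⟨v, h1, h2, -⟩ := D.exists_fixed_of_r_eq hr
  exact ⟨v, h1, by rw [h2, hw]⟩

/-- The subgroup generated by the units of the proper subfields. -/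
def E0 : Subgroup E :=
  Subgroup.closure {u | D.s u = u ∨ D.t u = u ∨ D.s (D.s (D.t u)) = u ∨ D.s (D.t u) = u}

lemma mem_E0_s {u : E} (h : D.s u = u) : u ∈ D.E0 := Subgroup.subset_closure (Or.inl h)
lemma mem_E0_t {u : E} (h : D.t u = u) : u ∈ D.E0 := Subgroup.subset_closure (Or.inr (Or.inl h))
lemma mem_E0_st {u : E} (h : D.s (D.t u) = u) : u ∈ D.E0 :=
  Subgroup.subset_closure (Or.inr (Or.inr (Or.inr h)))

lemma Y_le_E0 : D.Y ≤ D.E0 := by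
  have key : ∀ w, D.s w / w ∈ D.E0 := by
    intro w
    have : D.s w / w = (D.t w * D.s w) / (w * D.t w) := by
      apply Additive.ofMul.injective
      simp only [ofMul_mul, ofMul_div, ofMul_inv, ofMul_pow]
      abel
    rw [this]
    refine Subgroup.div_mem _ (D.mem_E0_st ?_) (D.mem_E0_t ?_)
    · rw [map_mul, map_mul, D.t_t, D.s_t_s, mul_comm]
    · rw [map_mul, D.t_t, mul_comm]
  intro u hu
  obtain ⟨w, rfl | rfl⟩ := D.mem_Y.1 hu
  · exact key w
  · exact mul_mem (D.mem_E0_s D.s_n) (key w)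

/-- The subgroup generated by `Y` and `z`. -/
def YZ : Subgroup E := Subgroup.zpowers D.z ⊔ D.Y

lemma YZ_le_E0 : D.YZ ≤ D.E0 :=
  sup_le (by rw [Subgroup.zpowers_le]; exact D.mem_E0_s D.s_z) D.Y_le_E0

lemma YZ_le_plus : D.YZ ≤ D.plus :=
  sup_le (by rw [Subgroup.zpowers_le]; exact D.z_mem_plus) D.Y_le_plus

lemma z_mem_YZ : D.z ∈ D.YZ := Subgroup.mem_sup_left (Subgroup.mem_zpowers _)

lemma E0_le_of_minus (h : D.minus ≤ D.Y) : D.E0 ≤ D.YZ := by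
  rw [E0, Subgroup.closure_le]
  have hY : D.Y ≤ D.YZ := le_sup_right
  rintro u (hu | hu | hu | hu)
  · obtain ⟨i, j, rfl⟩ := D.fixed u hu
    exact mul_mem (pow_mem (hY D.n_mem) _) (pow_mem D.z_mem_YZ _)
  · refine hY (h (D.mem_minus.2 ?_))
    rw [r_apply, hu, ← div_eq_mul_inv]; exact D.div_s_mem u
  · refine hY (h (D.mem_minus.2 ?_))
    have : D.s (D.t u) = D.s (D.s u) := by
      rw [D.s_s_t] at hu
      have h2 : D.t u = D.s u := by
        conv_lhs => rw [← hu]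
        rw [D.t_t]
      rw [h2]
    rw [r_apply, this, ← div_eq_mul_inv, ← div_mul_div_cancel u (D.s u)]
    exact mul_mem (D.div_s_mem u) (D.div_s_mem _)
  · refine hY (h (D.mem_minus.2 ?_))
    rw [r_apply, hu, mul_inv_cancel]; exact one_mem _

lemma minus_le_E0 : D.minus ≤ D.E0 := by
  intro u hu
  obtain ⟨v, hv, h⟩ := D.exists_fixed_of_mem_minus hu
  have h1 : D.s (D.t (u * v)) = u * v := by
    rw [map_mul, map_mul, hv]
    rw [r_apply, ← div_eq_mul_inv, div_eq_div_iff_mul_eq_mul] at h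
    rw [h, mul_comm]
  have := Subgroup.div_mem _ (D.mem_E0_st h1) (D.mem_E0_t hv)
  simpa using this

/-- The unit index is `1` or `3`, according to the size of the minus part. -/
theorem index_cases (hY : D.Y.index = 9) (hz : D.z ∉ D.Y) :
    (D.E0.index = 1 ∧ D.Y.relIndex D.plus = 3 ∧ D.Y.relIndex D.minus = 3) ∨
    (D.E0.index = 3 ∧ D.Y.relIndex D.plus = 9 ∧ D.Y.relIndex D.minus = 1) := by
  have hYZ1 : D.Y.relIndex D.YZ ≠ 1 := by
    rw [Ne, Subgroup.relIndex_eq_one]; exact fun h => hz (h D.z_mem_YZ)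
  have hmul := Subgroup.relIndex_mul_index (H := D.Y) (K := D.YZ) le_sup_right
  have hle : D.Y.relIndex D.YZ ∣ 3 := by
    rw [YZ, Subgroup.relIndex_sup_right]
    refine (Subgroup.relIndex_dvd_card _ _).trans ?_
    rw [Nat.card_zpowers]
    exact orderOf_dvd_of_pow_eq_one D.z_pow
  have h3 : D.Y.relIndex D.YZ = 3 := ((Nat.dvd_prime Nat.prime_three).1 hle).resolve_left hYZ1
  have hYZi : D.YZ.index = 3 := by rw [h3, hY] at hmul; omega
  have hmul0 := Subgroup.relIndex_mul_index D.YZ_le_E0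
  have hmulp := Subgroup.relIndex_mul_relIndex D.Y D.YZ D.plus le_sup_right D.YZ_le_plus
  have hmulm := D.relIndex_minus_mul
  rw [h3, D.relIndex_plus] at hmulp
  rw [hY] at hmulm
  rw [hYZi] at hmul0
  by_cases hm : D.minus ≤ D.Y
  · right
    have h1 : D.Y.relIndex D.minus = 1 := Subgroup.relIndex_eq_one.2 hm
    have h0 : D.E0 = D.YZ := le_antisymm (D.E0_le_of_minus hm) D.YZ_le_E0
    refine ⟨by rw [h0, hYZi], ?_, h1⟩
    rw [D.relIndex_plus]; rw [h1] at hmulm; omega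
  · left
    have h1 : D.Y.relIndex D.minus ≠ 1 := fun h => hm (Subgroup.relIndex_eq_one.1 h)
    have hne : D.minus.index ≠ 1 := by
      intro h; rw [h] at hmulp; omega
    have hd : D.minus.index ∣ 3 ^ 2 := ⟨D.Y.relIndex D.minus, by rw [mul_comm]; exact hmulm.symm⟩
    have hmi : D.minus.index = 3 := by
      obtain ⟨k, hk, hk'⟩ := (Nat.dvd_prime_pow Nat.prime_three).1 hd
      interval_cases k
      · simp_all
      · simpa using hk'
      · rw [hk'] at hmulm; omega
    refine ⟨?_, by rw [D.relIndex_plus, hmi], by rw [hmi] at hmulm; omega⟩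
    obtain ⟨u, hu, hu'⟩ := Set.not_subset.1 hm
    have hYZE : D.YZ.relIndex D.E0 ≠ 1 := by
      rw [Ne, Subgroup.relIndex_eq_one]
      intro h
      exact hu' (D.plus_inf_minus ▸ ⟨D.YZ_le_plus (h (D.minus_le_E0 hu)), hu⟩)
    have := ((Nat.dvd_prime Nat.prime_three).1 ⟨_, hmul0.symm⟩).resolve_left hYZE
    rw [this] at hmul0; omega

/-- The endomorphism `w ↦ σ w / w`. -/
def lam : E →* E := D.s / MonoidHom.id E

lemma lam_apply (w : E) : D.lam w = D.s w / w := rfl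

lemma mem_ker_lam {w : E} : w ∈ D.lam.ker ↔ D.s w = w := by
  rw [MonoidHom.mem_ker, lam_apply, div_eq_one]

lemma ker_lam : D.lam.ker = Subgroup.zpowers D.z ⊔ Subgroup.zpowers D.n := by
  apply le_antisymm
  · intro w hw
    obtain ⟨i, j, rfl⟩ := D.fixed w (D.mem_ker_lam.1 hw)
    rw [mul_comm]
    exact Subgroup.mul_mem_sup (pow_mem (Subgroup.mem_zpowers _) _)
      (pow_mem (Subgroup.mem_zpowers _) _)
  · rw [sup_le_iff, Subgroup.zpowers_le, Subgroup.zpowers_le, mem_ker_lam, mem_ker_lam]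
    exact ⟨D.s_z, D.s_n⟩

lemma YZ_eq : D.YZ = D.lam.range ⊔ D.lam.ker := by
  rw [YZ, Y, ker_lam, ← sup_assoc, sup_comm]; rfl

lemma sq_mem_ker_lam {w : E} (hT : ∀ u, u ^ 3 ∈ D.lam.ker → u ∈ D.lam.ker)
    (h : D.lam w ∈ D.lam.ker) : w ∈ D.lam.ker := by
  apply hT
  rw [mem_ker_lam, lam_apply] at *
  set q := D.s w / w with hq
  have hn := D.norm_div w
  rw [← hq, h, h] at hn
  rw [map_pow, show D.s w = q * w by simp [hq], mul_pow, show q ^ 3 = 1 by rw [← hn]; simp [pow_succ],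
    one_mul]

lemma comap_lam (hT : ∀ u, u ^ 3 ∈ D.lam.ker → u ∈ D.lam.ker) :
    (D.YZ.map D.lam ⊔ D.lam.ker).comap D.lam = D.YZ := by
  ext w
  rw [Subgroup.mem_comap, Subgroup.mem_sup]
  constructor
  · rintro ⟨_, ⟨v, hv, rfl⟩, t, ht, h⟩
    have : w / v ∈ D.lam.ker := by
      apply D.sq_mem_ker_lam hT
      rw [map_div, ← h]; simpa using ht
    have h2 : w / v ∈ D.YZ := by rw [D.YZ_eq]; exact Subgroup.mem_sup_right this
    have := mul_mem h2 hv
    simpa using this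
  · intro hw
    exact ⟨_, ⟨w, hw, rfl⟩, 1, one_mem _, by simp⟩

lemma map_lam_eq : D.YZ.map D.lam ⊔ D.lam.ker = (powMonoidHom (α := E) 3).range ⊔ D.lam.ker := by
  have key : ∀ u, ∃ t ∈ D.lam.ker, D.lam (D.lam u) = (D.s u ^ 3)⁻¹ * t := by
    intro u
    refine ⟨u * D.s u * D.s (D.s u), ?_, ?_⟩
    · rw [mem_ker_lam, map_mul, map_mul, D.s_s_s, mul_comm, mul_assoc]
    · simp only [lam_apply, map_div]
      apply Additive.ofMul.injective
      simp only [ofMul_mul, ofMul_div, ofMul_inv, ofMul_pow]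
      abel
  apply le_antisymm
  · rw [sup_le_iff]
    refine ⟨?_, le_sup_right⟩
    rintro _ ⟨w, hw, rfl⟩
    rw [D.YZ_eq] at hw
    obtain ⟨_, ⟨v, rfl⟩, t, ht, rfl⟩ := Subgroup.mem_sup.1 hw
    obtain ⟨t', ht', h⟩ := key v
    rw [map_mul, ht, mul_one, h]
    exact Subgroup.mul_mem_sup (inv_mem ⟨D.s v, rfl⟩) ht'
  · rw [sup_le_iff]
    refine ⟨?_, le_sup_right⟩
    rintro _ ⟨u, rfl⟩
    obtain ⟨t, ht, h⟩ := key (D.s (D.s u))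
    rw [D.s_s_s] at h
    have : powMonoidHom 3 u = D.lam (D.lam (D.s (D.s u)))⁻¹ * t := by
      rw [map_inv, h]; simp
    rw [this]
    refine Subgroup.mul_mem_sup ⟨_, inv_mem ?_, rfl⟩ ht
    rw [D.YZ_eq]
    exact Subgroup.mem_sup_left ⟨_, rfl⟩

lemma index_YZ (hT : ∀ u, u ^ 3 ∈ D.lam.ker → u ∈ D.lam.ker)
    (h9 : ((powMonoidHom (α := E) 3).range ⊔ D.lam.ker).index = 9) : D.YZ.index = 3 := by
  have h1 := Subgroup.index_comap (D.YZ.map D.lam ⊔ D.lam.ker) D.lam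
  set P := D.YZ.map D.lam ⊔ D.lam.ker with hP
  have hsup : P.relIndex (D.lam.range ⊔ P) = P.relIndex D.lam.range :=
    Subgroup.relIndex_sup_right D.lam.range P
  rw [D.comap_lam hT, ← hsup] at h1
  have h2 : D.lam.range ⊔ P = D.YZ := by
    rw [hP, ← sup_assoc, sup_eq_left.2 (Subgroup.map_le_range D.lam D.YZ), D.YZ_eq]
  rw [h2] at h1
  have h3 := Subgroup.relIndex_mul_index (H := P) (K := D.YZ)
    (h2 ▸ le_sup_right)
  rw [← h1, hP, D.map_lam_eq, h9] at h3
  nlinarith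

lemma index_Y (hT : ∀ u, u ^ 3 ∈ D.lam.ker → u ∈ D.lam.ker)
    (h9 : ((powMonoidHom (α := E) 3).range ⊔ D.lam.ker).index = 9) (hz : D.z ∉ D.Y) :
    D.Y.index = 9 := by
  have hYZ1 : D.Y.relIndex D.YZ ≠ 1 := by
    rw [Ne, Subgroup.relIndex_eq_one]; exact fun h => hz (h D.z_mem_YZ)
  have hmul := Subgroup.relIndex_mul_index (H := D.Y) (K := D.YZ) le_sup_right
  have hle : D.Y.relIndex D.YZ ∣ 3 := by
    rw [YZ, Subgroup.relIndex_sup_right]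
    refine (Subgroup.relIndex_dvd_card _ _).trans ?_
    rw [Nat.card_zpowers]
    exact orderOf_dvd_of_pow_eq_one D.z_pow
  rw [((Nat.dvd_prime Nat.prime_three).1 hle).resolve_left hYZ1, D.index_YZ hT h9] at hmul
  omega

end UnitAction

section Counting

variable {A : Type*} [CommGroup A]

lemma pow_mod_three {a : A} (ha : a ^ 3 = 1) (n : ℕ) : ∃ i : Fin 3, a ^ n = a ^ (i : ℕ) :=
  ⟨⟨n % 3, Nat.mod_lt _ (by norm_num)⟩, by
    conv_lhs => rw [← Nat.div_add_mod n 3, pow_add, pow_mul, ha, one_pow, one_mul]⟩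

/-- A subgroup of order nine of a group of exponent three with three generators has together with
a further generator the full group as span. -/
lemma exists_mul_pow_of_card_eq_nine {H : Subgroup A} (hH : Nat.card H = 9) {a b c : A}
    (ha : a ^ 3 = 1) (hb : b ^ 3 = 1) (hc : c ^ 3 = 1)
    (hgen : ∀ h ∈ H, ∃ i j k : ℕ, h = a ^ i * b ^ j * c ^ k) (hcH : c ∉ H) (i j k : ℕ) :
    ∃ h ∈ H, ∃ z : ℕ, a ^ i * b ^ j * c ^ k = h * c ^ z := by
  have : Finite H := Nat.finite_of_card_ne_zero (by rw [hH]; norm_num)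
  let f : Fin 3 × Fin 3 × Fin 3 → A := fun t => a ^ (t.1 : ℕ) * b ^ (t.2.1 : ℕ) * c ^ (t.2.2 : ℕ)
  let g : H × Fin 3 → A := fun t => t.1 * c ^ (t.2 : ℕ)
  have hf : ∀ i j k : ℕ, a ^ i * b ^ j * c ^ k ∈ Set.range f := by
    intro i j k
    obtain ⟨i', hi⟩ := pow_mod_three ha i
    obtain ⟨j', hj⟩ := pow_mod_three hb j
    obtain ⟨k', hk⟩ := pow_mod_three hc k
    exact ⟨(i', j', k'), by rw [hi, hj, hk]⟩
  have hc2 : c ^ 2 ∉ H := by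
    intro h
    apply hcH
    have h2 := pow_mem h 2
    rwa [← pow_mul, show 2 * 2 = 3 + 1 by norm_num, pow_add, hc, one_mul, pow_one] at h2
  have hg : Function.Injective g := by
    have key : ∀ h h' : H, ∀ s t : Fin 3, s ≤ t → (h : A) * c ^ (s : ℕ) = h' * c ^ (t : ℕ) →
        s = t := by
      intro h h' s t hst he
      have hmem : c ^ ((t : ℕ) - s) ∈ H := by
        have h1 : c ^ ((t : ℕ) - s) = (h' : A)⁻¹ * h := by
          rw [eq_inv_mul_iff_mul_eq]
          apply mul_right_cancel (b := c ^ (s : ℕ))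
          rw [mul_assoc, ← pow_add, Nat.sub_add_cancel hst, he]
        rw [h1]; exact mul_mem (inv_mem h'.2) h.2
      have hlt : (t : ℕ) - s < 3 := lt_of_le_of_lt (Nat.sub_le _ _) t.2
      have h0 : (t : ℕ) - s ≠ 1 := fun h => hcH (by rwa [h, pow_one] at hmem)
      have h1 : (t : ℕ) - s ≠ 2 := fun h => hc2 (by rwa [h] at hmem)
      have : (s : ℕ) ≤ t := hst
      apply Fin.ext
      omega
    rintro ⟨h, s⟩ ⟨h', t⟩ he
    change (h : A) * c ^ (s : ℕ) = h' * c ^ (t : ℕ) at he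
    have hst : s = t := by
      rcases le_total s t with hle | hle
      · exact key h h' s t hle he
      · exact (key h' h t s hle he.symm).symm
    subst hst
    rw [Prod.mk.injEq]
    exact ⟨Subtype.ext (mul_right_cancel he), rfl⟩
  have hsub : Set.range g ⊆ Set.range f := by
    rintro _ ⟨⟨h, s⟩, rfl⟩
    obtain ⟨i, j, k, hh⟩ := hgen h h.2
    change (h : A) * c ^ (s : ℕ) ∈ _
    rw [hh, mul_assoc, ← pow_add]
    exact hf _ _ _
  have hcard : (Set.range f).ncard ≤ (Set.range g).ncard := by
    have h1 : (Set.range g).ncard = 27 := by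
      rw [← Set.image_univ, Set.ncard_image_of_injective _ hg, Set.ncard_univ, Nat.card_prod, hH,
        Nat.card_eq_fintype_card, Fintype.card_fin]
    have h2 : (Set.range f).ncard ≤ 27 := by
      rw [← Set.image_univ]
      refine (Set.ncard_image_le).trans ?_
      rw [Set.ncard_univ, Nat.card_eq_fintype_card]; simp
    rw [h1]; exact h2
  have heq := Set.eq_of_subset_of_ncard_le hsub hcard
  obtain ⟨⟨h, s⟩, hs⟩ := heq.symm ▸ hf i j k
  exact ⟨h, h.2, s, hs.symm⟩

lemma mem_of_card_eq_nine {H : Subgroup A} (hH : Nat.card H = 9) {a b : A}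
    (ha : a ^ 3 = 1) (hb : b ^ 3 = 1) (hgen : ∀ h ∈ H, ∃ i j : ℕ, h = a ^ i * b ^ j) : b ∈ H := by
  have : Finite H := Nat.finite_of_card_ne_zero (by rw [hH]; norm_num)
  let f : Fin 3 × Fin 3 → A := fun t => a ^ (t.1 : ℕ) * b ^ (t.2 : ℕ)
  have hsub : (H : Set A) ⊆ Set.range f := by
    intro h hh
    obtain ⟨i, j, rfl⟩ := hgen h hh
    obtain ⟨i', hi⟩ := pow_mod_three ha i
    obtain ⟨j', hj⟩ := pow_mod_three hb j
    exact ⟨(i', j'), by rw [hi, hj]⟩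
  have hcard : (Set.range f).ncard ≤ (H : Set A).ncard := by
    have h1 : (H : Set A).ncard = 9 := hH
    rw [h1, ← Set.image_univ]
    refine (Set.ncard_image_le).trans ?_
    rw [Set.ncard_univ, Nat.card_eq_fintype_card]; simp
  have heq := Set.eq_of_subset_of_ncard_le hsub hcard
  have : b ∈ Set.range f := ⟨(0, 1), by simp [f]⟩
  rw [← heq] at this
  exact this

end Counting

/-- The normal closure `K = ℚ(θ, ζ)` of a pure cubic field `L = ℚ(θ)`, `θ³ = d`, with
`k₀ = ℚ(ζ)` and the standard generators `σ`, `τ` of its Galois group. -/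
structure PureCubic (K : Type*) [Field K] [NumberField K] where
  θ : K
  ζ : K
  d : ℕ
  σ : K ≃ₐ[ℚ] K
  τ : K ≃ₐ[ℚ] K
  k0 : IntermediateField ℚ K
  L : IntermediateField ℚ K
  ζ_eq : ζ ^ 2 + ζ + 1 = 0
  θ_pow : θ ^ 3 = d
  σ_ζ : σ ζ = ζ
  σ_θ : σ θ = ζ * θ
  τ_ζ : τ ζ = ζ ^ 2
  τ_θ : τ θ = θ
  k0_eq : k0 = ℚ⟮ζ⟯
  L_eq : L = ℚ⟮θ⟯
  gen : Algebra.adjoin ℚ {θ, ζ} = ⊤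
  noncube : ∀ x : ℚ, x ^ 3 ≠ d

lemma AlgEquiv.apply_eq_of_mem_zpowers {F K : Type*} [Field F] [Field K] [Algebra F K]
    {g f : K ≃ₐ[F] K} {x : K} (h : g x = x) (hf : f ∈ Subgroup.zpowers g) : f x = x := by
  have : Subgroup.zpowers g ≤ MulAction.stabilizer (K ≃ₐ[F] K) x := by
    rw [Subgroup.zpowers_le]; exact h
  exact this hf

namespace PureCubic

variable {K : Type*} [Field K] [NumberField K] (D : PureCubic K)

lemma d_ne_zero : D.d ≠ 0 := by
  intro h
  have := D.noncube 0
  simp [h] at this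

lemma θ_ne_zero : D.θ ≠ 0 := by
  intro h
  have := D.θ_pow
  rw [h] at this
  simp at this
  exact D.d_ne_zero (by exact_mod_cast this.symm)

lemma ζ_sq : D.ζ ^ 2 = -1 - D.ζ := by linear_combination D.ζ_eq

lemma ζ_pow : D.ζ ^ 3 = 1 := by linear_combination (D.ζ - 1) * D.ζ_eq

lemma ζ_ne_zero : D.ζ ≠ 0 := by
  intro h; have := D.ζ_eq; rw [h] at this; simp at this

lemma ζ_ne_one : D.ζ ≠ 1 := by
  intro h; have := D.ζ_eq; rw [h] at this; norm_num at this

lemma ζ_prim : IsPrimitiveRoot D.ζ 3 :=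
  IsPrimitiveRoot.mk_of_lt _ (by norm_num) D.ζ_pow (by
    intro l h1 h2
    interval_cases l
    · simpa using D.ζ_ne_one
    · rw [D.ζ_sq]; intro h
      have h3 : D.ζ = -2 := by linear_combination -h
      have := D.ζ_eq
      rw [h3] at this; norm_num at this)

/-- Elements of `ℚ + ℚζ`. -/
def qz (a b : ℚ) : K := algebraMap ℚ K a + algebraMap ℚ K b * D.ζ

lemma qz_mul (a b a' b' : ℚ) :
    D.qz a b * D.qz a' b' = D.qz (a * a' - b * b') (a * b' + a' * b - b * b') := by
  simp only [qz, map_add, map_mul, map_sub]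
  linear_combination (algebraMap ℚ K b * algebraMap ℚ K b') * D.ζ_eq

lemma qz_add (a b a' b' : ℚ) : D.qz a b + D.qz a' b' = D.qz (a + a') (b + b') := by
  simp only [qz, map_add]; ring

lemma σ_qz (a b : ℚ) : D.σ (D.qz a b) = D.qz a b := by
  simp [qz, D.σ_ζ]

lemma exists_coord (x : K) : ∃ a a' b b' c c' : ℚ,
    x = D.qz a a' + D.qz b b' * D.θ + D.qz c c' * D.θ ^ 2 := by
  have hx : x ∈ Algebra.adjoin ℚ {D.θ, D.ζ} := by rw [D.gen]; trivial
  induction hx using Algebra.adjoin_induction with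
  | mem x hx =>
    rcases hx with rfl | hx
    · exact ⟨0, 0, 1, 0, 0, 0, by simp [qz]⟩
    · rw [Set.mem_singleton_iff] at hx; subst hx; exact ⟨0, 1, 0, 0, 0, 0, by simp [qz]⟩
  | algebraMap r => exact ⟨r, 0, 0, 0, 0, 0, by simp [qz]⟩
  | add x y _ _ hx hy =>
    obtain ⟨a, a', b, b', c, c', rfl⟩ := hx
    obtain ⟨e, e', f, f', g, g', rfl⟩ := hy
    refine ⟨a + e, a' + e', b + f, b' + f', c + g, c' + g', ?_⟩
    simp only [← qz_add]; ring
  | mul x y _ _ hx hy =>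
    obtain ⟨a, a', b, b', c, c', rfl⟩ := hx
    obtain ⟨e, e', f, f', g, g', rfl⟩ := hy
    have h : (D.qz a a' + D.qz b b' * D.θ + D.qz c c' * D.θ ^ 2) *
        (D.qz e e' + D.qz f f' * D.θ + D.qz g g' * D.θ ^ 2) =
        (D.qz a a' * D.qz e e' + D.qz D.d 0 * (D.qz b b' * D.qz g g' + D.qz c c' * D.qz f f')) +
        (D.qz a a' * D.qz f f' + D.qz b b' * D.qz e e' + D.qz D.d 0 * (D.qz c c' * D.qz g g')) * D.θ
        + (D.qz a a' * D.qz g g' + D.qz b b' * D.qz f f' + D.qz c c' * D.qz e e') * D.θ ^ 2 := by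
      have : D.qz D.d 0 = D.θ ^ 3 := by rw [D.θ_pow]; simp [qz]
      rw [this]; ring
    rw [h]
    simp only [qz_mul, qz_add]
    exact ⟨_, _, _, _, _, _, rfl⟩

lemma indep {a b c : K} (ha : D.σ a = a) (hb : D.σ b = b) (hc : D.σ c = c)
    (h : a + b * D.θ + c * D.θ ^ 2 = 0) : a = 0 ∧ b = 0 ∧ c = 0 := by
  have h1 := congrArg D.σ h
  have h2 := congrArg D.σ h1
  simp only [map_add, map_mul, map_pow, ha, hb, hc, D.σ_θ, map_zero, D.σ_ζ] at h1 h2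
  have hz := D.ζ_eq
  have ht := D.θ_ne_zero
  have a0 : 3 * a = 0 := by
    linear_combination h + h1 + h2 - b * D.θ * hz - c * D.θ ^ 2 * (D.ζ ^ 2 - D.ζ + 1) * hz
  have a0' : a = 0 := by simpa using a0
  subst a0'
  have hb0 : 3 * (b * D.θ) = 0 := by
    linear_combination h + D.ζ ^ 2 * h1 + D.ζ * h2 - (c * D.θ ^ 2 * (1+ D.ζ^3-D.ζ) + b * D.θ * (2 * D.ζ - 2)) * hz
  have hb' : b = 0 := by simpa [ht] using hb0
  subst hb'
  refine ⟨rfl, rfl, by simpa [ht] using h⟩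

lemma exists_of_σ {x : K} (h : D.σ x = x) : ∃ a b : ℚ, x = D.qz a b := by
  obtain ⟨a, a', b, b', c, c', rfl⟩ := D.exists_coord x
  simp only [map_add, map_mul, map_pow, D.σ_θ, σ_qz] at h
  obtain ⟨-, hb, hc⟩ := D.indep (a := 0) (b := D.qz b b' * (D.ζ - 1))
    (c := D.qz c c' * (D.ζ ^ 2 - 1)) (by simp) (by simp [σ_qz, σ_ζ]) (by simp [σ_qz, σ_ζ])
    (by linear_combination h)
  have h1 : D.ζ - 1 ≠ 0 := sub_ne_zero.2 D.ζ_ne_one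
  have h2 : D.ζ ^ 2 - 1 ≠ 0 := sub_ne_zero.2 (D.ζ_prim.pow_ne_one_of_pos_of_lt (by norm_num) (by norm_num))
  refine ⟨a, a', ?_⟩
  rw [(mul_eq_zero.1 hb).resolve_right h1, (mul_eq_zero.1 hc).resolve_right h2]; ring

lemma τ_qz (a b : ℚ) : D.τ (D.qz a b) = D.qz (a - b) (-b) := by
  simp only [qz, map_add, map_mul, D.τ_ζ, AlgEquiv.commutes, map_sub, map_neg, D.ζ_sq]
  ring

lemma qz_inj {a b a' b' : ℚ} (h : D.qz a b = D.qz a' b') : a = a' ∧ b = b' := by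
  have h1 := congrArg D.τ h
  rw [τ_qz, τ_qz] at h1
  simp only [qz, map_sub, map_neg] at h h1
  have hz : (1 + 2 * D.ζ) ^ 2 = -3 := by linear_combination 4 * D.ζ_eq
  have hne : 1 + 2 * D.ζ ≠ 0 := by intro h0; rw [h0] at hz; norm_num at hz
  have hb : (algebraMap ℚ K b - algebraMap ℚ K b') * (1 + 2 * D.ζ) = 0 := by
    linear_combination h - h1
  have hb' : algebraMap ℚ K b = algebraMap ℚ K b' :=
    sub_eq_zero.1 ((mul_eq_zero.1 hb).resolve_right hne)
  have ha : algebraMap ℚ K a = algebraMap ℚ K a' := by rw [hb'] at h; simpa using h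
  exact ⟨(algebraMap ℚ K).injective ha, (algebraMap ℚ K).injective hb'⟩

lemma exists_of_τ {x : K} (h : D.τ x = x) : ∃ a b c : ℚ,
    x = algebraMap ℚ K a + algebraMap ℚ K b * D.θ + algebraMap ℚ K c * D.θ ^ 2 := by
  obtain ⟨a, a', b, b', c, c', rfl⟩ := D.exists_coord x
  simp only [map_add, map_mul, map_pow, D.τ_θ, τ_qz] at h
  obtain ⟨h1, h2, h3⟩ := D.indep (a := D.qz (a - a') (-a') - D.qz a a')
    (b := D.qz (b - b') (-b') - D.qz b b') (c := D.qz (c - c') (-c') - D.qz c c')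
    (by simp [σ_qz]) (by simp [σ_qz]) (by simp [σ_qz]) (by linear_combination h)
  have e1 := D.qz_inj (sub_eq_zero.1 h1)
  have e2 := D.qz_inj (sub_eq_zero.1 h2)
  have e3 := D.qz_inj (sub_eq_zero.1 h3)
  have a0 : a' = 0 := by linarith [e1.1]
  have b0 : b' = 0 := by linarith [e2.1]
  have c0 : c' = 0 := by linarith [e3.1]
  exact ⟨a, b, c, by simp [qz, a0, b0, c0]⟩

lemma exists_rat {x : K} (h : D.σ x = x) (h' : D.τ x = x) : ∃ a : ℚ, x = algebraMap ℚ K a := by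
  obtain ⟨a, b, rfl⟩ := D.exists_of_σ h
  rw [τ_qz] at h'
  have := (D.qz_inj h').1
  exact ⟨a, by simp [qz, show b = 0 by linarith]⟩

lemma ext_of {f g : K →ₐ[ℚ] K} (h1 : f D.θ = g D.θ) (h2 : f D.ζ = g D.ζ) : f = g := by
  refine AlgHom.ext_of_adjoin_eq_top D.gen ?_
  rintro x (rfl | hx)
  · exact h1
  · rw [Set.mem_singleton_iff] at hx; subst hx; exact h2

lemma σ_σ_σ (x : K) : D.σ (D.σ (D.σ x)) = x := by
  have := D.ext_of (f := ((D.σ : K →ₐ[ℚ] K).comp ((D.σ : K →ₐ[ℚ] K).comp (D.σ : K →ₐ[ℚ] K))))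
    (g := AlgHom.id ℚ K) (by simp [D.σ_θ, D.σ_ζ]; linear_combination D.θ * D.ζ_pow) (by simp [D.σ_ζ])
  exact congrArg (fun f => f x) this

lemma τ_τ (x : K) : D.τ (D.τ x) = x := by
  have := D.ext_of (f := ((D.τ : K →ₐ[ℚ] K).comp (D.τ : K →ₐ[ℚ] K)))
    (g := AlgHom.id ℚ K) (by simp [D.τ_θ]) (by simp [D.τ_ζ]; linear_combination D.ζ * D.ζ_pow)
  exact congrArg (fun f => f x) this

lemma σ_τ (x : K) : D.σ (D.τ x) = D.τ (D.σ (D.σ x)) := by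
  have := D.ext_of (f := ((D.σ : K →ₐ[ℚ] K).comp (D.τ : K →ₐ[ℚ] K)))
    (g := ((D.τ : K →ₐ[ℚ] K).comp ((D.σ : K →ₐ[ℚ] K).comp (D.σ : K →ₐ[ℚ] K))))
    (by simp [D.τ_θ, D.σ_θ, D.σ_ζ, D.τ_ζ]; linear_combination -D.ζ* D.θ * D.ζ_pow)
    (by simp [D.σ_ζ, D.τ_ζ])
  exact congrArg (fun f => f x) this

lemma mem_k0 {x : K} : x ∈ D.k0 ↔ D.σ x = x := by
  constructor
  · intro h
    have : D.k0 ≤ fixedField (Subgroup.zpowers D.σ) := by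
      rw [D.k0_eq, adjoin_simple_le_iff]
      rintro ⟨g, hg⟩
      exact AlgEquiv.apply_eq_of_mem_zpowers D.σ_ζ hg
    exact this h ⟨D.σ, Subgroup.mem_zpowers _⟩
  · intro h
    obtain ⟨a, b, rfl⟩ := D.exists_of_σ h
    rw [D.k0_eq]
    exact add_mem (_root_.algebraMap_mem _ _)
      (mul_mem (_root_.algebraMap_mem _ _) (mem_adjoin_simple_self _ _))

lemma mem_L {x : K} : x ∈ D.L ↔ D.τ x = x := by
  constructor
  · intro h
    have : D.L ≤ fixedField (Subgroup.zpowers D.τ) := by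
      rw [D.L_eq, adjoin_simple_le_iff]
      rintro ⟨g, hg⟩
      exact AlgEquiv.apply_eq_of_mem_zpowers D.τ_θ hg
    exact this h ⟨D.τ, Subgroup.mem_zpowers _⟩
  · intro h
    obtain ⟨a, b, c, rfl⟩ := D.exists_of_τ h
    rw [D.L_eq]
    exact add_mem (add_mem (_root_.algebraMap_mem _ _)
      (mul_mem (_root_.algebraMap_mem _ _) (mem_adjoin_simple_self _ _)))
      (mul_mem (_root_.algebraMap_mem _ _) (pow_mem (mem_adjoin_simple_self _ _) 2))

lemma k0_eq_fixedField : D.k0 = fixedField (Subgroup.zpowers D.σ) := by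
  ext x
  constructor
  · rintro h ⟨g, hg⟩
    exact AlgEquiv.apply_eq_of_mem_zpowers (D.mem_k0.1 h) hg
  · intro h
    exact D.mem_k0.2 (h ⟨D.σ, Subgroup.mem_zpowers _⟩)

lemma L_eq_fixedField : D.L = fixedField (Subgroup.zpowers D.τ) := by
  ext x
  constructor
  · rintro h ⟨g, hg⟩
    exact AlgEquiv.apply_eq_of_mem_zpowers (D.mem_L.1 h) hg
  · intro h
    exact D.mem_L.2 (h ⟨D.τ, Subgroup.mem_zpowers _⟩)

lemma τ_σ (x : K) : D.τ (D.σ x) = D.σ (D.σ (D.τ x)) := by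
  rw [D.σ_τ, D.σ_τ, D.σ_σ_σ]

/-- Hilbert's Theorem 90 for the cyclic cubic extension `K/k₀`. -/
lemma exists_σ_eq_mul {u : K} (hu : u * D.σ u * D.σ (D.σ u) = 1) :
    ∃ x : K, x ≠ 0 ∧ D.σ x = u * x := by
  have hu0 : u ≠ 0 := by rintro rfl; simp at hu
  have hσu0 : D.σ u ≠ 0 := by simpa using hu0
  set x : K → K := fun y => y + u⁻¹ * D.σ y + u⁻¹ * D.σ u⁻¹ * D.σ (D.σ y) with hx
  have h3 : D.σ (D.σ u⁻¹) = u * D.σ u := by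
    rw [map_inv₀, map_inv₀, inv_eq_iff_eq_inv]
    exact eq_inv_of_mul_eq_one_right hu
  have key : ∀ y, D.σ (x y) = u * x y := by
    intro y
    simp only [hx, map_add, map_mul, D.σ_σ_σ, h3]
    rw [map_inv₀]
    field_simp
    ring
  by_contra! hcon
  have hz : ∀ y, x y = 0 := fun y => by_contra fun h => hcon _ h (key y)
  have e1 := hz 1
  have e2 := hz D.θ
  have e3 := hz (D.θ ^ 2)
  simp only [hx, map_one, map_pow, D.σ_θ, map_mul, D.σ_ζ] at e1 e2 e3
  have ht := D.θ_ne_zero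
  generalize u⁻¹ = α at *
  generalize α * D.σ α = β at *
  have e2' : 1 + α * D.ζ + β * D.ζ ^ 2 = 0 :=
    (mul_eq_zero.1 (show D.θ * (1 + α * D.ζ + β * D.ζ ^ 2) = 0 by linear_combination e2)).resolve_left ht
  have e3' : 1 + α * D.ζ ^ 2 + β * D.ζ ^ 4 = 0 :=
    (mul_eq_zero.1 (show D.θ ^ 2 * (1 + α * D.ζ ^ 2 + β * D.ζ ^ 4) = 0 by
      linear_combination e3)).resolve_left (pow_ne_zero _ ht)
  have : (3 : K) = 0 := by
    linear_combination e1 + e2' + e3' - α * D.ζ_eq - β * (D.ζ ^ 2 - D.ζ + 1) * D.ζ_eq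
  norm_num at this

lemma isGalois (D : PureCubic K) : IsGalois ℚ K := by
  refine IsGalois.of_fixedField_eq_bot ℚ K (bot_unique fun x hx => ?_)
  obtain ⟨a, rfl⟩ := D.exists_rat (hx ⟨D.σ, trivial⟩) (hx ⟨D.τ, trivial⟩)
  exact IntermediateField.algebraMap_mem _ a

lemma isGalois_k0 : IsGalois D.k0 K := by
  have := D.isGalois
  infer_instance

lemma isGalois_L : IsGalois D.L K := by
  have := D.isGalois
  infer_instance

lemma orderOf_σ : orderOf D.σ = 3 := by
  refine orderOf_eq_prime (by ext x; exact D.σ_σ_σ x) ?_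
  intro h
  have := D.σ_θ
  rw [h] at this
  have h2 : (D.ζ - 1) * D.θ = 0 := by simp at this; linear_combination -this
  rcases mul_eq_zero.1 h2 with h | h
  · exact D.ζ_ne_one (sub_eq_zero.1 h)
  · exact D.θ_ne_zero h

lemma orderOf_τ : orderOf D.τ = 2 := by
  refine orderOf_eq_prime (by ext x; exact D.τ_τ x) ?_
  intro h
  have := D.τ_ζ
  rw [h] at this
  have h2 : (D.ζ - 1) * D.ζ = 0 := by simp at this; linear_combination -this
  rcases mul_eq_zero.1 h2 with h | h
  · exact D.ζ_ne_one (sub_eq_zero.1 h)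
  · exact D.ζ_ne_zero h

lemma finrank_k0 : Module.finrank D.k0 K = 3 := by
  rw [D.k0_eq_fixedField, finrank_fixedField_eq_card, Nat.card_zpowers, D.orderOf_σ]

lemma finrank_L : Module.finrank D.L K = 2 := by
  rw [D.L_eq_fixedField, finrank_fixedField_eq_card, Nat.card_zpowers, D.orderOf_τ]

/-- `σ` as an automorphism of `K/k₀`. -/
def σ' : K ≃ₐ[D.k0] K := AlgEquiv.ofRingEquiv (f := (D.σ : K ≃+* K))
  (fun x => D.mem_k0.1 x.2)

/-- `τ` as an automorphism of `K/L`. -/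
def τ' : K ≃ₐ[D.L] K := AlgEquiv.ofRingEquiv (f := (D.τ : K ≃+* K))
  (fun x => D.mem_L.1 x.2)

lemma σ'_apply (x : K) : D.σ' x = D.σ x := rfl
lemma τ'_apply (x : K) : D.τ' x = D.τ x := rfl

lemma norm_k0 (x : K) : (Algebra.norm D.k0 x : K) = x * D.σ x * D.σ (D.σ x) := by
  classical
  have := D.isGalois_k0
  have h := Algebra.norm_eq_prod_automorphisms D.k0 x
  have hθ := D.θ_ne_zero
  have hσ : ∀ n, (D.σ' ^ n) D.θ = D.ζ ^ n * D.θ := by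
    intro n
    induction n with
    | zero => simp
    | succ n ih => rw [pow_succ', AlgEquiv.mul_apply, ih, σ'_apply]; simp [D.σ_ζ, D.σ_θ]; ring
  have hinj : Function.Injective (fun i : Fin 3 => D.σ' ^ (i : ℕ)) := by
    intro i j hij
    have := congrArg (fun f => f D.θ) hij
    simp only [hσ] at this
    exact Fin.ext (D.ζ_prim.pow_inj i.2 j.2 (mul_right_cancel₀ hθ this))
  have hcard : Fintype.card (Fin 3) = Fintype.card (K ≃ₐ[D.k0] K) := by
    rw [← Nat.card_eq_fintype_card (α := K ≃ₐ[D.k0] K), IsGalois.card_aut_eq_finrank, D.finrank_k0]; simp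
  have hbij := (Fintype.bijective_iff_injective_and_card _).2 ⟨hinj, hcard⟩
  rw [← hbij.prod_comp (fun f => f x), Fin.prod_univ_three] at h
  rw [show (Algebra.norm D.k0 x : K) = algebraMap D.k0 K (Algebra.norm D.k0 x) from rfl, h]
  simp [pow_two, σ'_apply]

lemma norm_L (x : K) : (Algebra.norm D.L x : K) = x * D.τ x := by
  classical
  have := D.isGalois_L
  have h := Algebra.norm_eq_prod_automorphisms D.L x
  have hinj : Function.Injective (fun i : Fin 2 => D.τ' ^ (i : ℕ)) := by
    have hne : D.τ' ≠ 1 := by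
      intro h
      have h2 : D.τ = 1 := by
        ext y; exact congrArg (fun f => f y) h
      have := D.orderOf_τ
      rw [h2] at this; simp at this
    intro i j hij
    fin_cases i <;> fin_cases j <;> simp at hij ⊢
    · exact hne hij.symm
    · exact hne hij
  have hcard : Fintype.card (Fin 2) = Fintype.card (K ≃ₐ[D.L] K) := by
    rw [← Nat.card_eq_fintype_card (α := K ≃ₐ[D.L] K), IsGalois.card_aut_eq_finrank, D.finrank_L]; simp
  have hbij := (Fintype.bijective_iff_injective_and_card _).2 ⟨hinj, hcard⟩
  rw [← hbij.prod_comp (fun f => f x), Fin.prod_univ_two] at h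
  rw [show (Algebra.norm D.L x : K) = algebraMap D.L K (Algebra.norm D.L x) from rfl, h]
  simp [τ'_apply]

lemma isCyclotomicExtension : IsCyclotomicExtension {3} ℚ D.k0 := by
  rw [D.k0_eq]
  exact IsPrimitiveRoot.intermediateField_adjoin_isCyclotomicExtension ℚ D.ζ_prim

lemma finrank_ℚ_k0 : Module.finrank ℚ D.k0 = 2 := by
  have := D.isCyclotomicExtension
  rw [IsCyclotomicExtension.finrank (n := 3) D.k0 (Polynomial.cyclotomic.irreducible_rat (by norm_num))]
  decide

lemma finrank_ℚ (D : PureCubic K) : Module.finrank ℚ K = 6 := by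
  rw [← Module.finrank_mul_finrank ℚ D.k0 K, D.finrank_ℚ_k0, D.finrank_k0]

lemma isTotallyComplex (D : PureCubic K) : IsTotallyComplex K := by
  refine ⟨fun v => ?_⟩
  rw [InfinitePlace.not_isReal_iff_isComplex.symm]
  intro h
  obtain ⟨φ, hφ, rfl⟩ := h
  have h1 := congrArg φ D.ζ_eq
  simp only [map_add, map_pow, map_one, map_zero] at h1
  have him : (φ D.ζ).im = 0 := by
    have := congrArg (fun f => f D.ζ) hφ
    exact Complex.conj_eq_iff_im.1 this
  have h2 := congrArg Complex.re h1
  simp [pow_two, him] at h2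
  nlinarith [sq_nonneg ((φ D.ζ).re + 1/2)]

lemma unit_rank (D : PureCubic K) : Units.rank K = 2 := by
  have := D.isTotallyComplex
  have h := InfinitePlace.card_add_two_mul_card_eq_rank K
  rw [Units.rank, NumberField.InfinitePlace.card_eq_nrRealPlaces_add_nrComplexPlaces]
  have h2 := IsTotallyComplex.nrRealPlaces_eq_zero (K := K)
  rw [D.finrank_ℚ] at h
  omega

end PureCubic

namespace NumberField

variable {K : Type*} [Field K] [NumberField K]

lemma RingOfIntegers.exists_of_mem (F : IntermediateField ℚ K) (x : 𝓞 K) (hx : (x : K) ∈ F) :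
    ∃ y : 𝓞 F, ((y : F) : K) = x := by
  have h : IsIntegral ℤ (⟨x, hx⟩ : F) := by
    rw [← isIntegral_algebraMap_iff (B := K) (algebraMap F K).injective]
    exact x.2
  exact ⟨⟨_, h⟩, rfl⟩

lemma Units.exists_of_mem (F : IntermediateField ℚ K) (u : (𝓞 K)ˣ) (hu : ((u : 𝓞 K) : K) ∈ F) :
    ∃ v : (𝓞 F)ˣ, (((v : 𝓞 F) : F) : K) = (u : 𝓞 K) := by
  obtain ⟨x, hx⟩ := RingOfIntegers.exists_of_mem F u hu
  have hu' : ((((u⁻¹ : (𝓞 K)ˣ) : 𝓞 K)) : K) ∈ F := by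
    have h : ((((u⁻¹ : (𝓞 K)ˣ) : 𝓞 K)) : K) = (((u : 𝓞 K)) : K)⁻¹ := by
      apply eq_inv_of_mul_eq_one_left
      rw [← map_mul, Units.inv_mul, map_one]
    rw [h]; exact inv_mem hu
  obtain ⟨y, hy⟩ := RingOfIntegers.exists_of_mem F _ hu'
  have hxy : x * y = 1 := by
    apply RingOfIntegers.ext
    apply Subtype.ext
    have : ((x : F) : K) * ((y : F) : K) = 1 := by
      rw [hx, hy, ← map_mul, Units.mul_inv, map_one]
    simpa using this
  exact ⟨⟨x, y, hxy, by rw [mul_comm, hxy]⟩, hx⟩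

/-- The action of an automorphism on the unit group. -/
def Units.autMap (f : K ≃ₐ[ℚ] K) : (𝓞 K)ˣ →* (𝓞 K)ˣ :=
  _root_.Units.map ((RingOfIntegers.mapRingHom (f : K →+* K) : 𝓞 K →+* 𝓞 K) : 𝓞 K →* 𝓞 K)

lemma Units.coe_autMap (f : K ≃ₐ[ℚ] K) (u : (𝓞 K)ˣ) :
    ((Units.autMap f u : 𝓞 K) : K) = f ((u : 𝓞 K) : K) := rfl

lemma Units.ext_coe {K : Type*} [Field K] {u v : (𝓞 K)ˣ} (h : ((u : 𝓞 K) : K) = (v : 𝓞 K)) : u = v :=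
  Units.ext (RingOfIntegers.ext h)

end NumberField

namespace PureCubic

variable {K : Type*} [Field K] [NumberField K] (D : PureCubic K)

/-- `ζ` as a unit. -/
def zU : (𝓞 K)ˣ := (D.ζ_prim.toInteger_isPrimitiveRoot.isUnit (by norm_num)).unit

lemma coe_zU : ((D.zU : 𝓞 K) : K) = D.ζ := rfl

lemma exists_unit_eq {u : (𝓞 K)ˣ} (hu : D.σ ((u : 𝓞 K) : K) = (u : 𝓞 K)) :
    ∃ i j : ℕ, u = (-1) ^ i * D.zU ^ j := by
  have := D.isCyclotomicExtension
  obtain ⟨v, hv⟩ := Units.exists_of_mem D.k0 u (D.mem_k0.2 hu)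
  have hz : IsPrimitiveRoot (⟨D.ζ, D.mem_k0.2 D.σ_ζ⟩ : D.k0) 3 := by
    rw [← IsPrimitiveRoot.map_iff_of_injective (f := algebraMap D.k0 K) (algebraMap D.k0 K).injective]
    exact D.ζ_prim
  have hmem := IsCyclotomicExtension.Rat.Three.Units.mem hz v
  have key : ∀ (i j : ℕ), ((((v : 𝓞 D.k0) : D.k0)) : K) = (-1) ^ i * D.ζ ^ j →
      u = (-1) ^ i * D.zU ^ j := by
    intro i j h
    apply Units.ext_coe
    rw [← hv, h]
    simp [coe_zU]
  simp only [List.mem_cons, List.not_mem_nil, or_false] at hmem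
  have e : ∀ n : ℕ, (((((hz.toInteger_isPrimitiveRoot.isUnit (by decide)).unit ^ n :
    (𝓞 D.k0)ˣ) : 𝓞 D.k0) : D.k0) : K) = D.ζ ^ n := by
    intro n; simp; rfl
  rcases hmem with h | h | h | h | h | h
  · exact ⟨0, 0, key _ _ (by simp [h])⟩
  · exact ⟨1, 0, key _ _ (by simp [h])⟩
  · exact ⟨0, 1, key _ _ (by rw [h]; have := e 1; simp at this ⊢; exact this)⟩
  · exact ⟨1, 1, key _ _ (by rw [h]; have := e 1; simp at this ⊢; exact this)⟩
  · exact ⟨0, 2, key _ _ (by rw [h]; have := e 2; simp at this ⊢; exact this)⟩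
  · exact ⟨1, 2, key _ _ (by rw [h]; have := e 2; simp at this ⊢; exact this)⟩


/-- If `ζ` is not a norm, then the units of `k₀` which are norms are `1` and `-1`. -/
lemma norm_eq_of_unit (hN : ∀ x : K, x * D.σ x * D.σ (D.σ x) ≠ D.ζ) {x : K} {u : (𝓞 K)ˣ}
    (h : x * D.σ x * D.σ (D.σ x) = (u : 𝓞 K)) :
    x * D.σ x * D.σ (D.σ x) = 1 ∨ x * D.σ x * D.σ (D.σ x) = -1 := by
  have hσ : D.σ ((u : 𝓞 K) : K) = (u : 𝓞 K) := by
    rw [← h]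
    simp only [map_mul, D.σ_σ_σ]; ring
  obtain ⟨i, j, rfl⟩ := D.exists_unit_eq hσ
  have hu : x * D.σ x * D.σ (D.σ x) = (-1) ^ i * D.ζ ^ j := by
    rw [h]; simp [coe_zU]
  have hz : D.ζ ^ j = 1 := by
    have h3 : D.ζ ^ j = D.ζ ^ (j % 3) := by
      conv_lhs => rw [← Nat.div_add_mod j 3, pow_add, pow_mul, D.ζ_pow, one_pow, one_mul]
    have h2 : j % 3 < 3 := Nat.mod_lt _ (by norm_num)
    have hs : ((-1 : K) ^ i) ^ 2 = 1 := by rw [← pow_mul, mul_comm, pow_mul]; simp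
    have hs4 : ((-1 : K) ^ i) ^ 4 = 1 := by rw [show 4 = 2 * 2 by rfl, pow_mul, hs, one_pow]
    have hσs : D.σ ((-1) ^ i) = (-1) ^ i := by simp
    rw [h3] at hu ⊢
    interval_cases j % 3
    · simp
    · exfalso
      apply hN ((-1) ^ i * x)
      simp only [map_mul, hσs]
      linear_combination ((-1 : K) ^ i) ^ 3 * hu + D.ζ * hs4
    · exfalso
      apply hN (((-1) ^ i * x)⁻¹)
      simp only [map_mul, hσs, map_inv₀]
      rw [← mul_inv, ← mul_inv]
      apply inv_eq_of_mul_eq_one_left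
      linear_combination D.ζ * (((-1 : K) ^ i) ^ 3 * hu + D.ζ ^ 2 * hs4) + D.ζ_pow
  rw [hz, mul_one] at hu
  rw [hu]
  exact neg_one_pow_eq_or K i

/-- The unit group of `K` with its Galois action, provided `ζ` is not a norm from `K`. -/
def unitAction (hN : ∀ x : K, x * D.σ x * D.σ (D.σ x) ≠ D.ζ) : UnitAction (𝓞 K)ˣ where
  s := Units.autMap D.σ
  t := Units.autMap D.τ
  n := -1
  z := D.zU
  s_s_s u := Units.ext_coe (D.σ_σ_σ _)
  t_t u := Units.ext_coe (D.τ_τ _)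
  s_t u := Units.ext_coe (D.σ_τ _)
  n_mul_n := by simp
  n_ne_one := by
    intro h
    have := congrArg (fun u : (𝓞 K)ˣ => ((u : 𝓞 K) : K)) h
    norm_num at this
  z_pow := Units.ext_coe (by simpa [coe_zU] using D.ζ_pow)
  s_n := Units.ext_coe (by simp [Units.coe_autMap])
  t_n := Units.ext_coe (by simp [Units.coe_autMap])
  s_z := Units.ext_coe (by simp [Units.coe_autMap, coe_zU, D.σ_ζ])
  t_z := by
    apply eq_inv_of_mul_eq_one_left
    apply Units.ext_coe
    simp only [Units.val_mul, map_mul, Units.coe_autMap, coe_zU, D.τ_ζ, Units.val_one, map_one]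
    linear_combination D.ζ_pow
  norm_mem u := by
    rcases D.norm_eq_of_unit hN (x := (u : 𝓞 K))
      (u := u * Units.autMap D.σ u * Units.autMap D.σ (Units.autMap D.σ u))
      (by simp [Units.coe_autMap]) with h | h
    · left; apply Units.ext_coe; simpa [Units.coe_autMap] using h
    · right; apply Units.ext_coe; simpa [Units.coe_autMap] using h
  fixed u hu := by
    apply D.exists_unit_eq
    exact congrArg (fun u : (𝓞 K)ˣ => ((u : 𝓞 K) : K)) hu

variable (hN : ∀ x : K, x * D.σ x * D.σ (D.σ x) ≠ D.ζ)

lemma s_apply (u : (𝓞 K)ˣ) : ((((D.unitAction hN).s u : (𝓞 K)ˣ) : 𝓞 K) : K) = D.σ (u : 𝓞 K) := rfl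
lemma t_apply (u : (𝓞 K)ˣ) : ((((D.unitAction hN).t u : (𝓞 K)ˣ) : 𝓞 K) : K) = D.τ (u : 𝓞 K) := rfl

/-- The torsion units are exactly the units of `k₀`. -/
lemma ker_lam_eq_torsion : (D.unitAction hN).lam.ker = Units.torsion K := by
  apply le_antisymm
  · rw [(D.unitAction hN).ker_lam, sup_le_iff, Subgroup.zpowers_le, Subgroup.zpowers_le]
    constructor
    · exact isOfFinOrder_iff_pow_eq_one.2 ⟨3, by norm_num, (D.unitAction hN).z_pow⟩
    · exact isOfFinOrder_iff_pow_eq_one.2 ⟨2, by norm_num, by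
        rw [pow_two]; exact (D.unitAction hN).n_mul_n⟩
  · intro u hu
    have hcyc : IsCyclic (Units.torsion K) := inferInstance
    set s := (D.unitAction hN).s with hs
    set t := (D.unitAction hN).t with ht
    have hmem : ∀ (f : (𝓞 K)ˣ →* (𝓞 K)ˣ), ∀ v ∈ Units.torsion K, f v ∈ Units.torsion K :=
      fun f v hv => f.isOfFinOrder hv
    obtain ⟨g, hg⟩ := hcyc.exists_generator
    have hpow : ∀ (f : (𝓞 K)ˣ →* (𝓞 K)ˣ), ∃ n : ℤ, ∀ v ∈ Units.torsion K, f v = v ^ n := by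
      intro f
      obtain ⟨n, hn⟩ := Subgroup.mem_zpowers_iff.1 (hg ⟨f g, hmem f g g.2⟩)
      refine ⟨n, fun v hv => ?_⟩
      obtain ⟨m, hm⟩ := Subgroup.mem_zpowers_iff.1 (hg ⟨v, hv⟩)
      have hn' : (g : (𝓞 K)ˣ) ^ n = f g := congrArg Subtype.val hn
      have hm' : (g : (𝓞 K)ˣ) ^ m = v := congrArg Subtype.val hm
      rw [← hm', map_zpow, ← hn', ← zpow_mul, ← zpow_mul, mul_comm]
    obtain ⟨a, ha⟩ := hpow s
    obtain ⟨b, hb⟩ := hpow t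
    rw [(D.unitAction hN).mem_ker_lam]
    have h1 : s (t u) = t (s u) := by
      rw [hb u hu, ha u hu, map_zpow, map_zpow, ha u hu, hb u hu, ← zpow_mul, ← zpow_mul, mul_comm]
    have h2 := (D.unitAction hN).s_t u
    change s (t u) = t (s (s u)) at h2
    rw [h1] at h2
    have h3 : s u = s (s u) := by
      have := congrArg t h2
      rwa [ht, (D.unitAction hN).t_t, (D.unitAction hN).t_t] at this
    have h4 := congrArg s (congrArg s h3)
    rw [hs, (D.unitAction hN).s_s_s] at h4
    exact h4.symm

lemma index_pow_three : ((powMonoidHom (α := (𝓞 K)ˣ) 3).range ⊔ (D.unitAction hN).lam.ker).index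
    = 9 := by
  rw [D.ker_lam_eq_torsion hN]
  have h := AddSubgroup.index_range_nsmul (Additive ((𝓞 K)ˣ ⧸ Units.torsion K)) 3
  rw [Units.finrank_modTorsion, D.unit_rank] at h
  have h2 : (powMonoidHom (α := (𝓞 K)ˣ ⧸ Units.torsion K) 3).range.index = 9 := by
    rw [← Subgroup.index_toAddSubgroup]
    exact h
  rw [← h2, ← Subgroup.index_comap_of_surjective _ (QuotientGroup.mk'_surjective (Units.torsion K))]
  congr 1
  ext u
  rw [Subgroup.mem_sup, Subgroup.mem_comap]
  constructor
  · rintro ⟨_, ⟨v, rfl⟩, t, ht, rfl⟩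
    refine ⟨v, ?_⟩
    rw [map_mul, show QuotientGroup.mk' (Units.torsion K) t = 1 from
      (QuotientGroup.eq_one_iff t).2 ht]
    exact (mul_one (M := (𝓞 K)ˣ ⧸ Units.torsion K) _).symm
  · rintro ⟨v, hv⟩
    obtain ⟨v, rfl⟩ := QuotientGroup.mk_surjective v
    refine ⟨v ^ 3, ⟨v, rfl⟩, (v ^ 3)⁻¹ * u, ?_, by simp⟩
    exact QuotientGroup.eq.1 hv

/-- An element multiplied by `ζ` under `σ` does not have norm `±1`. -/
lemma norm_sq_ne_one {x : K} (hx : D.σ x = D.ζ * x) : (x * D.σ x * D.σ (D.σ x)) ^ 2 ≠ 1 := by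
  intro h
  have hx0 : x ≠ 0 := by rintro rfl; simp at h
  have hθ := D.θ_ne_zero
  set y := D.θ / x with hy
  have hxy : D.θ = x * y := by rw [hy]; field_simp
  have h1 : D.σ y = y := by
    rw [hy, map_div₀, hx, D.σ_θ, mul_div_mul_left _ _ D.ζ_ne_zero]
  have hn : (x * D.σ x * D.σ (D.σ x)) * y ^ 3 = D.d := by
    have h2 : D.θ * D.σ D.θ * D.σ (D.σ D.θ) = (x * D.σ x * D.σ (D.σ x)) * y ^ 3 := by
      rw [hxy]; simp only [map_mul, h1]; ring
    rw [← h2]; simp only [D.σ_θ, map_mul, D.σ_ζ]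
    rw [← D.θ_pow]; linear_combination D.θ ^ 3 * D.ζ_pow
  have hy6 : y ^ 6 = (D.d : K) ^ 2 := by
    rw [← hn]; linear_combination -y ^ 6 * h
  obtain ⟨r, hr⟩ := D.exists_rat (x := y * D.τ y) (by
    rw [map_mul, h1, D.σ_τ, h1, h1]) (by rw [map_mul, D.τ_τ, mul_comm])
  have hr6 : (r ^ 3) ^ 2 = ((D.d : ℚ) ^ 2) ^ 2 := by
    apply (algebraMap ℚ K).injective
    have h3 := congrArg D.τ hy6
    simp only [map_pow, map_natCast] at h3 ⊢
    rw [← hr]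
    linear_combination (D.τ y) ^ 6 * hy6 + (D.d : K) ^ 2 * h3
  have hd : (D.d : ℚ) ≠ 0 := by exact_mod_cast D.d_ne_zero
  rcases sq_eq_sq_iff_eq_or_eq_neg.1 hr6 with h | h
  · apply D.noncube (r ^ 2 / D.d)
    rw [div_pow]; field_simp
    linear_combination (r ^ 3 + D.d ^ 2) * h
  · apply D.noncube (r ^ 2 / D.d)
    rw [div_pow]; field_simp
    linear_combination (r ^ 3 - D.d ^ 2) * h

lemma z_not_mem_Y : (D.unitAction hN).z ∉ (D.unitAction hN).Y := by
  intro h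
  have hz : D.zU * D.zU * D.zU = 1 := by
    rw [← (D.unitAction hN).z_pow, pow_succ, pow_two]; rfl
  have hsz : (D.unitAction hN).s D.zU = D.zU := (D.unitAction hN).s_z
  have hnorm : D.zU * (D.unitAction hN).s D.zU * (D.unitAction hN).s ((D.unitAction hN).s D.zU) = 1 := by
    rw [hsz, hsz, hz]
  obtain ⟨w, hw⟩ := (D.unitAction hN).exists_eq_div h hnorm
  have hw' : (D.unitAction hN).s w = D.zU * w := by rw [show D.zU = _ from hw]; simp
  have hw2 := congrArg (fun u : (𝓞 K)ˣ => ((u : 𝓞 K) : K)) hw'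
  simp only [s_apply, Units.val_mul, map_mul, coe_zU] at hw2
  apply D.norm_sq_ne_one hw2
  have h3 := (D.unitAction hN).norm_mem w
  have h4 : ∀ {u v : (𝓞 K)ˣ}, u = v → ((u : 𝓞 K) : K) = (v : 𝓞 K) := fun h => by rw [h]
  rcases h3 with h3 | h3
  · have := h4 h3
    simp only [s_apply, Units.val_mul, map_mul, Units.val_one, map_one] at this
    rw [this]; ring
  · have := h4 h3
    simp only [s_apply, Units.val_mul, map_mul] at this
    rw [this]
    change (((-1 : (𝓞 K)ˣ) : 𝓞 K) : K) ^ 2 = 1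
    simp

lemma unit_index_cases :
    let A := D.unitAction hN
    (A.E0.index = 1 ∧ A.Y.relIndex A.plus = 3 ∧ A.Y.relIndex A.minus = 3) ∨
    (A.E0.index = 3 ∧ A.Y.relIndex A.plus = 9 ∧ A.Y.relIndex A.minus = 1) := by
  intro A
  refine A.index_cases (A.index_Y ?_ (D.index_pow_three hN) (D.z_not_mem_Y hN)) (D.z_not_mem_Y hN)
  intro u hu
  rw [D.ker_lam_eq_torsion hN] at *
  exact (IsOfFinOrder.of_pow hu (by norm_num))

lemma index_Y_eq : (D.unitAction hN).Y.index = 9 := by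
  refine (D.unitAction hN).index_Y ?_ (D.index_pow_three hN) (D.z_not_mem_Y hN)
  intro u hu
  rw [D.ker_lam_eq_torsion hN] at *
  exact (IsOfFinOrder.of_pow hu (by norm_num))

end PureCubic

section Padic

variable {p : ℕ} [hp : Fact p.Prime]

lemma Padic.norm_mul_pow_three_ne {δ x y : ℚ_[p]} (hδ : ¬ (3 : ℤ) ∣ δ.valuation) (hx : x ≠ 0) :
    ‖δ * x ^ 3‖ ≠ ‖y ^ 3‖ := by
  intro h
  have hδ0 : δ ≠ 0 := by rintro rfl; simp at hδ
  have hy : y ≠ 0 := by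
    rintro rfl
    rw [zero_pow (by norm_num), norm_zero, norm_eq_zero] at h
    simp [hδ0, hx] at h
  have h1 := Padic.norm_eq_zpow_neg_valuation (x := δ * x ^ 3) (by simp [hδ0, hx])
  have h2 := Padic.norm_eq_zpow_neg_valuation (x := y ^ 3) (by simp [hy])
  have hp1 : (1 : ℝ) < p := by exact_mod_cast hp.out.one_lt
  rw [h1, h2, zpow_right_inj₀ (by linarith) hp1.ne', Padic.valuation_mul hδ0 (by simp [hx]),
    Padic.valuation_pow, Padic.valuation_pow] at h
  push_cast at h
  omega

/-- If `3 ∤ v(δ)` and the form `a³ + δb³ + δ²c³ - 3δabc` is a unit, then it is congruent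
to `a³`. -/
lemma Padic.norm_form_sub_lt {δ a b c : ℚ_[p]} (hδ : ¬ (3 : ℤ) ∣ δ.valuation)
    (h : ‖a ^ 3 + δ * b ^ 3 + δ ^ 2 * c ^ 3 - 3 * δ * a * b * c‖ = 1) :
    ‖a‖ = 1 ∧ ‖a ^ 3 + δ * b ^ 3 + δ ^ 2 * c ^ 3 - 3 * δ * a * b * c - a ^ 3‖ < 1 := by
  have hδ0 : δ ≠ 0 := by rintro rfl; simp at hδ
  have hδ2 : ¬ (3 : ℤ) ∣ (δ ^ 2).valuation := by rw [Padic.valuation_pow]; push_cast; omega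
  have h3 : ‖(3 : ℚ_[p])‖ ≤ 1 := by exact_mod_cast Padic.norm_int_le_one (p := p) 3
  set A := ‖a ^ 3‖ with hA
  set B := ‖δ * b ^ 3‖ with hB
  set C := ‖δ ^ 2 * c ^ 3‖ with hC
  set T := ‖3 * δ * a * b * c‖ with hT
  have hA0 : 0 ≤ A := norm_nonneg _
  have hB0 : 0 ≤ B := norm_nonneg _
  have hC0 : 0 ≤ C := norm_nonneg _
  have hT0 : 0 ≤ T := norm_nonneg _
  have hT3 : T ^ 3 ≤ A * B * C := by
    rw [hA, hB, hC, hT, ← norm_mul, ← norm_mul, ← norm_pow,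
      show (3 * δ * a * b * c) ^ 3 = 3 ^ 3 * (a ^ 3 * (δ * b ^ 3) * (δ ^ 2 * c ^ 3)) by ring,
      norm_mul, norm_pow 3]
    exact mul_le_of_le_one_left (norm_nonneg _) (pow_le_one₀ (norm_nonneg _) h3)
  have key : ∀ {M X Y : ℝ}, 0 ≤ X → 0 ≤ Y → X < M → Y < M → T ^ 3 ≤ M * X * Y → T < M := by
    intro M X Y hX hY hXM hYM hT
    by_contra hlt
    push Not at hlt
    have hM : 0 < M := by linarith
    have h1 : M ^ 3 ≤ T ^ 3 := pow_le_pow_left₀ hM.le hlt 3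
    have h2 : X * Y < M * M := by nlinarith
    have h3 : M * (X * Y) < M * (M * M) := mul_lt_mul_of_pos_left h2 hM
    nlinarith
  have na : ∀ {M : ℝ} {x y z : ℚ_[p]}, ‖x‖ < M → ‖y‖ < M → ‖z‖ < M → ‖x + y - z‖ < M := by
    intro M x y z hx hy hz
    rw [sub_eq_add_neg]
    refine (Padic.nonarchimedean _ _).trans_lt (max_lt ((Padic.nonarchimedean _ _).trans_lt
      (max_lt hx hy)) (by rwa [norm_neg]))
  have na2 : ∀ {x y : ℚ_[p]}, ‖y‖ < ‖x‖ → ‖x + y‖ = ‖x‖ := by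
    intro x y hxy
    rw [Padic.add_eq_max_of_ne hxy.ne', max_eq_left hxy.le]
  have hb1 : B ≠ 1 := by
    intro h1
    by_cases hb : b = 0
    · simp [hB, hb] at h1
    · exact Padic.norm_mul_pow_three_ne (y := 1) hδ hb (by simp [← h1, hB])
  have hc1 : C ≠ 1 := by
    intro h1
    by_cases hc : c = 0
    · simp [hC, hc] at h1
    · exact Padic.norm_mul_pow_three_ne (y := 1) hδ2 hc (by simp [← h1, hC])
  have hAB : A = B → A = 0 := by
    intro hab
    by_cases hb : b = 0
    · rw [hab, hB, hb]; simp
    · exact absurd hab.symm (Padic.norm_mul_pow_three_ne hδ hb)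
  have hAC : A = C → A = 0 := by
    intro hab
    by_cases hb : c = 0
    · rw [hab, hC, hb]; simp
    · exact absurd hab.symm (Padic.norm_mul_pow_three_ne hδ2 hb)
  have hBC : B = C → B = 0 := by
    intro hab
    by_cases hb : c = 0
    · rw [hab, hC, hb]; simp
    · exfalso
      apply Padic.norm_mul_pow_three_ne (y := b) hδ hb
      rw [hB, hC, pow_two, mul_assoc, norm_mul, norm_mul δ] at hab
      exact (mul_left_cancel₀ (norm_ne_zero_iff.2 hδ0) hab).symm
  have hzero : ¬ (A = 0 ∧ B = 0 ∧ C = 0) := by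
    rintro ⟨h1, h2, h3⟩
    have h4 : a = 0 := by simpa [hA] using h1
    rw [hB, norm_eq_zero] at h2
    rw [hC, norm_eq_zero] at h3
    rw [h2, h3, h4] at h
    simp at h
  rcases lt_or_ge A B with hab | hab
  · rcases lt_or_ge B C with hbc | hbc
    · exfalso
      have := na (hab.trans hbc) hbc (key hA0 hB0 (hab.trans hbc) hbc (by linarith))
      have h2 := na2 (x := δ ^ 2 * c ^ 3) this
      apply hc1
      rw [hC, ← h2, ← h]; congr 1; ring
    · rcases hbc.lt_or_eq with hbc | hbc
      · exfalso
        have := na hab hbc (key hA0 hC0 hab hbc (by linarith))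
        have h2 := na2 (x := δ * b ^ 3) this
        apply hb1
        rw [hB, ← h2, ← h]; congr 1; ring
      · exfalso
        have := hBC hbc.symm
        linarith
  · have hAC' : C < A ∧ B < A := by
      rcases lt_trichotomy A C with hac | hac | hac
      · exfalso
        have := na hac (hab.trans_lt hac) (key hA0 hB0 hac (hab.trans_lt hac) (by linarith))
        have h2 := na2 (x := δ ^ 2 * c ^ 3) this
        apply hc1
        rw [hC, ← h2, ← h]; congr 1; ring
      · exfalso
        have h0 := hAC hac
        exact hzero ⟨h0, by linarith, by linarith⟩
      · refine ⟨hac, lt_of_le_of_ne hab ?_⟩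
        intro hba
        have := hAB hba.symm
        linarith
    have := na hAC'.2 hAC'.1 (key hB0 hC0 hAC'.2 hAC'.1 (by linarith))
    have h2 := na2 (x := a ^ 3) this
    have hA1 : A = 1 := by rw [hA, ← h2, ← h]; congr 1; ring
    refine ⟨?_, ?_⟩
    · rw [hA, norm_pow] at hA1
      exact (pow_eq_one_iff_of_nonneg (norm_nonneg _) (by norm_num)).1 hA1
    · rw [hA1] at this
      convert this using 2; ring

lemma PadicInt.exists_pow_three_eq_of_norm_form {δ a b c : ℚ_[p]} {u : ℤ_[p]}
    (hδ : ¬ (3 : ℤ) ∣ δ.valuation)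
    (h : (u : ℚ_[p]) = a ^ 3 + δ * b ^ 3 + δ ^ 2 * c ^ 3 - 3 * δ * a * b * c) (hu : IsUnit u) :
    ∃ t : ZMod p, t ^ 3 = PadicInt.toZMod u := by
  have hu1 : ‖(u : ℚ_[p])‖ = 1 := PadicInt.isUnit_iff.1 hu
  obtain ⟨h1, h2⟩ := Padic.norm_form_sub_lt hδ (h ▸ hu1)
  rw [← h] at h2
  set a' : ℤ_[p] := ⟨a, h1.le⟩
  refine ⟨PadicInt.toZMod a', ?_⟩
  rw [← map_pow, eq_comm, ← sub_eq_zero, ← map_sub, ← RingHom.mem_ker, PadicInt.ker_toZMod,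
    PadicInt.maximalIdeal_eq_span_p]
  rw [Ideal.mem_span_singleton, ← PadicInt.norm_lt_one_iff_dvd]
  exact h2

lemma ZMod.exists_sq_add_self_add_one (h3 : p % 3 = 1) : ∃ x : ZMod p, x ^ 2 + x + 1 = 0 := by
  have : Fact (Nat.Prime 3) := ⟨by norm_num⟩
  obtain ⟨x, hx⟩ := exists_prime_orderOf_dvd_card (G := (ZMod p)ˣ) 3 (by
    rw [ZMod.card_units_eq_totient, Nat.totient_prime hp.out]; omega)
  refine ⟨x, ?_⟩
  have h1 : ((x : ZMod p) - 1) * ((x : ZMod p) ^ 2 + x + 1) = 0 := by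
    have := congrArg (fun y : (ZMod p)ˣ => (y : ZMod p)) (hx ▸ pow_orderOf_eq_one x)
    simp only [Units.val_pow_eq_pow_val, Units.val_one] at this
    linear_combination this
  refine (mul_eq_zero.1 h1).resolve_left fun h => ?_
  have : x = 1 := Units.ext (by simpa using sub_eq_zero.1 h)
  rw [this, orderOf_one] at hx
  norm_num at hx

/-- If `p ≡ 1 (mod 3)` and `p ≢ 1 (mod 9)`, primitive cube roots of unity are not cubes. -/
lemma ZMod.pow_three_sq_add_ne_zero (h9 : p % 9 = 4 ∨ p % 9 = 7) (t : ZMod p) :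
    (t ^ 3) ^ 2 + t ^ 3 + 1 ≠ 0 := by
  intro h
  have ht9 : t ^ 9 = 1 := by linear_combination (t ^ 3 - 1) * h
  have ht0 : t ≠ 0 := by rintro rfl; simp at h
  have h3 : (3 : ZMod p) ≠ 0 := by
    intro h3
    have : p ∣ 3 := by rw [← ZMod.natCast_eq_zero_iff]; exact_mod_cast h3
    have := Nat.le_of_dvd (by norm_num) this
    omega
  have ht3 : t ^ 3 ≠ 1 := by
    intro h3'
    rw [h3'] at h
    exact h3 (by linear_combination h)
  have hcard := ZMod.pow_card_sub_one_eq_one ht0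
  have ho1 : orderOf t ∣ 9 := orderOf_dvd_of_pow_eq_one ht9
  have ho2 : orderOf t ∣ p - 1 := orderOf_dvd_of_pow_eq_one hcard
  have ho3 : orderOf t ∣ 3 := by
    have : orderOf t ∣ Nat.gcd 9 (p - 1) := Nat.dvd_gcd ho1 ho2
    refine this.trans ?_
    have : Nat.gcd 9 (p - 1) = Nat.gcd 9 ((p - 1) % 9) := by
      exact (Nat.gcd_rec 9 (p - 1)).trans (Nat.gcd_comm _ _)
    rw [this]
    rcases h9 with h9 | h9
    · rw [show (p - 1) % 9 = 3 by omega]; norm_num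
    · rw [show (p - 1) % 9 = 6 by omega]; norm_num
  exact ht3 (orderOf_dvd_iff_pow_eq_one.1 ho3)

lemma PadicInt.exists_sq_add_self_add_one (h3 : p % 3 = 1) : ∃ x : ℤ_[p], x ^ 2 + x + 1 = 0 := by
  obtain ⟨x, hx⟩ := ZMod.exists_sq_add_self_add_one h3
  obtain ⟨a, rfl⟩ := ZMod.ringHom_surjective (PadicInt.toZMod (p := p)) x
  set F : Polynomial ℤ_[p] := Polynomial.X ^ 2 + Polynomial.X + 1
  have hF : ∀ y : ℤ_[p], F.aeval y = y ^ 2 + y + 1 := by intro y; simp [F]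
  have hF' : ∀ y : ℤ_[p], F.derivative.aeval y = 2 * y + 1 := by intro y; simp [F]; left; norm_num
  have h1 : ‖F.aeval a‖ < 1 := by
    rw [hF, PadicInt.norm_lt_one_iff_dvd, ← Ideal.mem_span_singleton,
      ← PadicInt.maximalIdeal_eq_span_p, ← PadicInt.ker_toZMod, RingHom.mem_ker]
    simpa using hx
  have h2 : ‖F.derivative.aeval a‖ = 1 := by
    rw [hF']
    by_contra hne
    have hlt := lt_of_le_of_ne (PadicInt.norm_le_one _) hne
    rw [PadicInt.norm_lt_one_iff_dvd, ← Ideal.mem_span_singleton,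
      ← PadicInt.maximalIdeal_eq_span_p, ← PadicInt.ker_toZMod, RingHom.mem_ker] at hlt
    simp only [map_add, map_mul, map_one, map_ofNat] at hlt
    have : (3 : ZMod p) = 0 := by
      linear_combination 4 * hx - (2 * PadicInt.toZMod a + 1) * hlt
    have hp3 : p ∣ 3 := by rw [← ZMod.natCast_eq_zero_iff]; exact_mod_cast this
    rcases (Nat.dvd_prime Nat.prime_three).1 hp3 with h | h <;> subst h
    · exact hp.out.ne_one rfl
    · norm_num at h3
  obtain ⟨z, hz, -⟩ := hensels_lemma (F := F) (a := a) (by rw [h2, one_pow]; exact h1)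
  exact ⟨z, by rw [← hF]; exact hz⟩

end Padic

namespace PureCubic

variable {K : Type*} [Field K] [NumberField K] (D : PureCubic K)

lemma exists_coord_k0 (x : K) : ∃ a b c : D.k0, x = a + b * D.θ + c * D.θ ^ 2 := by
  obtain ⟨a, a', b, b', c, c', rfl⟩ := D.exists_coord x
  exact ⟨⟨_, D.mem_k0.2 (D.σ_qz a a')⟩, ⟨_, D.mem_k0.2 (D.σ_qz b b')⟩,
    ⟨_, D.mem_k0.2 (D.σ_qz c c')⟩, rfl⟩

lemma norm_eq_form (a b c : D.k0) :
    ((a : K) + b * D.θ + c * D.θ ^ 2) * D.σ ((a : K) + b * D.θ + c * D.θ ^ 2) *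
      D.σ (D.σ ((a : K) + b * D.θ + c * D.θ ^ 2)) =
    ((a ^ 3 + D.d * b ^ 3 + D.d ^ 2 * c ^ 3 - 3 * D.d * a * b * c : D.k0) : K) := by
  simp only [map_add, map_mul, map_pow, D.mem_k0.1 a.2, D.mem_k0.1 b.2, D.mem_k0.1 c.2, D.σ_θ,
    D.σ_ζ]
  push_cast
  rw [show ((3 : D.k0) : K) = 3 from rfl, ← D.θ_pow]
  have hz := D.ζ_pow
  have hz2 := D.ζ_sq
  have e : (D.ζ ^ 2 : K) = -1 - D.ζ := hz2
  have e3 : (D.ζ ^ 3 : K) = 1 := hz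
  have e4 : (D.ζ ^ 4 : K) = D.ζ := by linear_combination D.ζ * hz
  have e5 : (D.ζ ^ 5 : K) = -1 - D.ζ := by linear_combination D.ζ ^ 2 * hz + hz2
  have e6 : (D.ζ ^ 6 : K) = 1 := by linear_combination (D.ζ ^ 3 + 1) * hz
  ring_nf
  simp only [e, e3, e4, e5, e6]
  ring

variable {p : ℕ} [hp : Fact p.Prime]

lemma exists_padic_embedding (h3 : p % 3 = 1) : ∃ (f : D.k0 →+* ℚ_[p]) (w : ℤ_[p]),
    w ^ 2 + w + 1 = 0 ∧ f ⟨D.ζ, D.mem_k0.2 D.σ_ζ⟩ = w := by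
  obtain ⟨w, hw⟩ := PadicInt.exists_sq_add_self_add_one h3
  have h_int : IsIntegral ℚ D.ζ := Algebra.IsIntegral.isIntegral _
  have hk0 := D.k0_eq
  have hmin : minpoly ℚ D.ζ = Polynomial.cyclotomic 3 ℚ :=
    (Polynomial.cyclotomic_eq_minpoly_rat D.ζ_prim (by norm_num)).symm
  have hroot : (w : ℚ_[p]) ∈ (minpoly ℚ D.ζ).aroots ℚ_[p] := by
    rw [Polynomial.mem_aroots]
    refine ⟨minpoly.ne_zero h_int, ?_⟩
    rw [hmin, Polynomial.cyclotomic_three]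
    have : ((w ^ 2 + w + 1 : ℤ_[p]) : ℚ_[p]) = 0 := by rw [hw]; rfl
    simpa using this
  let g : ℚ⟮D.ζ⟯ →ₐ[ℚ] ℚ_[p] := (algHomAdjoinIntegralEquiv ℚ h_int).symm ⟨_, hroot⟩
  have hg : g (AdjoinSimple.gen ℚ D.ζ) = w :=
    algHomAdjoinIntegralEquiv_symm_apply_gen ℚ h_int ⟨_, hroot⟩
  let e : D.k0 ≃ₐ[ℚ] ℚ⟮D.ζ⟯ := IntermediateField.equivOfEq hk0
  refine ⟨(g : ℚ⟮D.ζ⟯ →+* ℚ_[p]).comp (e : D.k0 →+* ℚ⟮D.ζ⟯), w, hw, ?_⟩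
  rw [← hg]; rfl

lemma exists_pow_three_eq_of_norm (hd : ¬ 3 ∣ padicValNat p D.d) (f : D.k0 →+* ℚ_[p]) {x : K}
    {y n : D.k0} (hn : n ≠ 0) (h : x * D.σ x * D.σ (D.σ x) = ((y * n ^ 3 : D.k0) : K)) {u : ℤ_[p]}
    (hu : IsUnit u) (hy : f y = u) : ∃ t : ZMod p, t ^ 3 = PadicInt.toZMod u := by
  obtain ⟨a, b, c, rfl⟩ := D.exists_coord_k0 x
  rw [D.norm_eq_form, SetLike.coe_eq_coe] at h
  have hfn : f n ≠ 0 := by simpa using hn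
  refine PadicInt.exists_pow_three_eq_of_norm_form (δ := (D.d : ℚ_[p])) (a := f a / f n)
    (b := f b / f n) (c := f c / f n) (u := u) ?_ ?_ hu
  · rw [Padic.valuation_natCast]; omega
  · have := congrArg f h
    simp only [map_add, map_sub, map_mul, map_pow, map_natCast, map_ofNat, hy] at this
    field_simp
    linear_combination -this

lemma norm_ne_ζ (h9 : p % 9 = 4 ∨ p % 9 = 7) (hd : ¬ 3 ∣ padicValNat p D.d) (x : K) :
    x * D.σ x * D.σ (D.σ x) ≠ D.ζ := by
  intro h
  obtain ⟨f, w, hw, hf⟩ := D.exists_padic_embedding (p := p) (by omega)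
  have hwu : IsUnit w := IsUnit.of_mul_eq_one (-1 - w) (by linear_combination -hw)
  obtain ⟨t, ht⟩ := D.exists_pow_three_eq_of_norm hd f (n := 1) (y := ⟨D.ζ, D.mem_k0.2 D.σ_ζ⟩)
    one_ne_zero (by rw [h]; simp) hwu hf
  apply ZMod.pow_three_sq_add_ne_zero h9 t
  rw [ht, ← map_pow, ← map_add, ← map_one (PadicInt.toZMod (p := p)), ← map_add, hw, map_zero]

/-- A rational integer prime to `p` that is a norm up to cubes is a cube modulo `p`. -/
lemma exists_cube_of_norm (h9 : p % 9 = 4 ∨ p % 9 = 7) (hd : ¬ 3 ∣ padicValNat p D.d) {x : K}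
    {m : ℤ} {n : ℚ} (hm : ¬ (p : ℤ) ∣ m) (hn : n ≠ 0)
    (h : x * D.σ x * D.σ (D.σ x) = algebraMap ℚ K (m * n ^ 3)) : ∃ t : ZMod p, t ^ 3 = m := by
  obtain ⟨f, w, hw, hf⟩ := D.exists_padic_embedding (p := p) (by omega)
  obtain ⟨t, ht⟩ := D.exists_pow_three_eq_of_norm hd f (n := (algebraMap ℚ D.k0 n))
    (y := (m : D.k0)) (u := (m : ℤ_[p])) (by simpa using hn) (by rw [h]; simp) (by
      rw [PadicInt.isUnit_iff]
      refine le_antisymm (PadicInt.norm_le_one _) ?_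
      by_contra hlt
      push Not at hlt
      exact hm ((PadicInt.norm_int_lt_one_iff_dvd m).1 hlt)) (by simp)
  exact ⟨t, by rw [ht]; simp⟩

end PureCubic

namespace PureCubic

variable {K : Type*} [Field K] [NumberField K] (D : PureCubic K)

lemma coe_unit_ne_zero {K : Type*} [Field K] (u : (𝓞 K)ˣ) : ((u : 𝓞 K) : K) ≠ 0 := by
  simp

lemma coe_mul_unit {K : Type*} [Field K] (u v : (𝓞 K)ˣ) :
    (((u * v : (𝓞 K)ˣ) : 𝓞 K) : K) = ((u : 𝓞 K) : K) * (v : 𝓞 K) := by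
  rw [Units.val_mul]; exact map_mul (algebraMap (𝓞 K) K) _ _

/-- The elements of `K` generating a `σ`-invariant principal ideal. -/
def ambig : Subgroup Kˣ where
  carrier := {x | ∃ u : (𝓞 K)ˣ, D.σ x = (u : 𝓞 K) * x}
  one_mem' := ⟨1, by simp⟩
  mul_mem' := by
    rintro x y ⟨u, hu⟩ ⟨v, hv⟩
    exact ⟨u * v, by simp [hu, hv]; ring⟩
  inv_mem' := by
    rintro x ⟨u, hu⟩
    refine ⟨u⁻¹, ?_⟩
    rw [Units.val_inv_eq_inv_val, map_inv₀, hu, mul_inv]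
    congr 1
    apply inv_eq_of_mul_eq_one_left
    rw [← map_mul, Units.inv_mul, map_one]

lemma mem_ambig {x : Kˣ} : x ∈ D.ambig ↔ ∃ u : (𝓞 K)ˣ, D.σ x = (u : 𝓞 K) * x := Iff.rfl

/-- The unit `σ x / x`. -/
def unitOf : D.ambig →* (𝓞 K)ˣ :=
  MonoidHom.mk' (fun x => x.2.choose) (by
    have key : ∀ (x y : Kˣ) (u v w : (𝓞 K)ˣ), D.σ x = (u : 𝓞 K) * (x : K) →
        D.σ y = (v : 𝓞 K) * (y : K) → D.σ (x * y : Kˣ) = (w : 𝓞 K) * ((x * y : Kˣ) : K) →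
        w = u * v := by
      intro x y u v w hu hv hw
      apply Units.ext_coe
      apply mul_right_cancel₀ (x * y).ne_zero
      rw [← hw, Units.val_mul, map_mul, hu, hv, coe_mul_unit]
      ring
    exact fun x y => key x y _ _ _ x.2.choose_spec y.2.choose_spec (x * y).2.choose_spec)

lemma unitOf_spec (x : D.ambig) : D.σ (x : Kˣ) = ((D.unitOf x : (𝓞 K)ˣ) : 𝓞 K) * ((x : Kˣ) : K) :=
  x.2.choose_spec

lemma unitOf_eq {x : D.ambig} {u : (𝓞 K)ˣ} (h : D.σ (x : Kˣ) = (u : 𝓞 K) * ((x : Kˣ) : K)) :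
    D.unitOf x = u := by
  apply Units.ext_coe
  apply mul_right_cancel₀ (Units.ne_zero (x : Kˣ))
  rw [← h, unitOf_spec]

variable (hN : ∀ x : K, x * D.σ x * D.σ (D.σ x) ≠ D.ζ)

/-- The class of `σ x / x` modulo the elements `± σ w / w`. -/
def ψ : D.ambig →* (𝓞 K)ˣ ⧸ (D.unitAction hN).Y := (QuotientGroup.mk' _).comp D.unitOf

lemma ψ_eq_one {x : D.ambig} : D.ψ hN x = 1 ↔ D.unitOf x ∈ (D.unitAction hN).Y :=
  QuotientGroup.eq_one_iff _

lemma ψ_mem_map {x : D.ambig} {S : Subgroup (𝓞 K)ˣ} (hS : (D.unitAction hN).Y ≤ S) :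
    D.ψ hN x ∈ S.map (QuotientGroup.mk' (D.unitAction hN).Y) ↔ D.unitOf x ∈ S := by
  constructor
  · rintro ⟨y, hy, h⟩
    have := QuotientGroup.eq.1 h
    have h2 := mul_mem hy (hS this)
    simpa using h2
  · exact fun h => ⟨_, h, rfl⟩

lemma σ_eq_of_σ_eq_neg {x : K} (h : D.σ x = -x) : x = 0 := by
  have := D.σ_σ_σ x
  rw [h, map_neg, h, neg_neg, h] at this
  have h2 : 2 * x = 0 := by linear_combination -this
  simpa using h2

lemma exists_unitOf_eq {u : (𝓞 K)ˣ}
    (hu : ((u : 𝓞 K) : K) * D.σ (u : 𝓞 K) * D.σ (D.σ (u : 𝓞 K)) = 1) :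
    ∃ x : D.ambig, D.unitOf x = u := by
  obtain ⟨x, hx, h⟩ := D.exists_σ_eq_mul hu
  exact ⟨⟨Units.mk0 x hx, u, h⟩, D.unitOf_eq h⟩

lemma norm_unit (hN : ∀ x : K, x * D.σ x * D.σ (D.σ x) ≠ D.ζ) (u : (𝓞 K)ˣ) :
    ((u : 𝓞 K) : K) * D.σ (u : 𝓞 K) * D.σ (D.σ (u : 𝓞 K)) = 1 ∨
    ((u : 𝓞 K) : K) * D.σ (u : 𝓞 K) * D.σ (D.σ (u : 𝓞 K)) = -1 := by
  have e : ∀ {u v : (𝓞 K)ˣ}, u = v → ((u : 𝓞 K) : K) = (v : 𝓞 K) := fun h => by rw [h]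
  rcases (D.unitAction hN).norm_mem u with h | h
  · left
    have := e h
    simpa [s_apply] using this
  · right
    have := e h
    have h2 : ((((D.unitAction hN).n : (𝓞 K)ˣ) : 𝓞 K) : K) = -1 := by
      change (((-1 : (𝓞 K)ˣ) : 𝓞 K) : K) = -1
      simp
    rw [h2] at this
    simpa [s_apply] using this

lemma ψ_surjective : Function.Surjective (D.ψ hN) := by
  intro y
  obtain ⟨u, rfl⟩ := QuotientGroup.mk_surjective y
  rcases D.norm_unit hN u with h | h
  · obtain ⟨x, rfl⟩ := D.exists_unitOf_eq h
    exact ⟨x, rfl⟩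
  · obtain ⟨x, hx⟩ := D.exists_unitOf_eq (u := -1 * u) (by simp; linear_combination -h)
    refine ⟨x, ?_⟩
    change QuotientGroup.mk (D.unitOf x) = _
    rw [hx, QuotientGroup.eq]
    have := (D.unitAction hN).n_mem
    change -1 ∈ _ at this
    simpa using this

/-- The kernel of `ψ` is generated by `k₀ˣ` and the units. -/
lemma ψ_eq_one_iff {x : D.ambig} : D.ψ hN x = 1 ↔
    ∃ (y : K) (e : (𝓞 K)ˣ), D.σ y = y ∧ ((x : Kˣ) : K) = y * (e : 𝓞 K) := by
  rw [ψ_eq_one]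
  constructor
  · intro h
    obtain ⟨w, hw⟩ := (D.unitAction hN).mem_Y.1 h
    have hw0 := coe_unit_ne_zero w
    have hs := D.unitOf_spec x
    have key : D.σ (((x : Kˣ) : K) / (w : 𝓞 K)) = ((x : Kˣ) : K) / (w : 𝓞 K) ∨
        D.σ (((x : Kˣ) : K) / (w : 𝓞 K)) = -(((x : Kˣ) : K) / (w : 𝓞 K)) := by
      have hσw : D.σ (w : 𝓞 K) ≠ 0 := by simp
      have e : ∀ {v : (𝓞 K)ˣ}, v = (D.unitAction hN).s w / w →
          ((v : 𝓞 K) : K) * (w : 𝓞 K) = D.σ (w : 𝓞 K) := by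
        rintro v rfl
        rw [← s_apply, ← map_mul, ← Units.val_mul, div_mul_cancel]
      rcases hw with hw | hw
      · left
        have := e hw
        rw [map_div₀, hs, div_eq_div_iff hσw hw0, ← this]; ring
      · right
        have h2 := e (v := -1 * D.unitOf x) (by
          rw [hw, show (D.unitAction hN).n = -1 from rfl, ← mul_assoc]; simp)
        simp only [Units.val_mul, map_mul, Units.val_neg, Units.val_one, map_neg, map_one] at h2
        rw [map_div₀, hs, ← neg_div, div_eq_div_iff hσw hw0, ← h2]; ring
    refine ⟨((x : Kˣ) : K) / (w : 𝓞 K), w, ?_, by field_simp⟩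
    rcases key with h | h
    · exact h
    · rw [D.σ_eq_of_σ_eq_neg h, map_zero]
  · rintro ⟨y, e, hy, hx⟩
    have : D.unitOf x = (D.unitAction hN).s e / e := by
      rw [eq_div_iff_mul_eq']
      apply Units.ext_coe
      have h0 := coe_unit_ne_zero e
      have hx0 : ((x : Kˣ) : K) ≠ 0 := Units.ne_zero _
      have hs := D.unitOf_spec x
      rw [s_apply, coe_mul_unit]
      rw [hx] at hx0 hs
      rw [map_mul, hy] at hs
      have hy0 : y ≠ 0 := left_ne_zero_of_mul hx0
      apply mul_left_cancel₀ hy0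
      linear_combination -hs
    rw [this]; exact (D.unitAction hN).s_div_mem e

/-- The elements of `ambig` lying in `L`. -/
def ambigL : Subgroup D.ambig where
  carrier := {x | D.τ ((x : Kˣ) : K) = ((x : Kˣ) : K)}
  one_mem' := by simp
  mul_mem' := by
    intro x y hx hy
    simp only [Set.mem_ofPred_eq, Subgroup.coe_mul, Units.val_mul, map_mul] at *
    rw [hx, hy]
  inv_mem' := by
    intro x hx
    simp only [Set.mem_ofPred_eq, InvMemClass.coe_inv, Units.val_inv_eq_inv_val, map_inv₀] at *
    rw [hx]

lemma mem_ambigL {x : D.ambig} : x ∈ D.ambigL ↔ D.τ ((x : Kˣ) : K) = ((x : Kˣ) : K) := Iff.rfl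

lemma coe_r (u : (𝓞 K)ˣ) : ((((D.unitAction hN).r u : (𝓞 K)ˣ) : 𝓞 K) : K) =
    (D.σ (D.τ (u : 𝓞 K)))⁻¹ := by
  rw [(D.unitAction hN).r_apply]
  apply eq_inv_of_mul_eq_one_left
  rw [← D.t_apply hN, ← D.s_apply hN, ← map_mul, ← Units.val_mul, inv_mul_cancel]
  simp

lemma coe_unitOf (x : D.ambig) :
    ((D.unitOf x : (𝓞 K)ˣ) : 𝓞 K) = D.σ (x : Kˣ) / ((x : Kˣ) : K) := by
  rw [unitOf_spec, mul_div_cancel_right₀ _ (Units.ne_zero _)]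

lemma r_unitOf {x y : D.ambig} (h : D.τ ((x : Kˣ) : K) = ((y : Kˣ) : K)) :
    (D.unitAction hN).r (D.unitOf x) = D.unitOf y := by
  apply Units.ext_coe
  rw [coe_r, coe_unitOf, coe_unitOf, map_div₀, map_div₀, D.τ_σ, h, D.σ_σ_σ, inv_div]

/-- The conjugate under `τ`. -/
def ambigτ (x : D.ambig) : D.ambig :=
  ⟨_root_.Units.map (D.τ : K →* K) (x : Kˣ), by
    refine D.mem_ambig.2 ⟨(Units.autMap D.σ (Units.autMap D.τ (D.unitOf x)))⁻¹, ?_⟩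
    have h : ∀ {u : (𝓞 K)ˣ}, (((u⁻¹ : (𝓞 K)ˣ) : 𝓞 K) : K) = ((u : 𝓞 K) : K)⁻¹ := by
      intro u
      apply eq_inv_of_mul_eq_one_left
      rw [← map_mul, Units.inv_mul, map_one]
    rw [h, Units.coe_autMap, Units.coe_autMap, coe_unitOf, map_div₀, map_div₀, D.τ_σ, D.σ_σ_σ,
      inv_div]
    simp⟩

lemma coe_ambigτ (x : D.ambig) : ((D.ambigτ x : Kˣ) : K) = D.τ ((x : Kˣ) : K) := rfl

lemma unitOf_ambigτ (x : D.ambig) : D.unitOf (D.ambigτ x) = (D.unitAction hN).r (D.unitOf x) :=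
  (D.r_unitOf hN (D.coe_ambigτ x).symm).symm

lemma mul_ambigτ_mem (x : D.ambig) : x * D.ambigτ x ∈ D.ambigL := by
  rw [mem_ambigL, Subgroup.coe_mul, Units.val_mul, map_mul, coe_ambigτ, D.τ_τ, mul_comm]

lemma map_ambigL : D.ambigL.map (D.ψ hN) =
    (D.unitAction hN).plus.map (QuotientGroup.mk' (D.unitAction hN).Y) := by
  apply le_antisymm
  · rintro _ ⟨x, hx, rfl⟩
    rw [D.ψ_mem_map hN (D.unitAction hN).Y_le_plus, (D.unitAction hN).mem_plus,
      D.r_unitOf hN (x := x) (y := x) hx, div_self']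
    exact one_mem _
  · rintro _ ⟨u, hu, rfl⟩
    obtain ⟨x, hx⟩ := D.ψ_surjective hN (QuotientGroup.mk u)
    have hxu : D.unitOf x / u ∈ (D.unitAction hN).Y := by
      have := QuotientGroup.eq.1 hx.symm
      rwa [mul_comm, ← div_eq_mul_inv] at this
    refine ⟨(x * D.ambigτ x) ^ 2, pow_mem (D.mul_ambigτ_mem x) 2, ?_⟩
    rw [map_pow, map_mul]
    change (QuotientGroup.mk (D.unitOf x) * QuotientGroup.mk (D.unitOf (D.ambigτ x))) ^ 2 = QuotientGroup.mk u
    rw [D.unitOf_ambigτ hN, ← QuotientGroup.mk_mul, ← QuotientGroup.mk_pow, eq_comm,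
      QuotientGroup.eq]
    have h1 := (D.unitAction hN).mem_plus.1 hu
    have h2 := (D.unitAction hN).pow_three_mem u
    have h3 := (D.unitAction hN).r_mem hxu
    rw [map_div] at h3
    have : u⁻¹ * (D.unitOf x * (D.unitAction hN).r (D.unitOf x)) ^ 2 =
        (D.unitOf x / u) ^ 2 * ((D.unitAction hN).r (D.unitOf x) / (D.unitAction hN).r u) ^ 2 *
        u ^ 3 * ((u / (D.unitAction hN).r u) ^ 2)⁻¹ := by
      apply Additive.ofMul.injective
      simp only [ofMul_mul, ofMul_div, ofMul_inv, ofMul_pow]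
      abel
    rw [this]
    exact mul_mem (mul_mem (mul_mem (pow_mem hxu 2) (pow_mem h3 2)) h2) (inv_mem (pow_mem h1 2))

/-- On `L` the kernel of `ψ` is generated by `ℚˣ` and the units of `L`. -/
lemma ψ_eq_one_iff_of_mem {x : D.ambig} (hx : x ∈ D.ambigL) : D.ψ hN x = 1 ↔
    ∃ (r : ℚ) (e : (𝓞 K)ˣ), D.τ ((e : 𝓞 K) : K) = (e : 𝓞 K) ∧
      ((x : Kˣ) : K) = algebraMap ℚ K r * (e : 𝓞 K) := by
  constructor
  · intro h
    have hnorm : D.unitOf x * (D.unitAction hN).s (D.unitOf x) *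
        (D.unitAction hN).s ((D.unitAction hN).s (D.unitOf x)) = 1 := by
      apply Units.ext_coe
      have hx0 : ((x : Kˣ) : K) ≠ 0 := Units.ne_zero _
      have hx1 : D.σ ((x : Kˣ) : K) ≠ 0 := by simp
      have hx2 : D.σ (D.σ ((x : Kˣ) : K)) ≠ 0 := by simp
      rw [coe_mul_unit, coe_mul_unit, s_apply, s_apply, s_apply, coe_unitOf,
        map_div₀, map_div₀, D.σ_σ_σ]
      simp only [Units.val_one, map_one]
      field_simp
    obtain ⟨w, hw⟩ := (D.unitAction hN).exists_eq_div ((D.ψ_eq_one hN).1 h) hnorm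
    have hr := D.r_unitOf hN (x := x) (y := x) hx
    rw [hw] at hr
    obtain ⟨e, he, he2, -⟩ := (D.unitAction hN).exists_fixed_of_r_eq hr
    rw [← hw] at he2
    have he0 := coe_unit_ne_zero e
    have heτ : D.τ ((e : 𝓞 K) : K) = (e : 𝓞 K) := by rw [← D.t_apply hN, he]
    have heσ : D.σ (e : 𝓞 K) = D.σ ((x : Kˣ) : K) / ((x : Kˣ) : K) * (e : 𝓞 K) := by
      rw [← D.s_apply hN, ← coe_unitOf, ← map_mul, ← Units.val_mul, ← he2, div_mul_cancel]
    have hx0 : ((x : Kˣ) : K) ≠ 0 := Units.ne_zero _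
    have hx1 : D.σ ((x : Kˣ) : K) ≠ 0 := by simp
    obtain ⟨r, hr⟩ := D.exists_rat (x := ((x : Kˣ) : K) / (e : 𝓞 K)) (by
      rw [map_div₀, heσ]; field_simp) (by rw [map_div₀, heτ, D.mem_ambigL.1 hx])
    exact ⟨r, e, heτ, by rw [← hr]; field_simp⟩
  · rintro ⟨r, e, -, h⟩
    exact (D.ψ_eq_one_iff hN).2 ⟨_, e, by simp, h⟩

lemma ψ_mem_map_minus {x : D.ambig} :
    D.ψ hN x ∈ (D.unitAction hN).minus.map (QuotientGroup.mk' (D.unitAction hN).Y) ↔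
    ∃ (r : ℚ) (e : (𝓞 K)ˣ), D.τ ((e : 𝓞 K) : K) = (e : 𝓞 K) ∧
      ((x : Kˣ) : K) * D.τ ((x : Kˣ) : K) = algebraMap ℚ K r * (e : 𝓞 K) := by
  have h := D.ψ_eq_one_iff_of_mem hN (D.mul_ambigτ_mem x)
  rw [D.ψ_mem_map hN (D.unitAction hN).Y_le_minus, (D.unitAction hN).mem_minus,
    ← D.unitOf_ambigτ hN, ← map_mul, ← ψ_eq_one, h]
  rfl

lemma card_map_mk' {E : Type*} [CommGroup E] (Y S : Subgroup E) :
    Nat.card (S.map (QuotientGroup.mk' Y)) = Y.relIndex S := by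
  rw [← Subgroup.relIndex_ker, QuotientGroup.ker_mk']

lemma relIndex_ψ (S : Subgroup D.ambig) :
    (D.ψ hN).ker.relIndex S = Nat.card (S.map (D.ψ hN)) := Subgroup.relIndex_ker _ _

end PureCubic

namespace PureCubic

variable {K : Type*} [Field K] [NumberField K] (D : PureCubic K)

lemma coe_algebraMap (a : 𝓞 D.k0) :
    ((algebraMap (𝓞 D.k0) (𝓞 K) a : 𝓞 K) : K) = ((a : D.k0) : K) := rfl

lemma σ_coe_k0 (a : D.k0) : D.σ (a : K) = a := D.mem_k0.1 a.2

lemma exists_algebraMap_eq {x : 𝓞 K} (h : D.σ (x : K) = x) :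
    ∃ a : 𝓞 D.k0, algebraMap (𝓞 D.k0) (𝓞 K) a = x := by
  have h1 : (x : K) ∈ D.k0 := D.mem_k0.2 h
  have h2 : IsIntegral ℤ (⟨(x : K), h1⟩ : D.k0) := by
    have := x.2
    rw [← isIntegral_algebraMap_iff (algebraMap D.k0 K).injective]
    exact RingOfIntegers.isIntegral_coe x
  exact ⟨⟨_, h2⟩, RingOfIntegers.ext rfl⟩

/-- The automorphism `σ` of the ring of integers. -/
def σO : 𝓞 K ≃+* 𝓞 K := RingOfIntegers.mapRingEquiv (D.σ : K ≃+* K)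

lemma coe_σO (x : 𝓞 K) : ((D.σO x : 𝓞 K) : K) = D.σ (x : K) := rfl

lemma σO_σO_σO (x : 𝓞 K) : D.σO (D.σO (D.σO x)) = x := RingOfIntegers.ext (D.σ_σ_σ _)

lemma σO_algebraMap (a : 𝓞 D.k0) :
    D.σO (algebraMap (𝓞 D.k0) (𝓞 K) a) = algebraMap (𝓞 D.k0) (𝓞 K) a :=
  RingOfIntegers.ext (D.σ_coe_k0 _)

lemma map_σO_span (x : 𝓞 K) :
    (Ideal.span {x}).map D.σO = Ideal.span {D.σO x} := by
  rw [Ideal.map_span, Set.image_singleton]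

lemma isPrincipalIdealRing : IsPrincipalIdealRing (𝓞 D.k0) := by
  have := D.isCyclotomicExtension
  exact IsCyclotomicExtension.Rat.three_pid D.k0

lemma intNorm_eq (x : 𝓞 K) : algebraMap (𝓞 D.k0) (𝓞 K) (Algebra.intNorm (𝓞 D.k0) (𝓞 K) x) =
    x * D.σO x * D.σO (D.σO x) := by
  apply RingOfIntegers.ext
  rw [coe_algebraMap]
  change _ = (x : K) * D.σ (x : K) * D.σ (D.σ (x : K))
  rw [← D.norm_k0]
  congr 1
  exact Algebra.algebraMap_intNorm (A := 𝓞 D.k0) (K := D.k0) (L := K) (B := 𝓞 K) x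

lemma pow_left_inj_ideal {I J : Ideal (𝓞 K)} {n : ℕ} (hn : n ≠ 0) (h : I ^ n = J ^ n) : I = J := by
  apply le_antisymm
  · exact Ideal.dvd_iff_le.1 ((UniqueFactorizationMonoid.pow_dvd_pow_iff_dvd hn).1 h.symm.dvd)
  · exact Ideal.dvd_iff_le.1 ((UniqueFactorizationMonoid.pow_dvd_pow_iff_dvd hn).1 h.dvd)

lemma exists_pow_eq_span {I : Ideal (𝓞 K)} (hI : I ≠ ⊥) :
    ∃ n : ℕ, n ≠ 0 ∧ ∃ x : 𝓞 K, x ≠ 0 ∧ I ^ n = Ideal.span {x} := by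
  have hI0 : I ∈ (Ideal (𝓞 K))⁰ := mem_nonZeroDivisors_of_ne_zero hI
  refine ⟨Fintype.card (ClassGroup (𝓞 K)), Fintype.card_ne_zero, ?_⟩
  have h := pow_card_eq_one (x := ClassGroup.mk0 ⟨I, hI0⟩)
  rw [← map_pow, ClassGroup.mk0_eq_one_iff] at h
  obtain ⟨x, hx⟩ := h.principal
  have hx' : I ^ Fintype.card (ClassGroup (𝓞 K)) = Ideal.span {x} := by simpa using hx
  refine ⟨x, ?_, hx'⟩
  rintro rfl
  rw [Ideal.span_singleton_eq_bot.2 rfl] at hx'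
  exact hI (eq_zero_of_pow_eq_zero hx')

lemma exists_norm_ideal {I : Ideal (𝓞 K)} (hI : I ≠ ⊥) :
    ∃ a : 𝓞 D.k0, a ≠ 0 ∧ I * I.map D.σO * (I.map D.σO).map D.σO =
      Ideal.span {algebraMap (𝓞 D.k0) (𝓞 K) a} := by
  have := D.isPrincipalIdealRing
  obtain ⟨n, hn, x, hx, h⟩ := exists_pow_eq_span hI
  obtain ⟨a, ha⟩ := (inferInstance : (Ideal.relNorm (𝓞 D.k0) I).IsPrincipal)
  rw [Ideal.submodule_span_eq] at ha
  have key : Ideal.span {a ^ n} = Ideal.span {Algebra.intNorm (𝓞 D.k0) (𝓞 K) x} := by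
    rw [← Ideal.span_singleton_pow, ← ha, ← map_pow, h, Ideal.relNorm_singleton]
  have key2 : Ideal.span {algebraMap (𝓞 D.k0) (𝓞 K) (a ^ n)} =
      Ideal.span {x * D.σO x * D.σO (D.σO x)} := by
    have := congrArg (Ideal.map (algebraMap (𝓞 D.k0) (𝓞 K))) key
    rwa [Ideal.map_span, Ideal.map_span, Set.image_singleton, Set.image_singleton,
      intNorm_eq] at this
  refine ⟨a, ?_, ?_⟩
  · rintro rfl
    rw [Ideal.span_singleton_eq_bot.2 rfl, Ideal.relNorm_eq_bot_iff] at ha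
    exact hI ha
  · apply pow_left_inj_ideal hn
    rw [mul_pow, mul_pow, ← Ideal.map_pow, ← Ideal.map_pow, ← Ideal.map_pow, h, map_σO_span,
      map_σO_span, Ideal.span_singleton_mul_span_singleton,
      Ideal.span_singleton_mul_span_singleton, ← key2, Ideal.span_singleton_pow, map_pow]

lemma adjoin_eq_top {x : K} (hx : D.σ x ≠ x) : IntermediateField.adjoin D.k0 {x} = ⊤ := by
  have h3 : (Module.finrank D.k0 K).Prime := by rw [D.finrank_k0]; norm_num
  have := IntermediateField.isSimpleOrder_of_finrank_prime D.k0 K h3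
  rcases eq_bot_or_eq_top (IntermediateField.adjoin D.k0 {x}) with h | h
  · rw [IntermediateField.adjoin_simple_eq_bot_iff, IntermediateField.mem_bot] at h
    obtain ⟨y, rfl⟩ := h
    exact absurd (D.σ_coe_k0 y) hx
  · exact h

open Polynomial in
/-- The derivative of a cubic polynomial at a root which generates `K` lies in the different. -/
lemma mem_differentIdeal {x : 𝓞 K} (hx : D.σ (x : K) ≠ x) (a b c : 𝓞 D.k0)
    (h : x ^ 3 + algebraMap (𝓞 D.k0) (𝓞 K) a * x ^ 2 + algebraMap (𝓞 D.k0) (𝓞 K) b * x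
      + algebraMap (𝓞 D.k0) (𝓞 K) c = 0) :
    3 * x ^ 2 + 2 * algebraMap (𝓞 D.k0) (𝓞 K) a * x + algebraMap (𝓞 D.k0) (𝓞 K) b ∈
      differentIdeal (𝓞 D.k0) (𝓞 K) := by
  have htop := D.adjoin_eq_top hx
  have h_int : IsIntegral D.k0 (x : K) := Algebra.IsIntegral.isIntegral _
  have h_int' : IsIntegral (𝓞 D.k0) x := Algebra.IsIntegral.isIntegral _
  have hadj : Algebra.adjoin D.k0 {(x : K)} = ⊤ := by
    rw [← IntermediateField.adjoin_simple_toSubalgebra_of_isAlgebraic h_int.isAlgebraic, htop]; rfl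
  have hdeg : (minpoly D.k0 (x : K)).natDegree = 3 := by
    rw [← IntermediateField.adjoin.finrank h_int, htop, IntermediateField.finrank_top', D.finrank_k0]
  set f : (𝓞 D.k0)[X] := X ^ 3 + C a * X ^ 2 + C b * X + C c with hf
  have hfm : f.Monic := by rw [hf]; monicity!
  have hfd : f.natDegree = 3 := by rw [hf]; compute_degree!
  have hmin : minpoly (𝓞 D.k0) x = f := by
    refine (Polynomial.eq_of_monic_of_dvd_of_natDegree_le (minpoly.monic h_int') hfm ?_ ?_).symm
    · apply minpoly.isIntegrallyClosed_dvd h_int'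
      simp only [hf, map_add, map_mul, map_pow, aeval_X, aeval_C]
      exact h
    · rw [hfd, ← hdeg, minpoly.isIntegrallyClosed_eq_field_fractions D.k0 K h_int']
      exact Polynomial.natDegree_map_le
  have := aeval_derivative_mem_differentIdeal (𝓞 D.k0) D.k0 K x hadj
  rw [hmin] at this
  convert this using 1
  simp [hf]
  rw [map_ofNat]; ring

/-- A prime of `k₀` is unramified in `K` as soon as some different of an element of `𝓞 K` is not
divisible by it. -/
lemma squarefree_map {π : 𝓞 D.k0} (hπ : Prime π) {y : 𝓞 K}
    (hy : y ∈ differentIdeal (𝓞 D.k0) (𝓞 K)) {m : 𝓞 D.k0} {n : ℕ}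
    (hm : y ∣ (algebraMap (𝓞 D.k0) (𝓞 K) m) ^ n)
    (hπm : ¬ π ∣ m) : Squarefree (Ideal.span {algebraMap (𝓞 D.k0) (𝓞 K) π}) := by
  have hinj : Function.Injective (algebraMap (𝓞 D.k0) (𝓞 K)) :=
    FaithfulSMul.algebraMap_injective _ _
  have hπ0 : (Ideal.span {algebraMap (𝓞 D.k0) (𝓞 K) π}) ≠ 0 := by
    rw [Ne, Ideal.zero_eq_bot, Ideal.span_singleton_eq_bot, map_eq_zero_iff _ hinj]
    exact hπ.ne_zero
  have hπb : (Ideal.span {π}) ≠ ⊥ := by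
    rw [Ne, Ideal.span_singleton_eq_bot]; exact hπ.ne_zero
  have hprime : (Ideal.span {π}).IsPrime := (Ideal.span_singleton_prime hπ.ne_zero).2 hπ
  have hmax : (Ideal.span {π}).IsMaximal := hprime.isMaximal hπb
  rw [squarefree_iff_irreducible_sq_not_dvd_of_ne_zero hπ0]
  intro P hP hPπ
  have hPp : P.IsPrime := Ideal.isPrime_of_prime hP.prime
  have h1 : P ^ (2 - 1) ∣ differentIdeal (𝓞 D.k0) (𝓞 K) := by
    apply pow_sub_one_dvd_differentIdeal (𝓞 D.k0) (p := Ideal.span {π}) P 2 hπb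
    rw [Ideal.map_span, Set.image_singleton, sq]
    exact hPπ
  have h2 : y ∈ P := Ideal.dvd_iff_le.1 (by simpa using h1) hy
  have h3 : algebraMap (𝓞 D.k0) (𝓞 K) m ∈ P :=
    hPp.mem_of_pow_mem n (Ideal.mem_of_dvd _ hm h2)
  have h4 : algebraMap (𝓞 D.k0) (𝓞 K) π ∈ P :=
    Ideal.dvd_iff_le.1 ((Dvd.intro _ rfl).trans hPπ) (Ideal.mem_span_singleton_self _)
  have h5 : Ideal.span {π} = P.comap (algebraMap (𝓞 D.k0) (𝓞 K)) := by
    apply hmax.eq_of_le (Ideal.comap_ne_top _ hPp.ne_top)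
    rw [Ideal.span_singleton_le_iff_mem]; exact h4
  exact hπm (Ideal.mem_span_singleton.1 (h5 ▸ h3 : m ∈ Ideal.span {π}))

end PureCubic

lemma exists_eq_unit_mul_pow {R : Type*} [CommRing R] [IsDomain R] [UniqueFactorizationMonoid R]
    {x y z : R} (b : R) (hb : b ≠ 0)
    (h : ∀ π : R, Prime π → π ∣ b → Associated π x ∨ Associated π y ∨ Associated π z) :
    ∃ (u : Rˣ) (i j k : ℕ), b = u * x ^ i * y ^ j * z ^ k := by
  induction b using UniqueFactorizationMonoid.induction_on_prime with
  | h₁ => exact absurd rfl hb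
  | h₂ b hu => exact ⟨hu.unit, 0, 0, 0, by simp⟩
  | h₃ a π ha hπ ih =>
    obtain ⟨u, i, j, k, rfl⟩ := ih ha fun ρ hρ hd => h ρ hρ (hd.mul_left _)
    rcases h π hπ (dvd_mul_right _ _) with h | h | h
    · obtain ⟨v, rfl⟩ := h.symm
      exact ⟨u * v, i + 1, j, k, by push_cast; ring⟩
    · obtain ⟨v, rfl⟩ := h.symm
      exact ⟨u * v, i, j + 1, k, by push_cast; ring⟩
    · obtain ⟨v, rfl⟩ := h.symm
      exact ⟨u * v, i, j, k + 1, by push_cast; ring⟩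

/-- The primes of `k₀` which may ramify in `K`: they divide `p` or `c`, and there is only one
of them dividing `c`. -/
structure PureCubic.RamData {K : Type*} [Field K] [NumberField K] (D : PureCubic K) (p c : ℕ) where
  (π₁ π₂ π₃ : 𝓞 D.k0)
  ne₁ : π₁ ≠ 0
  ne₂ : π₂ ≠ 0
  ne₃ : π₃ ≠ 0
  ram : ∀ π : 𝓞 D.k0, Prime π → ¬ Associated π π₁ → ¬ Associated π π₂ → ¬ Associated π π₃ →
    Squarefree (Ideal.span {algebraMap (𝓞 D.k0) (𝓞 K) π})
  (i₁ i₂ i₃ : ℕ)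
  (n₁ n₂ n₃ : ℚ)
  n₁_ne : n₁ ≠ 0
  n₂_ne : n₂ ≠ 0
  n₃_ne : n₃ ≠ 0
  i₃_dvd : ¬ 3 ∣ i₃
  norm₁ : (π₁ : K) * D.τ (π₁ : K) = algebraMap ℚ K (p ^ i₁ * n₁ ^ 3)
  norm₂ : (π₂ : K) * D.τ (π₂ : K) = algebraMap ℚ K (p ^ i₂ * n₂ ^ 3)
  norm₃ : (π₃ : K) * D.τ (π₃ : K) = algebraMap ℚ K (c ^ i₃ * n₃ ^ 3)

namespace PureCubic

variable {K : Type*} [Field K] [NumberField K] (D : PureCubic K)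

lemma algebraMap_k0_injective : Function.Injective (algebraMap (𝓞 D.k0) (𝓞 K)) :=
  FaithfulSMul.algebraMap_injective _ _

lemma exists_cube_reduction {p c : ℕ} (P : D.RamData p c) (a : 𝓞 D.k0) :
    ∀ I : Ideal (𝓞 K), a ≠ 0 → I ^ 3 = Ideal.span {algebraMap (𝓞 D.k0) (𝓞 K) a} →
    ∃ m b : 𝓞 D.k0, m ≠ 0 ∧ b ≠ 0 ∧ a = m ^ 3 * b ∧ ∀ π : 𝓞 D.k0, Prime π → π ∣ b →
      Associated π P.π₁ ∨ Associated π P.π₂ ∨ Associated π P.π₃ := by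
  induction a using (wellFounded_dvdNotUnit (α := 𝓞 D.k0)).induction with
  | _ a ih =>
  intro I ha hI
  by_cases hall : ∀ π : 𝓞 D.k0, Prime π → π ∣ a →
      Associated π P.π₁ ∨ Associated π P.π₂ ∨ Associated π P.π₃
  · exact ⟨1, a, one_ne_zero, ha, by ring, hall⟩
  push Not at hall
  obtain ⟨π, hπ, hd, h1, h2, h3⟩ := hall
  have hsq := P.ram π hπ h1 h2 h3
  have hinj := D.algebraMap_k0_injective
  have hdI : Ideal.span {algebraMap (𝓞 D.k0) (𝓞 K) π} ∣ I := by
    rw [← hsq.dvd_pow_iff_dvd (n := 3) (by norm_num), hI]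
    obtain ⟨b, rfl⟩ := hd
    rw [map_mul, ← Ideal.span_singleton_mul_span_singleton]
    exact dvd_mul_right _ _
  obtain ⟨J, rfl⟩ := hdI
  have hdvd : algebraMap (𝓞 D.k0) (𝓞 K) (π ^ 3) ∣ algebraMap (𝓞 D.k0) (𝓞 K) a := by
    rw [← Ideal.span_singleton_le_span_singleton, ← hI, mul_pow, Ideal.span_singleton_pow, map_pow]
    exact Ideal.dvd_iff_le.1 (dvd_mul_right _ _)
  obtain ⟨y, hy⟩ := hdvd
  have hπ0 : (algebraMap (𝓞 D.k0) (𝓞 K) (π ^ 3)) ≠ 0 :=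
    (map_ne_zero_iff _ hinj).2 (pow_ne_zero _ hπ.ne_zero)
  have hyσ : D.σ (y : K) = y := by
    have h := congrArg D.σO hy
    rw [map_mul, D.σO_algebraMap, D.σO_algebraMap, hy] at h
    have := mul_left_cancel₀ hπ0 h
    rw [← coe_σO, ← this]
  obtain ⟨a', rfl⟩ := D.exists_algebraMap_eq hyσ
  rw [← map_mul] at hy
  have haa := hinj hy
  have ha' : a' ≠ 0 := by rintro rfl; simp at haa; exact ha haa
  have hJ : J ^ 3 = Ideal.span {algebraMap (𝓞 D.k0) (𝓞 K) a'} := by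
    rw [haa, mul_pow, map_mul, ← Ideal.span_singleton_mul_span_singleton,
      Ideal.span_singleton_pow, ← map_pow] at hI
    refine mul_left_cancel₀ ?_ hI
    rw [Ne, Ideal.zero_eq_bot, Ideal.span_singleton_eq_bot]; exact hπ0
  obtain ⟨m, b, hm, hb, hab, h⟩ := ih a' ⟨ha', π ^ 3, fun hu => hπ.not_isUnit
    ((isUnit_pow_iff (by norm_num)).1 hu), by rw [haa]; ring⟩ J ha' hJ
  exact ⟨π * m, b, mul_ne_zero hπ.ne_zero hm, hb, by rw [haa, hab]; ring, h⟩

/-- An element of `k₀` whose ideal is a cube in `K` is, up to units and cubes, a product of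
ramified primes. -/
lemma exists_eq_of_cube {p c : ℕ} (P : D.RamData p c) {a : 𝓞 D.k0} (ha : a ≠ 0)
    {I : Ideal (𝓞 K)} (hI : I ^ 3 = Ideal.span {algebraMap (𝓞 D.k0) (𝓞 K) a}) :
    ∃ (u : (𝓞 D.k0)ˣ) (m : 𝓞 D.k0) (i j k : ℕ), m ≠ 0 ∧
      a = u * m ^ 3 * (P.π₁ ^ i * P.π₂ ^ j * P.π₃ ^ k) := by
  have := D.isPrincipalIdealRing
  obtain ⟨m, b, hm, hb, hab, h⟩ := D.exists_cube_reduction P a I ha hI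
  obtain ⟨u, i, j, k, rfl⟩ := exists_eq_unit_mul_pow b hb h
  exact ⟨u, m, i, j, k, hm, by rw [hab]; ring⟩

/-- Units of `k₀` times cubes of elements of `k₀`. -/
def unitCubes : Subgroup Kˣ where
  carrier := {x | ∃ (e : (𝓞 K)ˣ) (m : K), D.σ (e : 𝓞 K) = (e : 𝓞 K) ∧ D.σ m = m ∧
    (x : K) = (e : 𝓞 K) * m ^ 3}
  one_mem' := ⟨1, 1, by simp, by simp, by simp⟩
  mul_mem' := by
    rintro x y ⟨u, m, hu, hm, hx⟩ ⟨v, n, hv, hn, hy⟩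
    refine ⟨u * v, m * n, ?_, by rw [map_mul, hm, hn], ?_⟩
    · rw [coe_mul_unit, map_mul, hu, hv]
    · rw [coe_mul_unit, Units.val_mul, hx, hy]; ring
  inv_mem' := by
    rintro x ⟨u, m, hu, hm, hx⟩
    have h : (((u⁻¹ : (𝓞 K)ˣ) : 𝓞 K) : K) = ((u : 𝓞 K) : K)⁻¹ := by
      apply eq_inv_of_mul_eq_one_left
      rw [← map_mul, Units.inv_mul, map_one]
    refine ⟨u⁻¹, m⁻¹, ?_, by rw [map_inv₀, hm], ?_⟩
    · rw [h, map_inv₀, hu]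
    · rw [h, Units.val_inv_eq_inv_val, hx, mul_inv, inv_pow]

lemma mem_unitCubes {x : Kˣ} : x ∈ D.unitCubes ↔ ∃ (e : (𝓞 K)ˣ) (m : K),
    D.σ (e : 𝓞 K) = (e : 𝓞 K) ∧ D.σ m = m ∧ (x : K) = (e : 𝓞 K) * m ^ 3 := Iff.rfl

/-- A nonzero element of `𝓞 k₀` as a unit of `K`. -/
def unitK0 {a : 𝓞 D.k0} (ha : a ≠ 0) : Kˣ :=
  Units.mk0 ((a : D.k0) : K) (by simpa using ha)

lemma coe_unitK0 {a : 𝓞 D.k0} (ha : a ≠ 0) : (D.unitK0 ha : K) = ((a : D.k0) : K) := rfl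

/-- The group `Kˣ` modulo units and cubes of `k₀`. -/
def ClsGroup : Type _ := Kˣ ⧸ D.unitCubes

instance : CommGroup D.ClsGroup := inferInstanceAs (CommGroup (Kˣ ⧸ D.unitCubes))

/-- The class of an element of `Kˣ` modulo units and cubes of `k₀`. -/
def cls : Kˣ →* D.ClsGroup := QuotientGroup.mk' _

lemma cls_eq_one {x : Kˣ} : D.cls x = 1 ↔ x ∈ D.unitCubes := QuotientGroup.eq_one_iff _

lemma cls_eq_cls {x y : Kˣ} : D.cls x = D.cls y ↔ x / y ∈ D.unitCubes := by
  refine (QuotientGroup.eq_iff_div_mem (N := D.unitCubes)).trans Iff.rfl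

lemma exists_cls_eq_of_cube {p c : ℕ} (P : D.RamData p c) {a : 𝓞 D.k0} (ha : a ≠ 0)
    {I : Ideal (𝓞 K)} (hI : I ^ 3 = Ideal.span {algebraMap (𝓞 D.k0) (𝓞 K) a}) :
    ∃ i j k : ℕ, D.cls (D.unitK0 ha) = D.cls (D.unitK0 P.ne₁) ^ i * D.cls (D.unitK0 P.ne₂) ^ j *
      D.cls (D.unitK0 P.ne₃) ^ k := by
  obtain ⟨u, m, i, j, k, hm, h⟩ := D.exists_eq_of_cube P ha hI
  refine ⟨i, j, k, ?_⟩
  rw [← map_pow, ← map_pow, ← map_pow, ← map_mul, ← map_mul, cls_eq_cls]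
  refine ⟨_root_.Units.map (algebraMap (𝓞 D.k0) (𝓞 K) : 𝓞 D.k0 →* 𝓞 K) u, ((m : D.k0) : K),
    D.σ_coe_k0 _, D.σ_coe_k0 _, ?_⟩
  have h' : ((a : D.k0) : K) = (((u : 𝓞 D.k0) : D.k0) : K) * ((m : D.k0) : K) ^ 3 *
      (((P.π₁ : D.k0) : K) ^ i * ((P.π₂ : D.k0) : K) ^ j * ((P.π₃ : D.k0) : K) ^ k) := by
    have := congrArg (fun x : 𝓞 D.k0 => ((x : D.k0) : K)) h
    simpa using this
  have h1 : ((P.π₁ : D.k0) : K) ≠ 0 := by simpa using P.ne₁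
  have h2 : ((P.π₂ : D.k0) : K) ≠ 0 := by simpa using P.ne₂
  have h3 : ((P.π₃ : D.k0) : K) ≠ 0 := by simpa using P.ne₃
  simp only [Units.val_div_eq_div_val, Units.val_mul, Units.val_pow_eq_pow_val, coe_unitK0]
  rw [h', mul_div_assoc, div_self (by positivity), mul_one]
  rfl

end PureCubic

lemma NumberField.Units.exists_of_pow {K : Type*} [Field K] [NumberField K] {z : K} {n : ℕ}
    (hn : 0 < n) {u : (𝓞 K)ˣ} (h : z ^ n = (u : 𝓞 K)) : ∃ v : (𝓞 K)ˣ, ((v : 𝓞 K) : K) = z := by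
  have h1 : IsIntegral ℤ z := IsIntegral.of_pow hn (h ▸ RingOfIntegers.isIntegral_coe _)
  let y : 𝓞 K := ⟨z, h1⟩
  have hy : y ^ n = u := RingOfIntegers.ext ((map_pow (algebraMap (𝓞 K) K) y n).trans h)
  have : IsUnit y := by
    rw [← isUnit_pow_iff hn.ne', hy]; exact u.isUnit
  exact ⟨this.unit, rfl⟩

namespace PureCubic

variable {K : Type*} [Field K] [NumberField K] (D : PureCubic K)

/-- The norm `K → k₀`, with values in `K`. -/
def normU : Kˣ →* Kˣ :=
  MonoidHom.mk' (fun x => x * Units.map (D.σ : K →* K) x *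
    Units.map (D.σ : K →* K) (Units.map (D.σ : K →* K) x)) (by
    intro x y
    simp only [map_mul]
    apply Additive.ofMul.injective; simp only [ofMul_mul]; abel)

lemma coe_normU (x : Kˣ) : (D.normU x : K) = x * D.σ x * D.σ (D.σ x) := rfl

/-- The norm of ambiguous elements modulo units and cubes. -/
def χ : D.ambig →* D.ClsGroup := (D.cls.comp D.normU).comp D.ambig.subtype

lemma χ_apply (x : D.ambig) : D.χ x = D.cls (D.normU x) := rfl

variable (hN : ∀ x : K, x * D.σ x * D.σ (D.σ x) ≠ D.ζ)

lemma χ_eq_one (hN : ∀ x : K, x * D.σ x * D.σ (D.σ x) ≠ D.ζ) {x : D.ambig} :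
    D.χ x = 1 ↔ D.ψ hN x = 1 := by
  rw [χ_apply, cls_eq_one, mem_unitCubes, ψ_eq_one_iff]
  constructor
  · rintro ⟨e, m, he, hm, h⟩
    rw [coe_normU] at h
    have hx0 : ((x : Kˣ) : K) ≠ 0 := Units.ne_zero _
    have hm0 : m ≠ 0 := by
      rintro rfl
      have : ((D.normU x : Kˣ) : K) = 0 := by rw [coe_normU, h]; simp
      exact Units.ne_zero _ this
    obtain ⟨u, hu⟩ := x.2
    set X : K := ((x : Kˣ) : K) with hX
    have hu2 : D.σ (D.σ X) = D.σ (u : 𝓞 K) * (u : 𝓞 K) * X := by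
      rw [hu, map_mul, hu]; ring
    rw [hu2, hu] at h
    have hu0 := coe_unit_ne_zero u
    have hinv : (((u⁻¹ : (𝓞 K)ˣ) : 𝓞 K) : K) = ((u : 𝓞 K) : K)⁻¹ := by
      apply eq_inv_of_mul_eq_one_left
      rw [← map_mul, Units.inv_mul, map_one]
    obtain ⟨v, hv⟩ := NumberField.Units.exists_of_pow (z := X / m) (n := 3) (by norm_num)
      (u := e * u⁻¹ * u⁻¹ * Units.autMap D.σ u⁻¹) (by
        simp only [coe_mul_unit, Units.coe_autMap, hinv, map_inv₀]
        have hs : D.σ ((u : 𝓞 K) : K) ≠ 0 := by simp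
        field_simp
        linear_combination h)
    exact ⟨m, v, hm, by rw [hv]; field_simp⟩
  · rintro ⟨y, e, hy, h⟩
    rcases D.norm_unit hN e with he | he
    · refine ⟨1, y, by simp, hy, ?_⟩
      rw [coe_normU, h, map_mul, map_mul, hy, hy]
      simp; linear_combination y ^ 3 * he
    · refine ⟨-1, y, by simp, hy, ?_⟩
      rw [coe_normU, h, map_mul, map_mul, hy, hy]
      simp; linear_combination y ^ 3 * he

lemma ker_χ : (D.χ).ker = (D.ψ hN).ker := by
  ext x
  rw [MonoidHom.mem_ker, MonoidHom.mem_ker, χ_eq_one]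

lemma card_map_χ (S : Subgroup D.ambig) : Nat.card (S.map D.χ) = Nat.card (S.map (D.ψ hN)) := by
  rw [← Subgroup.relIndex_ker, ← Subgroup.relIndex_ker, ker_χ]

lemma card_range_χ (hN : ∀ x : K, x * D.σ x * D.σ (D.σ x) ≠ D.ζ) : Nat.card (D.χ).range = 9 := by
  rw [← Subgroup.index_ker, D.ker_χ hN, Subgroup.index_ker,
    MonoidHom.range_eq_top.2 (D.ψ_surjective hN), Subgroup.card_top, ← Subgroup.index]
  exact D.index_Y_eq hN

lemma cls_pow_three {x : Kˣ} (hx : D.σ (x : K) = x) : D.cls x ^ 3 = 1 := by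
  rw [← map_pow, cls_eq_one]
  exact ⟨1, x, by simp, hx, by simp⟩

lemma cls_unitK0_pow {a : 𝓞 D.k0} (ha : a ≠ 0) : D.cls (D.unitK0 ha) ^ 3 = 1 :=
  D.cls_pow_three (D.σ_coe_k0 _)

lemma unit_mul_τ {e : (𝓞 K)ˣ} (he : D.σ ((e : 𝓞 K) : K) = (e : 𝓞 K)) :
    ((e : 𝓞 K) : K) * D.τ (e : 𝓞 K) = 1 := by
  obtain ⟨i, j, rfl⟩ := D.exists_unit_eq he
  simp only [coe_mul_unit, Units.val_pow_eq_pow_val, map_mul, map_pow, coe_zU, Units.val_neg,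
    Units.val_one, map_neg, map_one, D.τ_ζ]
  have h1 : ((-1 : K) ^ i) ^ 2 = 1 := by rw [← pow_mul, mul_comm, pow_mul]; simp
  have h2 : D.ζ ^ j * (D.ζ ^ 2) ^ j = 1 := by
    rw [← mul_pow, ← pow_succ', D.ζ_pow, one_pow]
  calc (-1 : K) ^ i * D.ζ ^ j * ((-1) ^ i * (D.ζ ^ 2) ^ j)
      = ((-1 : K) ^ i) ^ 2 * (D.ζ ^ j * (D.ζ ^ 2) ^ j) := by ring
    _ = 1 := by rw [h1, h2, one_mul]

/-- If `x` and `y` are congruent modulo units and cubes, then so are their absolute norms. -/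
lemma exists_mul_τ_eq {x y : Kˣ} (h : D.cls x = D.cls y) :
    ∃ n : ℚ, n ≠ 0 ∧ (x : K) * D.τ x = y * D.τ y * algebraMap ℚ K (n ^ 3) := by
  rw [cls_eq_cls] at h
  obtain ⟨e, m, he, hm, hxy⟩ := h
  obtain ⟨n, hn⟩ := D.exists_rat (x := m * D.τ m) (by rw [map_mul, hm, D.σ_τ, hm, hm])
    (by rw [map_mul, D.τ_τ, mul_comm])
  have hy : (x : K) = (e : 𝓞 K) * m ^ 3 * y := by
    rw [← hxy, Units.val_div_eq_div_val, div_mul_cancel₀ _ (Units.ne_zero _)]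
  have h1 := D.unit_mul_τ he
  have h2 : (x : K) * D.τ x = y * D.τ y * algebraMap ℚ K (n ^ 3) := by
    rw [hy, map_pow, ← hn, map_mul, map_mul, map_pow]
    linear_combination m ^ 3 * y * (D.τ m) ^ 3 * D.τ y * h1
  refine ⟨n, ?_, h2⟩
  rintro rfl
  simp at h2

end PureCubic

namespace PureCubic

variable {K : Type*} [Field K] [NumberField K] (D : PureCubic K)

lemma exists_coe_eq_mul (x : Kˣ) : ∃ (n : ℚ) (y : 𝓞 K), n ≠ 0 ∧ y ≠ 0 ∧
    (y : K) = algebraMap ℚ K n * x := by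
  have h : IsAlgebraic ℤ (x : K) :=
    (IsFractionRing.isAlgebraic_iff ℤ ℚ K).2 (Algebra.IsAlgebraic.isAlgebraic _)
  obtain ⟨n, hn, hx⟩ := h.exists_integral_multiple
  refine ⟨n, ⟨_, hx⟩, by exact_mod_cast hn, ?_, ?_⟩
  · intro h0
    have := congrArg (fun y : 𝓞 K => (y : K)) h0
    simp [hn] at this
  · change n • (x : K) = _
    simp

lemma exists_norm_eq {y : 𝓞 K} (hy : y ≠ 0) : ∃ (a : 𝓞 D.k0) (ha : a ≠ 0),
    algebraMap (𝓞 D.k0) (𝓞 K) a = y * D.σO y * D.σO (D.σO y) ∧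
    D.unitK0 ha = D.normU (Units.mk0 (y : K) (by simpa using hy)) := by
  have h := D.intNorm_eq y
  have ha : Algebra.intNorm (𝓞 D.k0) (𝓞 K) y ≠ 0 := by
    intro h0
    rw [h0, map_zero, eq_comm] at h
    simp [hy] at h
  refine ⟨_, ha, h, ?_⟩
  apply Units.ext
  exact congrArg (fun y : 𝓞 K => (y : K)) h

lemma span_mul_map (y : 𝓞 K) : Ideal.span {y} * (Ideal.span {y}).map D.σO *
    ((Ideal.span {y}).map D.σO).map D.σO = Ideal.span {y * D.σO y * D.σO (D.σO y)} := by
  rw [map_σO_span, map_σO_span, Ideal.span_singleton_mul_span_singleton,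
    Ideal.span_singleton_mul_span_singleton]

/-- An ambiguous principal ideal is generated, up to a rational factor, by an ambiguous
integer. -/
lemma exists_integral_of_ambig (x : D.ambig) : ∃ (y : 𝓞 K) (a : 𝓞 D.k0) (ha : a ≠ 0), y ≠ 0 ∧
    (Ideal.span {y}).map D.σO = Ideal.span {y} ∧
    (Ideal.span {y}) ^ 3 = Ideal.span {algebraMap (𝓞 D.k0) (𝓞 K) a} ∧
    D.cls (D.unitK0 ha) = D.χ x := by
  obtain ⟨n, y, hn, hy, h⟩ := exists_coe_eq_mul (x : Kˣ)
  obtain ⟨a, ha, h1, h2⟩ := D.exists_norm_eq hy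
  obtain ⟨u, hu⟩ := x.2
  have hyu : D.σO y = u * y := by
    apply RingOfIntegers.ext
    rw [coe_σO]
    change _ = ((u : 𝓞 K) : K) * (y : K)
    rw [h, map_mul, hu, AlgEquiv.commutes]; ring
  have hmap : (Ideal.span {y}).map D.σO = Ideal.span {y} := by
    rw [map_σO_span, hyu]
    exact Ideal.span_singleton_mul_left_unit u.isUnit y
  refine ⟨y, a, ha, hy, hmap, ?_, ?_⟩
  · rw [h1, ← span_mul_map, hmap, hmap]; ring
  · rw [χ_apply, cls_eq_cls, h2]
    refine ⟨1, algebraMap ℚ K n, by simp, by simp, ?_⟩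
    rw [Units.val_div_eq_div_val, coe_normU, coe_normU, Units.val_mk0, h]
    simp only [map_mul, AlgEquiv.commutes]
    have h0 : ((x : Kˣ) : K) ≠ 0 := Units.ne_zero _
    have h1 : D.σ ((x : Kˣ) : K) ≠ 0 := by simp
    have h2 : D.σ (D.σ ((x : Kˣ) : K)) ≠ 0 := by simp
    field_simp
    simp

variable {p c : ℕ}

lemma χ_eq (P : D.RamData p c) (x : D.ambig) : ∃ i j k : ℕ, D.χ x = D.cls (D.unitK0 P.ne₁) ^ i *
    D.cls (D.unitK0 P.ne₂) ^ j * D.cls (D.unitK0 P.ne₃) ^ k := by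
  obtain ⟨y, a, ha, -, -, h, h'⟩ := D.exists_integral_of_ambig x
  rw [← h']
  exact D.exists_cls_eq_of_cube P ha h

lemma exists_norm_of_cls (P : D.RamData p c) {x : Kˣ} {i j k : ℕ} (h : D.cls x = D.cls (D.unitK0 P.ne₁) ^ i *
    D.cls (D.unitK0 P.ne₂) ^ j * D.cls (D.unitK0 P.ne₃) ^ k) :
    ∃ n : ℚ, n ≠ 0 ∧ (x : K) * D.τ x =
      algebraMap ℚ K (p ^ (P.i₁ * i + P.i₂ * j) * c ^ (P.i₃ * k) * n ^ 3) := by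
  rw [← map_pow, ← map_pow, ← map_pow, ← map_mul, ← map_mul] at h
  obtain ⟨n, hn, h⟩ := D.exists_mul_τ_eq h
  refine ⟨P.n₁ ^ i * P.n₂ ^ j * P.n₃ ^ k * n, ?_, ?_⟩
  · have := P.n₁_ne; have := P.n₂_ne; have := P.n₃_ne
    positivity
  · rw [h]
    simp only [Units.val_mul, Units.val_pow_eq_pow_val, coe_unitK0, map_mul, map_pow]
    have h1 := P.norm₁; have h2 := P.norm₂; have h3 := P.norm₃
    simp only [map_mul, map_pow] at h1 h2 h3
    calc _ = (((P.π₁ : D.k0) : K) * D.τ ((P.π₁ : D.k0) : K)) ^ i *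
          (((P.π₂ : D.k0) : K) * D.τ ((P.π₂ : D.k0) : K)) ^ j *
          (((P.π₃ : D.k0) : K) * D.τ ((P.π₃ : D.k0) : K)) ^ k * (algebraMap ℚ K n) ^ 3 := by ring
      _ = _ := by rw [h1, h2, h3]; ring

lemma exists_norm_of_cls' (P : D.RamData p c) {x : Kˣ} {k : ℕ} (h : D.cls x = D.cls (D.unitK0 P.ne₃) ^ k) :
    ∃ n : ℚ, n ≠ 0 ∧ (x : K) * D.τ x = algebraMap ℚ K (c ^ (P.i₃ * k) * n ^ 3) := by
  obtain ⟨n, hn, h⟩ := D.exists_norm_of_cls P (i := 0) (j := 0) (k := k) (x := x) (by simp [h])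
  exact ⟨n, hn, by simpa using h⟩

/-- A nonzero rational number as a unit of `K`. -/
def unitQ {q : ℚ} (hq : q ≠ 0) : Kˣ := Units.mk0 (algebraMap ℚ K q) (by simpa using hq)

lemma coe_unitQ {q : ℚ} (hq : q ≠ 0) : (unitQ (K := K) hq : K) = algebraMap ℚ K q := rfl

lemma cls_unitQ_pow {q : ℚ} (hq : q ≠ 0) : D.cls (unitQ hq) ^ 3 = 1 :=
  D.cls_pow_three (by rw [coe_unitQ, AlgEquiv.commutes])

/-- If every unit class comes from `L`, then `c` or its square is a norm up to cubes. -/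
lemma exists_norm_of_relIndex_eq_nine (P : D.RamData p c) (hN : ∀ x : K, x * D.σ x * D.σ (D.σ x) ≠ D.ζ)
    (hp : p ≠ 0) (hc : c ≠ 0)
    (h9 : (D.unitAction hN).Y.relIndex (D.unitAction hN).plus = 9) :
    ∃ (y : K) (n : ℚ), n ≠ 0 ∧ y * D.σ y * D.σ (D.σ y) = algebraMap ℚ K (c ^ 2 * n ^ 3) := by
  have hcard : Nat.card (D.ambigL.map D.χ) = 9 := by
    rw [D.card_map_χ hN, map_ambigL, card_map_mk', h9]
  have hp' : (p : ℚ) ≠ 0 := by exact_mod_cast hp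
  have hc' : (c : ℚ) ≠ 0 := by exact_mod_cast hc
  have hmem : D.cls (unitQ hc') ∈ D.ambigL.map D.χ := by
    refine mem_of_card_eq_nine hcard (D.cls_unitQ_pow hp') (D.cls_unitQ_pow hc') ?_
    rintro _ ⟨x, hx, rfl⟩
    obtain ⟨i, j, k, h⟩ := D.χ_eq P x
    rw [χ_apply] at h
    obtain ⟨n, hn, h1⟩ := D.exists_norm_of_cls P h
    have hx' : D.τ ((x : Kˣ) : K) = ((x : Kˣ) : K) := D.mem_ambigL.1 hx
    have h2 : D.τ (D.normU x : K) = D.normU x := by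
      rw [coe_normU, map_mul, map_mul, D.τ_σ, D.τ_σ, D.τ_σ, hx', D.σ_σ_σ]; ring
    have hσ : D.σ (D.normU x : K) = D.normU x := by
      rw [coe_normU, map_mul, map_mul, D.σ_σ_σ]; ring
    have h3 := D.cls_pow_three hσ
    refine ⟨2 * (P.i₁ * i + P.i₂ * j), 2 * (P.i₃ * k), ?_⟩
    have h4 : D.cls (D.normU x) ^ 2 = D.cls (unitQ hp') ^ (P.i₁ * i + P.i₂ * j) *
        D.cls (unitQ hc') ^ (P.i₃ * k) := by
      rw [← map_pow D.cls, ← map_pow D.cls, ← map_pow D.cls, ← map_mul D.cls, cls_eq_cls]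
      refine ⟨1, algebraMap ℚ K n, by simp, by simp, ?_⟩
      rw [h2] at h1
      rw [Units.val_div_eq_div_val, Units.val_pow_eq_pow_val, pow_two, h1]
      simp [coe_unitQ, hp', hc', hp, hc]
    rw [χ_apply, mul_comm 2, mul_comm 2, pow_mul, pow_mul, ← mul_pow, ← h4, ← pow_mul]
    calc _ = D.cls (D.normU x) ^ 3 * D.cls (D.normU x) := by rw [h3, one_mul]
      _ = _ := by rw [← pow_succ]
  obtain ⟨y, hy, h⟩ := hmem
  rw [χ_apply] at h
  obtain ⟨n, hn, h1⟩ := D.exists_mul_τ_eq h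
  have hy' : D.τ ((y : Kˣ) : K) = ((y : Kˣ) : K) := D.mem_ambigL.1 hy
  have h2 : D.τ (D.normU y : K) = D.normU y := by
    rw [coe_normU, map_mul, map_mul, D.τ_σ, D.τ_σ, D.τ_σ, hy', D.σ_σ_σ]; ring
  rw [h2, coe_normU, coe_unitQ, AlgEquiv.commutes] at h1
  refine ⟨((y : Kˣ) : K) ^ 2, n, hn, ?_⟩
  simp only [map_pow, map_mul] at h1 ⊢
  linear_combination h1

lemma ambig_θ_aux : D.σ D.θ = (D.zU : 𝓞 K) * D.θ := by rw [D.σ_θ, coe_zU]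

/-- `θ` as an ambiguous element. -/
def ambigθ : D.ambig := ⟨Units.mk0 D.θ D.θ_ne_zero, D.zU, D.ambig_θ_aux⟩

lemma ambigθ_mem : D.ambigθ ∈ D.ambigL := D.mem_ambigL.2 D.τ_θ

lemma ψ_ambigθ (hN : ∀ x : K, x * D.σ x * D.σ (D.σ x) ≠ D.ζ) : D.ψ hN D.ambigθ ≠ 1 := by
  rw [Ne, ψ_eq_one, D.unitOf_eq (u := D.zU) D.ambig_θ_aux]
  exact D.z_not_mem_Y hN

end PureCubic

/-- Comparing valuations at two primes. -/
lemma three_dvd_of_pow_mul_eq {p c d i j : ℕ} [hp : Fact p.Prime] [hc : Fact c.Prime]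
    (hpc : p ≠ c) (hd0 : d ≠ 0) (hd : ¬ 3 ∣ padicValNat p d) {r n : ℚ} (hr : r ≠ 0) (hn : n ≠ 0)
    {s : ℤ} (hs : s = 1 ∨ s = -1) (h : s * (d : ℚ) ^ j * r ^ 3 = c ^ i * n ^ 3) : 3 ∣ i := by
  have hd' : (d : ℚ) ≠ 0 := by exact_mod_cast hd0
  have hc' : (c : ℚ) ≠ 0 := by exact_mod_cast hc.out.ne_zero
  have hval : ∀ (l : ℕ) [Fact l.Prime], j * (padicValNat l d : ℤ) + 3 * padicValRat l r =
      i * (padicValNat l c : ℤ) + 3 * padicValRat l n := by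
    intro l _
    have h' : (d : ℚ) ^ j * r ^ 3 = c ^ i * n ^ 3 ∨ (d : ℚ) ^ j * r ^ 3 = -(c ^ i * n ^ 3) := by
      rcases hs with rfl | rfl
      · left; push_cast at h; linarith
      · right; push_cast at h; linarith
    have h2 : padicValRat l ((d : ℚ) ^ j * r ^ 3) = padicValRat l (c ^ i * n ^ 3) := by
      rcases h' with h' | h'
      · rw [h']
      · rw [h', padicValRat.neg]
    rw [padicValRat.mul (by positivity) (by positivity), padicValRat.mul (by positivity)
      (by positivity), padicValRat.pow, padicValRat.pow,
      padicValRat.pow, padicValRat.pow, padicValRat.of_nat, padicValRat.of_nat] at h2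
    exact_mod_cast h2
  have h1 := hval p
  rw [padicValNat_primes hpc] at h1
  have h3 : 3 ∣ j * padicValNat p d := by
    have : (3 : ℤ) ∣ j * (padicValNat p d : ℤ) :=
      ⟨padicValRat p n - padicValRat p r, by
        simp only [Nat.cast_zero, mul_zero] at h1; linarith⟩
    exact_mod_cast this
  rcases (Nat.Prime.dvd_mul Nat.prime_three).1 h3 with ⟨j', rfl⟩ | h3
  · have h2 := hval c
    rw [padicValNat_self] at h2
    have : (3 : ℤ) ∣ i := ⟨j' * (padicValNat c d : ℤ) + padicValRat c r - padicValRat c n, by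
      simp only [Nat.cast_one, Nat.cast_mul, Nat.cast_ofNat, mul_one] at h2; linarith⟩
    exact_mod_cast this
  · exact absurd h3 hd

namespace PureCubic

variable {K : Type*} [Field K] [NumberField K] (D : PureCubic K)

lemma not_mem_range_χ {p c : ℕ} (P : D.RamData p c) [hp : Fact p.Prime] [hc : Fact c.Prime]
    (hpc : p ≠ c) (hd : ¬ 3 ∣ padicValNat p D.d)
    (hN : ∀ x : K, x * D.σ x * D.σ (D.σ x) ≠ D.ζ)
    (h3 : (D.unitAction hN).Y.relIndex (D.unitAction hN).plus = 3) :
    D.cls (D.unitK0 P.ne₃) ∉ (D.χ).range := by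
  rintro ⟨x, hx⟩
  rw [χ_apply, ← pow_one (D.cls (D.unitK0 P.ne₃))] at hx
  obtain ⟨n, hn, h⟩ := D.exists_norm_of_cls' P hx
  have hcard : Nat.card (D.ambigL.map (D.ψ hN)) = 3 := by rw [map_ambigL, card_map_mk', h3]
  have := Fact.mk Nat.prime_three
  have hw := D.mul_ambigτ_mem x
  set w := x * D.ambigτ x with hwdef
  obtain ⟨j, hj⟩ := Submonoid.mem_powers_iff _ _ |>.1 (mem_powers_of_prime_card hcard
    (g := ⟨D.ψ hN D.ambigθ, D.ambigθ, D.ambigθ_mem, rfl⟩) (g' := ⟨D.ψ hN w, w, hw, rfl⟩)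
    (fun h => D.ψ_ambigθ hN (congrArg Subtype.val h)))
  have hj' : D.ψ hN D.ambigθ ^ j = D.ψ hN w := congrArg Subtype.val hj
  have h1 : D.ψ hN (w / D.ambigθ ^ j) = 1 := by rw [map_div, map_pow, hj', div_self']
  rw [D.ψ_eq_one_iff_of_mem hN (div_mem hw (pow_mem D.ambigθ_mem j))] at h1
  obtain ⟨r, e, he, h1⟩ := h1
  have hθ : ((D.ambigθ : Kˣ) : K) = D.θ := rfl
  have h2 : ((w : Kˣ) : K) = D.θ ^ j * (algebraMap ℚ K r * (e : 𝓞 K)) := by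
    rw [← h1, Subgroup.coe_div, Units.val_div_eq_div_val, Subgroup.coe_pow,
      Units.val_pow_eq_pow_val, hθ]
    have := D.θ_ne_zero
    field_simp
  have hnw : (D.normU w : K) = algebraMap ℚ K (c ^ P.i₃ * n ^ 3) := by
    have e1 : ((w : Kˣ) : K) = ((x : Kˣ) : K) * D.τ ((x : Kˣ) : K) := rfl
    rw [coe_normU, e1]
    rw [coe_normU, mul_one] at h
    rw [← h]
    simp only [map_mul, D.τ_σ, D.σ_σ_σ]
    ring
  have hr : r ≠ 0 := by
    rintro rfl
    have := Units.ne_zero (w : Kˣ)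
    rw [h2, map_zero, zero_mul, mul_zero] at this
    exact this rfl
  have hnorm : ∀ s : ℤ, ((e : 𝓞 K) : K) * D.σ (e : 𝓞 K) * D.σ (D.σ (e : 𝓞 K)) = s →
      s * (D.d : ℚ) ^ j * r ^ 3 = c ^ P.i₃ * n ^ 3 := by
    intro s hs
    apply (algebraMap ℚ K).injective
    rw [← hnw, coe_normU, h2]
    simp only [map_mul, map_pow, D.σ_θ, D.σ_ζ, AlgEquiv.commutes]
    have hd : algebraMap ℚ K (D.d : ℚ) = D.θ ^ 3 := by rw [D.θ_pow]; simp
    rw [hd, map_intCast, ← hs]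
    have h3 : (D.ζ ^ j) ^ 3 = 1 := by rw [← pow_mul, mul_comm, pow_mul, D.ζ_pow, one_pow]
    simp only [mul_pow]
    calc _ = (D.ζ ^ j) ^ 3 * ((e : 𝓞 K) * D.σ (e : 𝓞 K) * D.σ (D.σ (e : 𝓞 K)) * (D.θ ^ 3) ^ j *
          algebraMap ℚ K r ^ 3) := by rw [h3]; ring
      _ = _ := by ring
  refine P.i₃_dvd ?_
  rcases D.norm_unit hN e with h | h
  · exact three_dvd_of_pow_mul_eq hpc D.d_ne_zero hd hr hn (Or.inl rfl) (hnorm 1 (by simpa using h))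
  · exact three_dvd_of_pow_mul_eq hpc D.d_ne_zero hd hr hn (Or.inr rfl) (hnorm (-1) (by simpa using h))

end PureCubic

namespace PureCubic

variable {K : Type*} [Field K] [NumberField K] (D : PureCubic K)

lemma map_σO_ne_bot {I : Ideal (𝓞 K)} (hI : I ≠ ⊥) : I.map D.σO ≠ ⊥ := by
  rwa [Ne, Ideal.map_eq_bot_iff_of_injective D.σO.injective]

/-- The action of `σ` on nonzero ideals. -/
def idealMap : (Ideal (𝓞 K))⁰ →* (Ideal (𝓞 K))⁰ where
  toFun I := ⟨(I : Ideal (𝓞 K)).map D.σO, mem_nonZeroDivisors_of_ne_zero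
    (D.map_σO_ne_bot (nonZeroDivisors.ne_zero I.2))⟩
  map_one' := by
    apply Subtype.ext
    change Ideal.map D.σO (1 : Ideal (𝓞 K)) = 1
    rw [Ideal.one_eq_top]
    exact Ideal.map_top _
  map_mul' I J := by
    apply Subtype.ext
    change Ideal.map D.σO ((I : Ideal (𝓞 K)) * (J : Ideal (𝓞 K))) =
      Ideal.map D.σO (I : Ideal (𝓞 K)) * Ideal.map D.σO (J : Ideal (𝓞 K))
    exact Ideal.map_mul _ _ _

lemma coe_idealMap (I : (Ideal (𝓞 K))⁰) :
    (D.idealMap I : Ideal (𝓞 K)) = (I : Ideal (𝓞 K)).map D.σO := rfl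

lemma mk0_idealMap {I J : (Ideal (𝓞 K))⁰} (h : ClassGroup.mk0 I = ClassGroup.mk0 J) :
    ClassGroup.mk0 (D.idealMap I) = ClassGroup.mk0 (D.idealMap J) := by
  rw [ClassGroup.mk0_eq_mk0_iff] at h ⊢
  obtain ⟨x, y, hx, hy, h⟩ := h
  refine ⟨D.σO x, D.σO y, by simpa using hx, by simpa using hy, ?_⟩
  have := congrArg (Ideal.map D.σO) h
  rwa [Ideal.map_mul, Ideal.map_mul, map_σO_span, map_σO_span] at this

/-- The action of `σ` on the class group. -/
def classMap : ClassGroup (𝓞 K) →* ClassGroup (𝓞 K) :=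
  MonoidHom.mk' (fun C => ClassGroup.mk0 (D.idealMap (ClassGroup.mk0_surjective C).choose)) (by
    intro C C'
    rw [← map_mul, ← map_mul]
    apply mk0_idealMap
    rw [map_mul, (ClassGroup.mk0_surjective _).choose_spec,
      (ClassGroup.mk0_surjective _).choose_spec, (ClassGroup.mk0_surjective _).choose_spec])

lemma classMap_mk0 (I : (Ideal (𝓞 K))⁰) :
    D.classMap (ClassGroup.mk0 I) = ClassGroup.mk0 (D.idealMap I) :=
  D.mk0_idealMap (ClassGroup.mk0_surjective _).choose_spec

lemma classMap_norm (C : ClassGroup (𝓞 K)) :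
    C * D.classMap C * D.classMap (D.classMap C) = 1 := by
  obtain ⟨I, rfl⟩ := ClassGroup.mk0_surjective C
  obtain ⟨a, ha, h⟩ := D.exists_norm_ideal (nonZeroDivisors.ne_zero I.2)
  rw [classMap_mk0, classMap_mk0, ← map_mul, ← map_mul, ClassGroup.mk0_eq_one_iff,
    Submonoid.coe_mul, Submonoid.coe_mul, coe_idealMap, coe_idealMap, coe_idealMap, h]
  infer_instance

/-- An invariant ideal class contains an invariant ideal. -/
lemma exists_invariant_ideal (hN : ∀ x : K, x * D.σ x * D.σ (D.σ x) ≠ D.ζ)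
    {C : ClassGroup (𝓞 K)} (hC : D.classMap C = C) :
    ∃ J : (Ideal (𝓞 K))⁰, ClassGroup.mk0 J = C ∧
      (J : Ideal (𝓞 K)).map D.σO = J := by
  obtain ⟨I, rfl⟩ := ClassGroup.mk0_surjective C
  rw [classMap_mk0, ClassGroup.mk0_eq_mk0_iff] at hC
  obtain ⟨x, y, hx, hy, h⟩ := hC
  rw [coe_idealMap] at h
  have hI0 : (I : Ideal (𝓞 K)) ≠ ⊥ := nonZeroDivisors.ne_zero I.2
  obtain ⟨a, ha, hnorm⟩ := D.exists_norm_ideal hI0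
  have hσ3 : (((I : Ideal (𝓞 K)).map D.σO).map D.σO).map D.σO = (I : Ideal (𝓞 K)) := by
    change Ideal.map (D.σO : 𝓞 K →+* 𝓞 K) (Ideal.map (D.σO : 𝓞 K →+* 𝓞 K)
      (Ideal.map (D.σO : 𝓞 K →+* 𝓞 K) I)) = I
    rw [Ideal.map_map, Ideal.map_map]
    convert Ideal.map_id (I : Ideal (𝓞 K))
    exact RingHom.ext D.σO_σO_σO
  have hx' : (x : K) ≠ 0 := by simpa using hx
  have hy' : (y : K) ≠ 0 := by simpa using hy
  have hspan : Ideal.span {x * D.σO x * D.σO (D.σO x)} =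
      Ideal.span {y * D.σO y * D.σO (D.σO y)} := by
    have h1 := congrArg (Ideal.map D.σO) h
    have h2 := congrArg (Ideal.map D.σO) h1
    simp only [Ideal.map_mul, map_σO_span] at h1 h2
    have h0 : (Ideal.span {algebraMap (𝓞 D.k0) (𝓞 K) a}) ≠ 0 := by
      rw [Ne, Ideal.zero_eq_bot, Ideal.span_singleton_eq_bot]
      exact (map_ne_zero_iff _ D.algebraMap_k0_injective).2 ha
    apply mul_right_cancel₀ h0
    simp only [← Ideal.span_singleton_mul_span_singleton]
    rw [← hnorm]
    calc _ = (Ideal.span {x} * (I : Ideal (𝓞 K)).map D.σO) *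
          (Ideal.span {D.σO x} * ((I : Ideal (𝓞 K)).map D.σO).map D.σO) *
          (Ideal.span {D.σO (D.σO x)} * (((I : Ideal (𝓞 K)).map D.σO).map D.σO).map D.σO) := by
            rw [hσ3]; ring
      _ = _ := by rw [h, h1, h2]; ring
  rw [Ideal.span_singleton_eq_span_singleton] at hspan
  obtain ⟨u, hu⟩ := hspan.symm
  have hu' : (y : K) * D.σ y * D.σ (D.σ y) * (u : 𝓞 K) = x * D.σ x * D.σ (D.σ x) :=
    congrArg (fun y : 𝓞 K => (y : K)) hu
  have hv : ((x : K) / y) * D.σ (x / y) * D.σ (D.σ (x / y)) = (u : 𝓞 K) := by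
    simp only [map_div₀]
    have h1 : D.σ (y : K) ≠ 0 := by simpa using hy'
    have h2 : D.σ (D.σ (y : K)) ≠ 0 := by simpa using hy'
    field_simp
    linear_combination -hu'
  obtain ⟨s, hs, hs1⟩ : ∃ s : (𝓞 K)ˣ, (s = 1 ∨ s = -1) ∧ ((s * x : 𝓞 K) / y : K) *
      D.σ ((s * x : 𝓞 K) / y) * D.σ (D.σ ((s * x : 𝓞 K) / y)) = 1 := by
    rcases D.norm_eq_of_unit hN hv with h | h
    · exact ⟨1, Or.inl rfl, by simpa using h⟩
    · refine ⟨-1, Or.inr rfl, ?_⟩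
      simp [neg_div]
      simp at h
      linear_combination -h
  obtain ⟨α, hα, hσα⟩ := D.exists_σ_eq_mul hs1
  obtain ⟨n, β, hn, hβ, hβα⟩ := exists_coe_eq_mul (Units.mk0 α hα)
  have hσβ : y * D.σO β = s * x * β := by
    apply RingOfIntegers.ext
    change (y : K) * D.σ (β : K) = ((s * x : 𝓞 K) : K) * β
    rw [hβα, map_mul, AlgEquiv.commutes, Units.val_mk0, hσα]
    field_simp
  have hJ : Ideal.span {β} * (I : Ideal (𝓞 K)) ≠ ⊥ :=
    mul_ne_zero (by rwa [Ne, Ideal.zero_eq_bot, Ideal.span_singleton_eq_bot]) hI0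
  refine ⟨⟨_, mem_nonZeroDivisors_of_ne_zero hJ⟩, ?_, ?_⟩
  · rw [ClassGroup.mk0_eq_mk0_iff]
    exact ⟨1, β, one_ne_zero, hβ, by simp⟩
  · change (Ideal.span {β} * (I : Ideal (𝓞 K))).map D.σO = Ideal.span {β} * (I : Ideal (𝓞 K))
    rw [Ideal.map_mul, map_σO_span]
    have hy0 : Ideal.span {y} ≠ 0 := by rwa [Ne, Ideal.zero_eq_bot, Ideal.span_singleton_eq_bot]
    apply mul_left_cancel₀ hy0
    have h5 : Ideal.span {y} * Ideal.span {D.σO β} = Ideal.span {x} * Ideal.span {β} := by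
      rw [Ideal.span_singleton_mul_span_singleton, Ideal.span_singleton_mul_span_singleton, hσβ,
        mul_assoc]
      exact Ideal.span_singleton_mul_left_unit s.isUnit _
    rw [← mul_assoc, h5]
    calc _ = Ideal.span {β} * (Ideal.span {x} * (I : Ideal (𝓞 K)).map D.σO) := by ring
      _ = _ := by rw [h]; ring

end PureCubic

namespace PureCubic

variable {K : Type*} [Field K] [NumberField K] (D : PureCubic K) {p c : ℕ}

lemma unitK0_mul {a b : 𝓞 D.k0} (ha : a ≠ 0) (hb : b ≠ 0) :
    D.unitK0 (mul_ne_zero ha hb) = D.unitK0 ha * D.unitK0 hb := Units.ext rfl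

/-- The class `C` contains an invariant ideal whose cube is generated by `π₃ ^ z` up to units and
cubes of `k₀`. -/
def HasExponent (P : D.RamData p c) (C : ClassGroup (𝓞 K)) (z : ℕ) : Prop :=
  ∃ (J : (Ideal (𝓞 K))⁰) (a : 𝓞 D.k0) (ha : a ≠ 0), ClassGroup.mk0 J = C ∧
    (J : Ideal (𝓞 K)) ^ 3 = Ideal.span {algebraMap (𝓞 D.k0) (𝓞 K) a} ∧
    D.cls (D.unitK0 ha) = D.cls (D.unitK0 P.ne₃) ^ z

variable {D}

lemma HasExponent.one (P : D.RamData p c) : D.HasExponent P 1 0 :=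
  ⟨1, 1, one_ne_zero, map_one _, by simp [Ideal.one_eq_top], by
    rw [pow_zero, cls_eq_one]
    exact ⟨1, 1, by simp, by simp, by simp [coe_unitK0]⟩⟩

lemma HasExponent.mul {P : D.RamData p c} {C C' : ClassGroup (𝓞 K)} {z z' : ℕ}
    (h : D.HasExponent P C z) (h' : D.HasExponent P C' z') :
    D.HasExponent P (C * C') (z + z') := by
  obtain ⟨J, a, ha, rfl, hJ, hz⟩ := h
  obtain ⟨J', a', ha', rfl, hJ', hz'⟩ := h'
  refine ⟨J * J', a * a', mul_ne_zero ha ha', map_mul _ _ _, ?_, ?_⟩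
  · rw [Submonoid.coe_mul, mul_pow, hJ, hJ', Ideal.span_singleton_mul_span_singleton, map_mul]
  · rw [D.unitK0_mul ha ha', map_mul, hz, hz', pow_add]

lemma HasExponent.eq_one {P : D.RamData p c} {C : ClassGroup (𝓞 K)} {z : ℕ}
    (h : D.HasExponent P C z) (hz : 3 ∣ z) : C = 1 := by
  obtain ⟨J, a, ha, rfl, hJ, h⟩ := h
  obtain ⟨t, rfl⟩ := hz
  rw [pow_mul, cls_unitK0_pow, one_pow, cls_eq_one] at h
  obtain ⟨e, m, he, hm, h⟩ := h
  rw [coe_unitK0] at h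
  have hm' : IsIntegral ℤ m := by
    have h1 : m ^ 3 = (((e⁻¹ : (𝓞 K)ˣ) * algebraMap (𝓞 D.k0) (𝓞 K) a : 𝓞 K) : K) := by
      have h2 : (((e⁻¹ : (𝓞 K)ˣ) : 𝓞 K) : K) * ((e : 𝓞 K) : K) = 1 :=
        congrArg (fun y : 𝓞 K => (y : K)) e.inv_mul
      change m ^ 3 = (((e⁻¹ : (𝓞 K)ˣ) : 𝓞 K) : K) * ((a : D.k0) : K)
      rw [h, ← mul_assoc, h2, one_mul]
    exact IsIntegral.of_pow (n := 3) (by norm_num) (h1 ▸ RingOfIntegers.isIntegral_coe _)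
  obtain ⟨μ, hμ⟩ : ∃ μ : 𝓞 K, (μ : K) = m := ⟨⟨m, hm'⟩, rfl⟩
  have hspan : (J : Ideal (𝓞 K)) = Ideal.span {μ} := by
    apply pow_left_inj_ideal (n := 3) (by norm_num)
    rw [hJ, Ideal.span_singleton_pow]
    have : algebraMap (𝓞 D.k0) (𝓞 K) a = e * μ ^ 3 := by
      apply RingOfIntegers.ext
      change ((a : D.k0) : K) = ((e : 𝓞 K) : K) * (μ : K) ^ 3
      rw [hμ, h]
    rw [this]
    exact Ideal.span_singleton_mul_left_unit e.isUnit _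
  rw [ClassGroup.mk0_eq_one_iff, hspan]
  exact ⟨μ, rfl⟩

/-- Every invariant ideal class has an exponent. -/
lemma exists_hasExponent (P : D.RamData p c) [hp : Fact p.Prime] [hc : Fact c.Prime]
    (hpc : p ≠ c) (hd : ¬ 3 ∣ padicValNat p D.d)
    (hN : ∀ x : K, x * D.σ x * D.σ (D.σ x) ≠ D.ζ)
    (h3 : (D.unitAction hN).Y.relIndex (D.unitAction hN).plus = 3)
    {C : ClassGroup (𝓞 K)} (hC : D.classMap C = C) : ∃ z, D.HasExponent P C z := by
  obtain ⟨J, rfl, hJ⟩ := D.exists_invariant_ideal hN hC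
  obtain ⟨a, ha, h⟩ := D.exists_norm_ideal (nonZeroDivisors.ne_zero J.2)
  rw [hJ, hJ, ← pow_three'] at h
  obtain ⟨i, j, k, h1⟩ := D.exists_cls_eq_of_cube P ha h
  obtain ⟨_, ⟨x, rfl⟩, z, hz⟩ := exists_mul_pow_of_card_eq_nine (D.card_range_χ hN)
    (D.cls_unitK0_pow P.ne₁) (D.cls_unitK0_pow P.ne₂) (D.cls_unitK0_pow P.ne₃)
    (by rintro _ ⟨x, rfl⟩; exact D.χ_eq P x) (D.not_mem_range_χ P hpc hd hN h3) i j k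
  obtain ⟨y, b, hb, hy, -, hy3, hby⟩ := D.exists_integral_of_ambig (x ^ 2)
  obtain ⟨y', b', hb', -, -, -, hby'⟩ := D.exists_integral_of_ambig x
  refine ⟨z, J * ⟨Ideal.span {y}, mem_nonZeroDivisors_of_ne_zero (by simpa using hy)⟩, a * b,
    mul_ne_zero ha hb, ?_, ?_, ?_⟩
  · rw [ClassGroup.mk0_eq_mk0_iff]
    exact ⟨1, y, one_ne_zero, hy, by simp [mul_comm]⟩
  · rw [Submonoid.coe_mul, mul_pow, h, map_mul, ← Ideal.span_singleton_mul_span_singleton, hy3]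
  · rw [D.unitK0_mul ha hb, map_mul, hby, h1, hz, map_pow, mul_right_comm, ← pow_succ', ← hby',
      cls_unitK0_pow, one_mul]

lemma absNorm_span (D : PureCubic K) (x : 𝓞 K) {q : ℚ}
    (h : (x * D.τ x : K) * D.σ (x * D.τ x) * D.σ (D.σ (x * D.τ x)) = algebraMap ℚ K q) :
    ((Ideal.absNorm (Ideal.span {x}) : ℕ) : ℚ) = |q| := by
  have h1 : Algebra.norm ℚ (x : K) = Algebra.norm ℚ (Algebra.norm D.L (x : K)) :=
    (Algebra.norm_norm (S := D.L) ..).symm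
  have h2 : (Algebra.norm ℚ (x : K)) ^ 2 = q ^ 2 := by
    have h3 : Algebra.norm ℚ ((Algebra.norm D.L (x : K) : D.L) : K) =
        (Algebra.norm ℚ (x : K)) ^ 2 := by
      rw [← Algebra.norm_norm (S := D.L), show ((Algebra.norm D.L (x : K) : D.L) : K) =
        algebraMap D.L K (Algebra.norm D.L (x : K)) from rfl, Algebra.norm_algebraMap,
        D.finrank_L, map_pow, ← h1]
    rw [← h3, ← Algebra.norm_norm (S := D.k0), norm_L]
    have h4 : Algebra.norm D.k0 ((x : K) * D.τ x) = algebraMap ℚ D.k0 q := by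
      apply Subtype.ext
      rw [norm_k0, h]
      rfl
    rw [h4, Algebra.norm_algebraMap, D.finrank_ℚ_k0]
  rw [Ideal.absNorm_span_singleton, ← abs_eq_abs.2 (sq_eq_sq_iff_eq_or_eq_neg.1 h2),
    Nat.cast_natAbs, ← Algebra.coe_norm_int]
  simp

lemma absNorm_ne_zero (J : (Ideal (𝓞 K))⁰) :
    ((Ideal.absNorm (J : Ideal (𝓞 K)) : ℕ) : ℚ) ≠ 0 := by
  rw [Nat.cast_ne_zero]
  exact Ideal.absNorm_ne_zero_of_nonZeroDivisors J

lemma exists_rat_norm (D : PureCubic K) (x : K) : ∃ q : ℚ,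
    (x * D.τ x : K) * D.σ (x * D.τ x) * D.σ (D.σ (x * D.τ x)) = algebraMap ℚ K q := by
  apply D.exists_rat
  · simp only [map_mul, D.σ_σ_σ]
    ring
  · simp only [map_mul, D.τ_σ, D.τ_τ, D.σ_σ_σ]
    ring

/-- The norm of an ideal in a class with exponent `z` is a norm from `K` up to `c ^ (i₃ z)` and
cubes. -/
lemma HasExponent.absNorm_eq {P : D.RamData p c} {I : (Ideal (𝓞 K))⁰} {z : ℕ} (hc : c ≠ 0)
    (h : D.HasExponent P (ClassGroup.mk0 I) z) :
    ∃ (w : K) (n : ℚ), n ≠ 0 ∧ w * D.σ w * D.σ (D.σ w) * algebraMap ℚ K (c ^ (P.i₃ * z) * n ^ 3) =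
      algebraMap ℚ K (Ideal.absNorm (I : Ideal (𝓞 K)) : ℕ) := by
  obtain ⟨J, a, ha, hJI, hJ, hz⟩ := h
  obtain ⟨n, hn, hna⟩ := D.exists_norm_of_cls' P hz
  rw [ClassGroup.mk0_eq_mk0_iff] at hJI
  obtain ⟨x, y, hx, hy, hxy⟩ := hJI
  have hc' : (c : ℚ) ≠ 0 := by exact_mod_cast hc
  have hJn : ((Ideal.absNorm (J : Ideal (𝓞 K)) : ℕ) : ℚ) = |(c : ℚ) ^ (P.i₃ * z) * n ^ 3| := by
    have h1 : ((Ideal.absNorm (J : Ideal (𝓞 K)) : ℕ) : ℚ) ^ 3 =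
        |((c : ℚ) ^ (P.i₃ * z) * n ^ 3) ^ 3| := by
      rw [← Nat.cast_pow, ← map_pow, hJ]
      apply D.absNorm_span
      change (D.unitK0 ha * D.τ (D.unitK0 ha) : K) * D.σ (D.unitK0 ha * D.τ (D.unitK0 ha)) *
        D.σ (D.σ (D.unitK0 ha * D.τ (D.unitK0 ha))) = _
      rw [hna, AlgEquiv.commutes, AlgEquiv.commutes, ← map_mul, ← map_mul]
      congr 1
      ring
    rw [abs_pow] at h1
    exact (pow_left_inj₀ (by positivity) (by positivity) (by norm_num)).1 h1
  obtain ⟨q, hq⟩ := D.exists_rat_norm (x : K)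
  obtain ⟨r, hr⟩ := D.exists_rat_norm (y : K)
  have hq' := D.absNorm_span x hq
  have hr' := D.absNorm_span y hr
  have hx' : (x : K) ≠ 0 := by simpa using hx
  have hy' : (y : K) ≠ 0 := by simpa using hy
  have hr0 : r ≠ 0 := by
    rintro rfl
    simp [hy'] at hr
  have hq0 : q ≠ 0 := by
    rintro rfl
    simp [hx'] at hq
  have hprod : |q| * |(c : ℚ) ^ (P.i₃ * z) * n ^ 3| =
      |r| * (Ideal.absNorm (I : Ideal (𝓞 K)) : ℕ) := by
    rw [← hJn, ← hq', ← hr', ← Nat.cast_mul, ← Nat.cast_mul, ← map_mul, ← map_mul, hxy]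
  have hI : ((Ideal.absNorm (I : Ideal (𝓞 K)) : ℕ) : ℚ) =
      |q / r * ((c : ℚ) ^ (P.i₃ * z) * n ^ 3)| := by
    rw [abs_mul, abs_div]
    have : |r| ≠ 0 := by simpa using hr0
    field_simp
    linear_combination -hprod
  have hw : (x * D.τ x / (y * D.τ y) : K) * D.σ (x * D.τ x / (y * D.τ y)) *
      D.σ (D.σ (x * D.τ x / (y * D.τ y))) = algebraMap ℚ K (q / r) := by
    rw [map_div₀ (algebraMap ℚ K), ← hq, ← hr]
    rw [map_div₀, map_div₀, div_mul_div_comm, div_mul_div_comm]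
  rcases abs_choice (q / r * ((c : ℚ) ^ (P.i₃ * z) * n ^ 3)) with h | h
  · exact ⟨_, n, hn, by rw [hw, ← map_mul, hI, h]⟩
  · exact ⟨_, -n, neg_ne_zero.2 hn, by rw [hw, ← map_mul, hI, h]; congr 1; ring⟩

end PureCubic

lemma exists_cube_of_exists_cube_pow {F : Type*} [Field F] {x : F} {m : ℕ} (hm : ¬ 3 ∣ m)
    (h : ∃ t : F, t ^ 3 = x ^ m) : ∃ t : F, t ^ 3 = x := by
  obtain ⟨t, ht⟩ := h
  by_cases hx : x = 0
  · exact ⟨0, by simp [hx]⟩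
  obtain ⟨j, hj⟩ : ∃ j, m = 3 * j + 1 ∨ m = 3 * j + 2 := ⟨m / 3, by omega⟩
  rcases hj with rfl | rfl
  · exact ⟨t / x ^ j, by rw [div_pow, ht]; field_simp; ring⟩
  · refine ⟨t ^ 2 / x ^ (2 * j + 1), ?_⟩
    rw [div_pow, ← pow_mul, mul_comm 2 3, pow_mul, ht]
    field_simp
    ring

/-- If `1 + s + s ^ 2` kills an abelian group and `1 - s` has no nontrivial invariant value, then
`s` is trivial on elements of `3`-power order. -/
lemma eq_of_pow_three_pow_eq_one {G : Type*} [CommGroup G] (s : G →* G)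
    (hs : ∀ w, w * s w * s (s w) = 1) (h : ∀ w, s (w / s w) = w / s w → w / s w = 1)
    (k : ℕ) : ∀ w : G, w ^ 3 ^ k = 1 → s w = w := by
  have h' : ∀ w, w / s w / s (w / s w) = 1 → w / s w = 1 :=
    fun w hw => h w (div_eq_one.1 hw).symm
  induction k with
  | zero => intro w hw; simp at hw; simp [hw]
  | succ k ih =>
    intro w hw
    have h1 : w / s w / s (w / s w) = (s w)⁻¹ ^ 3 := by
      have := hs w
      have h2 : s (s w) = (w * s w)⁻¹ := eq_inv_of_mul_eq_one_right this
      rw [map_div, h2]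
      apply Additive.ofMul.injective
      simp only [ofMul_mul, ofMul_div, ofMul_inv, ofMul_pow]
      abel
    have h3 : ((s w)⁻¹ ^ 3) ^ 3 ^ k = 1 := by
      rw [← pow_mul, ← pow_succ', inv_pow, ← map_pow, hw, map_one, inv_one]
    have h4 := ih _ h3
    rw [← h1] at h4
    have h5 : w / s w / s (w / s w) = 1 := h _ h4
    exact (div_eq_one.1 (h' w h5)).symm

/-- If `1 + s + s ^ 2` kills an abelian group then `s` is trivial on subgroups of order `3`. -/
lemma eq_of_card_eq_three {G : Type*} [CommGroup G] (s : G →* G)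
    (hs : ∀ w, w * s w * s (s w) = 1) {H : Subgroup G} (hH : Nat.card H = 3)
    (hsH : ∀ w ∈ H, s w ∈ H) {w : G} (hw : w ∈ H) : s w = w := by
  by_contra hne
  have h3 : w ^ 3 = 1 := by
    have := pow_card_eq_one' (x := (⟨w, hw⟩ : H))
    rw [hH] at this
    exact congrArg Subtype.val this
  have h1 : w ≠ 1 := by rintro rfl; simp at hne
  have hord : orderOf w = 3 := orderOf_eq_prime h3 h1
  have hz : Subgroup.zpowers w = H := by
    have : Finite H := Nat.finite_of_card_ne_zero (by rw [hH]; norm_num)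
    apply Subgroup.eq_of_le_of_card_ge (Subgroup.zpowers_le.2 hw)
    rw [hH, Nat.card_zpowers, hord]
  have hsw := hsH w hw
  rw [← hz, ← (isOfFinOrder_iff_pow_eq_one.2 ⟨3, by norm_num, h3⟩).mem_powers_iff_mem_zpowers,
    Submonoid.mem_powers_iff] at hsw
  obtain ⟨n, hn⟩ := hsw
  have hs' := hs w
  rw [← hn, map_pow, ← hn, ← pow_mul, ← pow_succ', ← pow_add, ← orderOf_dvd_iff_pow_eq_one,
    hord] at hs'
  apply hne
  rw [← hn, ← Nat.div_add_mod n 3, pow_add, pow_mul, h3, one_pow, one_mul]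
  have : n % 3 = 1 := by
    have : n % 3 = 0 ∨ n % 3 = 1 ∨ n % 3 = 2 := by omega
    have h6 := Nat.mod_eq_zero_of_dvd hs'
    rw [Nat.add_mod, Nat.add_mod n, Nat.mul_mod] at h6
    rcases this with h | h | h <;> simp [h] at h6 ⊢
  rw [this, pow_one]

namespace PureCubic

variable {K : Type*} [Field K] [NumberField K] {D : PureCubic K} {p c : ℕ}

lemma absNorm_map_σO (D : PureCubic K) (I : Ideal (𝓞 K)) :
    Ideal.absNorm (I.map D.σO) = Ideal.absNorm I := by
  rw [Ideal.absNorm_apply, Ideal.absNorm_apply, Submodule.cardQuot_apply, Submodule.cardQuot_apply]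
  exact (Nat.card_congr (Ideal.quotientEquiv I (I.map D.σO) D.σO rfl).toEquiv).symm

lemma HasExponent.exists_cube [hp : Fact p.Prime] [hc : Fact c.Prime] (hpc : p ≠ c)
    (h9 : p % 9 = 4 ∨ p % 9 = 7) (hd : ¬ 3 ∣ padicValNat p D.d)
    {P : D.RamData p c} {I : (Ideal (𝓞 K))⁰} {z m : ℕ} (h : D.HasExponent P (ClassGroup.mk0 I) z)
    {s : ℚ} (hs : s ≠ 0) (hI : ((Ideal.absNorm (I : Ideal (𝓞 K)) : ℕ) : ℚ) = m * s ^ 3)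
    (hm : ¬ p ∣ m) : ∃ t : ZMod p, t ^ 3 = m * c ^ (2 * (P.i₃ * z)) := by
  obtain ⟨w, n, hn, hw⟩ := h.absNorm_eq hc.out.ne_zero
  have hc0 : (c : ℚ) ≠ 0 := by exact_mod_cast hc.out.ne_zero
  have hcop : ¬ (p : ℤ) ∣ ((m * c ^ (2 * (P.i₃ * z)) : ℕ) : ℤ) := by
    rw [Int.natCast_dvd_natCast, hp.out.dvd_mul]
    rintro (h | h)
    · exact hm h
    · exact hpc ((Nat.prime_dvd_prime_iff_eq hp.out hc.out).1 (hp.out.dvd_of_dvd_pow h))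
  obtain ⟨t, ht⟩ := D.exists_cube_of_norm h9 hd (x := w)
    (n := s / (c ^ (P.i₃ * z) * n)) hcop (by positivity) (by
      have h0 : algebraMap ℚ K (c ^ (P.i₃ * z) * n ^ 3) ≠ 0 := by
        rw [Ne, map_eq_zero]; positivity
      apply mul_right_cancel₀ h0
      rw [hw, ← map_mul, hI]
      congr 1
      push_cast
      field_simp
      ring)
  exact ⟨t, by rw [ht]; push_cast; rfl⟩

/-- An ideal whose norm is not a cube modulo `p`, in a strong sense. -/
structure BadIdeal (D : PureCubic K) (p : ℕ) where
  /-- The underlying ideal. -/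
  R : (Ideal (𝓞 K))⁰
  /-- The residue characteristic. -/
  r : ℕ
  /-- The residue degree. -/
  f : ℕ
  absNorm_eq : Ideal.absNorm (R : Ideal (𝓞 K)) = r ^ f
  not_dvd : ¬ 3 ∣ f
  not_cube : ¬ ∃ t : ZMod p, t ^ 3 = r

open CommGroup in
lemma BadIdeal.exists_class (B : D.BadIdeal p) [hp : Fact p.Prime] [hc : Fact c.Prime] (hpc : p ≠ c)
    (h9 : p % 9 = 4 ∨ p % 9 = 7) (hd : ¬ 3 ∣ padicValNat p D.d) (P : D.RamData p c) :
    ∃ C ∈ primaryComponent (ClassGroup (𝓞 K)) 3, ∀ z, D.HasExponent P C z →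
      ¬ ∃ t : ZMod p, t ^ 3 = c ^ (P.i₃ * z) := by
  obtain ⟨n, h', hh, hcard⟩ := Nat.exists_eq_pow_mul_and_not_dvd
    (Nat.card_pos (α := ClassGroup (𝓞 K))).ne' 3 (by norm_num)
  refine ⟨ClassGroup.mk0 B.R ^ h', ?_, ?_⟩
  · have h1 : (ClassGroup.mk0 B.R ^ h') ^ 3 ^ n = 1 := by
      rw [← pow_mul, mul_comm, ← hcard, pow_card_eq_one']
    exact ⟨n, h1⟩
  · rintro z hz ⟨t, ht⟩
    rw [← map_pow] at hz
    have hr : ¬ p ∣ B.r := by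
      intro h
      exact B.not_cube ⟨0, by rw [(ZMod.natCast_eq_zero_iff _ _).2 h]; simp⟩
    obtain ⟨s, hs⟩ := hz.exists_cube hpc h9 hd (m := B.r ^ (B.f * h')) (s := 1) one_ne_zero
      (by rw [SubmonoidClass.coe_pow, map_pow, B.absNorm_eq, ← pow_mul]; simp)
      (fun h => hr (hp.out.dvd_of_dvd_pow h))
    apply B.not_cube
    have hc0 : (c : ZMod p) ≠ 0 := by
      rw [Ne, ZMod.natCast_eq_zero_iff, Nat.prime_dvd_prime_iff_eq hp.out hc.out]
      exact hpc
    have ht0 : t ≠ 0 := by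
      rintro rfl
      exact pow_ne_zero _ hc0 (ht.symm.trans (zero_pow (by norm_num)))
    apply exists_cube_of_exists_cube_pow (m := B.f * h')
    · rw [Nat.prime_three.dvd_mul]
      exact not_or.2 ⟨B.not_dvd, hh⟩
    · refine ⟨s / t ^ 2, ?_⟩
      rw [div_pow, hs, ← pow_mul t, mul_comm 2 3, pow_mul t, ht]
      field_simp
      push_cast
      ring

variable [hp : Fact p.Prime] [hc : Fact c.Prime]

/-- If the `3`-class group has order `3` and `Q = 1`, then `c` is not a cube modulo `p`. -/
lemma not_cube_of_card_eq_three (B : D.BadIdeal p) (hpc : p ≠ c)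
    (h9 : p % 9 = 4 ∨ p % 9 = 7) (hd : ¬ 3 ∣ padicValNat p D.d) (P : D.RamData p c)
    (hN : ∀ x : K, x * D.σ x * D.σ (D.σ x) ≠ D.ζ)
    (h3 : (D.unitAction hN).Y.relIndex (D.unitAction hN).plus = 3)
    (hcard : Nat.card (CommGroup.primaryComponent (ClassGroup (𝓞 K)) 3) = 3) :
    ¬ ∃ t : ZMod p, t ^ 3 = c := by
  rintro ⟨t, ht⟩
  obtain ⟨C, hC, h⟩ := B.exists_class hpc h9 hd P
  have hCC : D.classMap C = C := by
    refine eq_of_card_eq_three D.classMap D.classMap_norm hcard ?_ hC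
    rintro w ⟨k, hk⟩
    exact ⟨k, by rw [← map_pow, hk, map_one]⟩
  obtain ⟨z, hz⟩ := exists_hasExponent P hpc hd hN h3 hCC
  exact h z hz ⟨t ^ (P.i₃ * z), by rw [← pow_mul, mul_comm, pow_mul, ht]⟩

/-- If `c` is not a cube modulo `p` then `Q = 1`. -/
lemma relIndex_plus_eq_three_of_not_cube (hpc : p ≠ c)
    (h9 : p % 9 = 4 ∨ p % 9 = 7) (hd : ¬ 3 ∣ padicValNat p D.d) (P : D.RamData p c)
    (hN : ∀ x : K, x * D.σ x * D.σ (D.σ x) ≠ D.ζ)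
    (hcube : ¬ ∃ t : ZMod p, t ^ 3 = c) :
    (D.unitAction hN).Y.relIndex (D.unitAction hN).plus = 3 := by
  rcases D.unit_index_cases hN with h | h
  · exact h.2.1
  · exfalso
    obtain ⟨y, n, hn, hy⟩ := D.exists_norm_of_relIndex_eq_nine P hN hp.out.ne_zero hc.out.ne_zero
      h.2.1
    obtain ⟨t, ht⟩ := D.exists_cube_of_norm h9 hd (x := y) (m := (c : ℤ) ^ 2) (n := n) (by
      intro h
      have := Int.natCast_dvd_natCast.1 (Int.Prime.dvd_pow' hp.out h)
      exact hpc ((Nat.prime_dvd_prime_iff_eq hp.out hc.out).1 this)) hn (by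
      rw [hy]; push_cast; rfl)
    exact hcube (exists_cube_of_exists_cube_pow (m := 2) (by norm_num) ⟨t, by rw [ht]; push_cast; rfl⟩)

/-- If `c` is not a cube modulo `p`, then the `3`-class group has order `3`. -/
lemma card_eq_three_of_not_cube (B : D.BadIdeal p) (hpc : p ≠ c)
    (h9 : p % 9 = 4 ∨ p % 9 = 7) (hd : ¬ 3 ∣ padicValNat p D.d) (P : D.RamData p c)
    (hN : ∀ x : K, x * D.σ x * D.σ (D.σ x) ≠ D.ζ)
    (hcube : ¬ ∃ t : ZMod p, t ^ 3 = c) :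
    Nat.card (CommGroup.primaryComponent (ClassGroup (𝓞 K)) 3) = 3 := by
  have h3 := relIndex_plus_eq_three_of_not_cube hpc h9 hd P hN hcube
  have hinv : ∀ C ∈ CommGroup.primaryComponent (ClassGroup (𝓞 K)) 3, D.classMap C = C := by
    rintro C ⟨k, hk⟩
    refine eq_of_pow_three_pow_eq_one D.classMap D.classMap_norm ?_ k C hk
    intro w hw
    obtain ⟨z, hz⟩ := exists_hasExponent P hpc hd hN h3 hw
    obtain ⟨W, rfl⟩ := ClassGroup.mk0_surjective w
    have hclass : ClassGroup.mk0 W / D.classMap (ClassGroup.mk0 W) =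
        ClassGroup.mk0 (W * W * D.idealMap (D.idealMap W)) := by
      rw [div_eq_iff_eq_mul, map_mul, map_mul, ← classMap_mk0, ← classMap_mk0, mul_assoc,
        mul_assoc, mul_comm (D.classMap (D.classMap _)), ← mul_assoc (ClassGroup.mk0 W) (D.classMap _),
        D.classMap_norm, mul_one]
    apply hz.eq_one
    rw [hclass] at hz
    obtain ⟨t, ht⟩ := hz.exists_cube hpc h9 hd (m := 1)
      (s := (Ideal.absNorm (W : Ideal (𝓞 K)) : ℕ)) (absNorm_ne_zero W) (by
        rw [Submonoid.coe_mul, Submonoid.coe_mul, map_mul, map_mul, coe_idealMap, coe_idealMap,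
          absNorm_map_σO, absNorm_map_σO]
        push_cast
        ring) (by simpa using hp.out.ne_one)
    by_contra hz3
    exact hcube (exists_cube_of_exists_cube_pow (m := 2 * (P.i₃ * z)) (by
      rw [Nat.prime_three.dvd_mul, Nat.prime_three.dvd_mul]
      exact not_or.2 ⟨by norm_num, not_or.2 ⟨P.i₃_dvd, hz3⟩⟩) ⟨t, by simpa using ht⟩)
  have hexp : ∀ C : CommGroup.primaryComponent (ClassGroup (𝓞 K)) 3,
      ∃ z, D.HasExponent P (C : ClassGroup (𝓞 K)) z :=
    fun C => exists_hasExponent P hpc hd hN h3 (hinv C C.2)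
  choose z hz using hexp
  have hle : Nat.card (CommGroup.primaryComponent (ClassGroup (𝓞 K)) 3) ≤ 3 := by
    have hinj : Function.Injective (fun C => (⟨z C % 3, Nat.mod_lt _ (by norm_num)⟩ : Fin 3)) := by
      intro C C' h
      have h : z C % 3 = z C' % 3 := congrArg Fin.val h
      have h1 := ((hz C).mul ((hz C').mul (hz C'))).eq_one (by omega)
      have h2 := ((hz C').mul ((hz C').mul (hz C'))).eq_one (by omega)
      exact Subtype.ext (mul_right_cancel (h1.trans h2.symm))
    simpa using Nat.card_le_card_of_injective _ hinj
  obtain ⟨C, hC, h⟩ := B.exists_class hpc h9 hd P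
  have hC1 : C ≠ 1 := by
    rintro rfl
    exact h 0 (HasExponent.one P) ⟨1, by simp⟩
  have hC3 : C ^ 3 = 1 := by
    have h2 := ((hz ⟨C, hC⟩).mul ((hz ⟨C, hC⟩).mul (hz ⟨C, hC⟩))).eq_one (by omega)
    rw [pow_three]
    exact h2
  have hdvd : 3 ∣ Nat.card (CommGroup.primaryComponent (ClassGroup (𝓞 K)) 3) := by
    have hord : orderOf (⟨C, hC⟩ : CommGroup.primaryComponent (ClassGroup (𝓞 K)) 3) = 3 := by
      rw [Subgroup.orderOf_mk]
      exact orderOf_eq_prime hC3 hC1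
    have := orderOf_dvd_natCard (⟨C, hC⟩ : CommGroup.primaryComponent (ClassGroup (𝓞 K)) 3)
    rwa [hord] at this
  exact le_antisymm hle (Nat.le_of_dvd Nat.card_pos hdvd)

end PureCubic

lemma ZMod.exists_not_cube {p : ℕ} [hp : Fact p.Prime] (h3 : p % 3 = 1) :
    ∃ g : ZMod p, ¬ ∃ t : ZMod p, t ^ 3 = g := by
  by_contra! h
  have hsurj : Function.Surjective (fun t : ZMod p => t ^ 3) := h
  have hinj := Finite.injective_iff_surjective.2 hsurj
  have hdvd : 3 ∣ Nat.card (ZMod p)ˣ := by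
    rw [Nat.card_eq_fintype_card, ZMod.card_units p]
    have := hp.out.two_le
    omega
  obtain ⟨w, hw⟩ := exists_prime_orderOf_dvd_card' 3 hdvd
  have h1 : w ^ 3 = 1 := by rw [← hw]; exact pow_orderOf_eq_one w
  have h2 : (w : ZMod p) = 1 := hinj (by simpa using congrArg Units.val h1)
  have h3 : w = 1 := Units.ext h2
  rw [h3, orderOf_one] at hw
  norm_num at hw

/-- There are arbitrarily large primes congruent to `2` modulo `3` that are not cubes modulo
`p`. -/
lemma Nat.exists_prime_gt_not_cube {p : ℕ} [hp : Fact p.Prime] (h3 : p % 3 = 1) (N : ℕ) :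
    ∃ r > N, r.Prime ∧ r % 3 = 2 ∧ ¬ ∃ t : ZMod p, t ^ 3 = r := by
  obtain ⟨g, hg⟩ := ZMod.exists_not_cube h3
  have hcop : Nat.Coprime 3 p := by
    rw [Nat.coprime_primes Nat.prime_three hp.out]
    rintro rfl
    omega
  obtain ⟨n, hn3, hnp⟩ := Nat.chineseRemainder hcop 2 g.val
  have hg0 : g ≠ 0 := by rintro rfl; exact hg ⟨0, by simp⟩
  have hng : ((n : ℕ) : ZMod p) = g := by
    rw [(ZMod.natCast_eq_natCast_iff _ _ _).2 hnp, ZMod.natCast_zmod_val]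
  have hnc : n.Coprime (3 * p) := by
    apply Nat.Coprime.mul_right
    · rw [Nat.coprime_comm, Nat.Prime.coprime_iff_not_dvd Nat.prime_three]
      have : n % 3 = 2 % 3 := hn3
      omega
    · rw [Nat.coprime_comm, Nat.Prime.coprime_iff_not_dvd hp.out, ← ZMod.natCast_eq_zero_iff, hng]
      exact hg0
  have : NeZero (3 * p) := ⟨mul_ne_zero (by norm_num) hp.out.ne_zero⟩
  obtain ⟨r, hr, hrp, hrn⟩ := Nat.forall_exists_prime_gt_and_eq_mod
    ((ZMod.isUnit_iff_coprime n (3 * p)).2 hnc) N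
  rw [ZMod.natCast_eq_natCast_iff] at hrn
  refine ⟨r, hr, hrp, ?_, ?_⟩
  · have h1 : r % 3 = n % 3 := hrn.of_mul_right p
    have h2 : n % 3 = 2 % 3 := hn3
    omega
  · rw [(ZMod.natCast_eq_natCast_iff _ _ _).2 (hrn.of_mul_left 3), hng]
    exact hg

lemma Nat.exists_dvd_pow_three_sub {r : ℕ} (hr : r.Prime) (h3 : r % 3 = 2) (d : ℕ) :
    ∃ m : ℤ, (r : ℤ) ∣ m ^ 3 - d := by
  have : Fact r.Prime := ⟨hr⟩
  refine ⟨(d : ℤ) ^ ((2 * r - 1) / 3), ?_⟩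
  rw [← ZMod.intCast_zmod_eq_zero_iff_dvd]
  push_cast
  rw [← pow_mul, Nat.div_mul_cancel (by omega), sub_eq_zero]
  by_cases hd : (d : ZMod r) = 0
  · rw [hd, zero_pow]
    omega
  · have : 2 * r - 1 = (r - 1) * 2 + 1 := by have := hr.two_le; omega
    rw [this, pow_succ, pow_mul, ZMod.pow_card_sub_one_eq_one hd, one_pow, one_mul]

namespace PureCubic

variable {K : Type*} [Field K] [NumberField K] {D : PureCubic K} {p : ℕ}

lemma map_σO_ne_self (D : PureCubic K) {r : ℕ} (hr : r.Prime) (hrd : 3 * D.d < r) {m : ℤ}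
    (hm : (r : ℤ) ∣ m ^ 3 - D.d) {R : Ideal (𝓞 K)} (hR : R.IsMaximal)
    (hrR : ((r : ℕ) : 𝓞 K) ∈ R) : R.map D.σO ≠ R := by
  intro h
  have hσ : ∀ x ∈ R, D.σO x ∈ R := fun x hx => h ▸ Ideal.mem_map_of_mem D.σO hx
  have h_int : IsIntegral ℤ D.θ := IsIntegral.of_pow (n := 3) (by norm_num)
    (by rw [D.θ_pow, ← map_natCast (algebraMap ℤ K)]; exact isIntegral_algebraMap)
  obtain ⟨θ, hθ⟩ : ∃ θ : 𝓞 K, (θ : K) = D.θ := ⟨⟨D.θ, h_int⟩, rfl⟩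
  have hθ3 : θ ^ 3 = (D.d : 𝓞 K) := RingOfIntegers.ext (by
    change (θ : K) ^ 3 = ((D.d : 𝓞 K) : K)
    rw [hθ, D.θ_pow]
    exact (map_natCast (algebraMap (𝓞 K) K) D.d).symm)
  obtain ⟨z, hz⟩ : ∃ z : 𝓞 K, (z : K) = D.ζ := ⟨(D.zU : 𝓞 K), D.coe_zU⟩
  have hz1 : z ^ 2 + z + 1 = 0 := RingOfIntegers.ext (by
    change (z : K) ^ 2 + z + 1 = 0
    rw [hz, D.ζ_eq])
  have hσz : D.σO z = z := RingOfIntegers.ext (by rw [coe_σO, hz, D.σ_ζ])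
  have hσθ : D.σO θ = z * θ := RingOfIntegers.ext (by
    change D.σ (θ : K) = (z : K) * θ
    rw [hz, hθ, D.σ_θ])
  have hprime := hR.isPrime
  have hmR : (m : 𝓞 K) ^ 3 - (D.d : 𝓞 K) ∈ R := by
    obtain ⟨t, ht⟩ := hm
    have : (m : 𝓞 K) ^ 3 - (D.d : 𝓞 K) = (t : 𝓞 K) * ((r : ℕ) : 𝓞 K) := by
      have := congrArg (fun x : ℤ => (x : 𝓞 K)) ht
      push_cast at this
      rw [this, mul_comm]
    rw [this]
    exact R.mul_mem_left _ hrR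
  have hcases : ∃ j : ℕ, z ^ j * θ - m ∈ R := by
    have h1 : (z ^ 0 * θ - m) * ((z ^ 1 * θ - m) * (z ^ 2 * θ - m)) ∈ R := by
      have : (z ^ 0 * θ - m) * ((z ^ 1 * θ - m) * (z ^ 2 * θ - m)) =
          -((m : 𝓞 K) ^ 3 - (D.d : 𝓞 K)) := by
        have hz3 : z ^ 3 = 1 := by linear_combination (z - 1) * hz1
        rw [← hθ3]
        linear_combination (θ ^ 3 - m * θ ^ 2) * hz3 + (-m * θ ^ 2 + m ^ 2 * θ) * hz1
      rw [this]
      exact R.neg_mem hmR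
    rcases hprime.mem_or_mem h1 with h2 | h2
    · exact ⟨0, h2⟩
    · rcases hprime.mem_or_mem h2 with h3 | h3
      · exact ⟨1, h3⟩
      · exact ⟨2, h3⟩
  obtain ⟨j, hj⟩ := hcases
  have hj' := hσ _ hj
  simp only [map_sub, map_mul, map_pow, hσz, hσθ, map_intCast] at hj'
  have h3 := R.sub_mem hj' hj
  have h3d : ((3 * D.d : ℕ) : 𝓞 K) ∈ R := by
    have h4 : z ^ j * ((z - 1) * θ) ∈ R := by
      convert h3 using 1
      ring
    rcases hprime.mem_or_mem h4 with h5 | h5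
    · have h6 := hprime.mem_of_pow_mem _ h5
      have : (1 : 𝓞 K) ∈ R := by
        have : (1 : 𝓞 K) = (-1 - z) * z := by linear_combination hz1
        rw [this]
        exact R.mul_mem_left _ h6
      exact absurd ((Ideal.eq_top_iff_one R).2 this) hR.ne_top
    · rcases hprime.mem_or_mem h5 with h6 | h6
      · have : ((3 * D.d : ℕ) : 𝓞 K) = (D.d * (-(2 + z))) * (z - 1) := by
          push_cast
          linear_combination D.d * hz1
        rw [this]
        exact R.mul_mem_left _ h6
      · have : ((3 * D.d : ℕ) : 𝓞 K) = 3 * θ ^ 2 * θ := by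
          push_cast
          rw [← hθ3]
          ring
        rw [this]
        exact R.mul_mem_left _ h6
  have hcop : IsCoprime (r : ℤ) ((3 * D.d : ℕ) : ℤ) := by
    rw [Nat.isCoprime_iff_coprime, Nat.Prime.coprime_iff_not_dvd hr]
    intro h
    exact absurd (Nat.le_of_dvd (by have := D.d_ne_zero; omega) h) (by omega)
  obtain ⟨a, b, hab⟩ := hcop
  have h1 : (1 : 𝓞 K) = a * ((r : ℕ) : 𝓞 K) + b * ((3 * D.d : ℕ) : 𝓞 K) := by
    have := congrArg (fun x : ℤ => (x : 𝓞 K)) hab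
    push_cast at this ⊢
    exact this.symm
  apply hR.ne_top
  rw [Ideal.eq_top_iff_one, h1]
  exact R.add_mem (R.mul_mem_left _ hrR) (R.mul_mem_left _ h3d)

lemma map_map_map_σO (D : PureCubic K) (I : Ideal (𝓞 K)) :
    ((I.map D.σO).map D.σO).map D.σO = I := by
  change Ideal.map (D.σO : 𝓞 K →+* 𝓞 K) (Ideal.map (D.σO : 𝓞 K →+* 𝓞 K)
      (Ideal.map (D.σO : 𝓞 K →+* 𝓞 K) I)) = I
  rw [Ideal.map_map, Ideal.map_map]
  convert Ideal.map_id I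
  exact RingHom.ext D.σO_σO_σO

lemma map_map_σO_ne_self {I : Ideal (𝓞 K)} (h : I.map D.σO ≠ I) : (I.map D.σO).map D.σO ≠ I := by
  intro h'
  exact h ((congrArg (Ideal.map D.σO) h').symm.trans (D.map_map_map_σO I))

lemma nonempty_badIdeal (D : PureCubic K) [hp : Fact p.Prime] (h3 : p % 3 = 1) :
    Nonempty (D.BadIdeal p) := by
  obtain ⟨r, hrd, hr, hr3, hcube⟩ := Nat.exists_prime_gt_not_cube h3 (3 * D.d)
  obtain ⟨m, hm⟩ := Nat.exists_dvd_pow_three_sub hr hr3 D.d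
  have hnu : Ideal.span {((r : ℕ) : 𝓞 K)} ≠ ⊤ := by
    intro h
    have h1 := congrArg Ideal.absNorm h
    rw [Ideal.absNorm_span_natCast, Ideal.absNorm_top] at h1
    exact hr.ne_one ((Nat.pow_eq_one.1 h1).resolve_right (Module.finrank_pos).ne')
  obtain ⟨R, hR, hle⟩ := Ideal.exists_le_maximal _ hnu
  have hrR : ((r : ℕ) : 𝓞 K) ∈ R := hle (Ideal.mem_span_singleton_self _)
  have hR0 : R ≠ ⊥ := by
    rintro rfl
    exact hr.ne_zero (by simpa using hrR)
  have hne := D.map_σO_ne_self hr (by omega) hm hR hrR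
  have hne' := D.map_map_σO_ne_self hne
  have hd1 := Ideal.dvd_iff_le.2 hle
  have hr6 : Ideal.absNorm (Ideal.span {((r : ℕ) : 𝓞 K)}) = r ^ 6 := by
    rw [Ideal.absNorm_span_natCast, RingOfIntegers.rank, D.finrank_ℚ]
  obtain ⟨f, -, hf⟩ : ∃ f ≤ 6, Ideal.absNorm R = r ^ f := by
    rw [← Nat.dvd_prime_pow hr, ← hr6]
    exact map_dvd Ideal.absNorm hd1
  refine ⟨⟨R, mem_nonZeroDivisors_of_ne_zero hR0⟩, r, f, hf, ?_, hcube⟩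
  have hmap : ∀ I : Ideal (𝓞 K), I.IsMaximal → (I.map D.σO).IsMaximal := fun I hI =>
    Ideal.map_isMaximal_of_equiv D.σO
  have hr1 := hmap R hR
  have hr2 := hmap _ hr1
  have hc1 : IsCoprime R (R.map D.σO) := Ideal.isCoprime_of_isMaximal hne.symm
  have hc2 : IsCoprime R ((R.map D.σO).map D.σO) := Ideal.isCoprime_of_isMaximal hne'.symm
  have hc3 : IsCoprime (R.map D.σO) ((R.map D.σO).map D.σO) := by
    apply Ideal.isCoprime_of_isMaximal
    intro h
    have := congrArg (Ideal.map D.σO) h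
    exact hne' (this.trans (D.map_map_map_σO R))
  have hdvd : ∀ I : Ideal (𝓞 K), I ∣ Ideal.span {((r : ℕ) : 𝓞 K)} →
      I.map D.σO ∣ Ideal.span {((r : ℕ) : 𝓞 K)} := by
    intro I hI
    obtain ⟨J, hJ⟩ := hI
    have := congrArg (Ideal.map D.σO) hJ
    rw [Ideal.map_mul, map_σO_span, map_natCast] at this
    exact ⟨_, this⟩
  have hd2 := hdvd _ hd1
  have hd3 := hdvd _ hd2
  have hprod := (hc2.mul_left hc3).mul_dvd (hc1.mul_dvd hd1 hd2) hd3
  have h6 := map_dvd Ideal.absNorm hprod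
  rw [map_mul, map_mul, absNorm_map_σO, absNorm_map_σO, absNorm_map_σO, hf, hr6,
    ← pow_add, ← pow_add, Nat.pow_dvd_pow_iff_le_right hr.one_lt] at h6
  have h0 : f ≠ 0 := by
    rintro rfl
    rw [pow_zero, Ideal.absNorm_eq_one_iff] at hf
    exact hR.ne_top hf
  omega

end PureCubic

lemma exists_int_of_isIntegral {K : Type*} [Field K] [NumberField K] {r : ℚ}
    (h : IsIntegral ℤ (algebraMap ℚ K r)) : ∃ n : ℤ, r = n := by
  rw [isIntegral_algebraMap_iff (algebraMap ℚ K).injective] at h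
  obtain ⟨n, hn⟩ := IsIntegrallyClosed.isIntegral_iff.1 h
  exact ⟨n, by simpa using hn.symm⟩

namespace PureCubic

variable {K : Type*} [Field K] [NumberField K] (D : PureCubic K)

/-- Complex conjugation on the ring of integers of `k₀`. -/
def conjO : 𝓞 D.k0 ≃+* 𝓞 D.k0 :=
  have := D.isCyclotomicExtension
  have : IsGalois ℚ D.k0 := IsCyclotomicExtension.isGalois {3} ℚ D.k0
  RingOfIntegers.mapRingEquiv ((D.τ.restrictNormal D.k0 : D.k0 ≃ₐ[ℚ] D.k0) : D.k0 ≃+* D.k0)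

lemma coe_conjO (a : 𝓞 D.k0) : ((D.conjO a : D.k0) : K) = D.τ (a : K) := by
  have := D.isCyclotomicExtension
  have : IsGalois ℚ D.k0 := IsCyclotomicExtension.isGalois {3} ℚ D.k0
  exact AlgEquiv.restrictNormal_commutes D.τ D.k0 (a : D.k0)

lemma conjO_conjO (a : 𝓞 D.k0) : D.conjO (D.conjO a) = a := by
  apply RingOfIntegers.ext
  apply Subtype.ext
  rw [coe_conjO, coe_conjO, τ_τ]

lemma exists_nat_norm (a : 𝓞 D.k0) : ∃ n : ℕ, a * D.conjO a = n ∧ n % 3 ≠ 2 := by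
  obtain ⟨r, s, hrs⟩ := D.exists_of_σ (D.σ_coe_k0 (a : D.k0))
  have hτ := D.coe_conjO a
  have hia : IsIntegral ℤ ((a : D.k0) : K) := (RingOfIntegers.isIntegral_coe a).algebraMap
  have hib : IsIntegral ℤ ((D.conjO a : D.k0) : K) :=
    (RingOfIntegers.isIntegral_coe (D.conjO a)).algebraMap
  rw [hrs, τ_qz] at hτ
  have hn : ((a : D.k0) : K) * ((D.conjO a : D.k0) : K) = algebraMap ℚ K (r ^ 2 - r * s + s ^ 2) := by
    rw [hrs, hτ]
    simp only [qz, map_sub, map_add, map_mul, map_neg, map_pow]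
    linear_combination (-algebraMap ℚ K s ^ 2) * D.ζ_eq
  have ht : ((a : D.k0) : K) + ((D.conjO a : D.k0) : K) = algebraMap ℚ K (2 * r - s) := by
    rw [hrs, hτ]
    simp only [qz, map_sub, map_mul, map_neg, map_ofNat]
    ring
  obtain ⟨n, hn'⟩ := exists_int_of_isIntegral (hn ▸ hia.mul hib)
  obtain ⟨t, ht'⟩ := exists_int_of_isIntegral (ht ▸ hia.add hib)
  have hpos : 0 ≤ n := by
    have : (0 : ℚ) ≤ n := by rw [← hn']; nlinarith [sq_nonneg (r - s), sq_nonneg r, sq_nonneg s]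
    exact_mod_cast this
  lift n to ℕ using hpos
  refine ⟨n, ?_, ?_⟩
  · apply RingOfIntegers.ext
    apply Subtype.ext
    refine hn.trans ?_
    rw [hn']
    simp
  have hw : ∃ w : ℤ, 3 * s = w := by
    have h : IsIntegral ℤ (3 * s) := by
      refine IsIntegral.of_pow (n := 2) (by norm_num) ?_
      have : (3 * s) ^ 2 = algebraMap ℤ ℚ (3 * (4 * n - t ^ 2)) := by
        simp; push_cast at hn'; rw [← hn', ← ht']; ring
      rw [this]; exact isIntegral_algebraMap
    obtain ⟨n, hn⟩ := IsIntegrallyClosed.isIntegral_iff.1 h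
    exact ⟨n, by simpa using hn.symm⟩
  obtain ⟨w, hw⟩ := hw
  have h1 : w ^ 2 = 3 * (4 * n - t ^ 2) := by
    have : (w : ℚ) ^ 2 = 3 * (4 * n - t ^ 2) := by
      push_cast at hn'; rw [← hn', ← ht', ← hw]; ring
    exact_mod_cast this
  obtain ⟨v, rfl⟩ : (3 : ℤ) ∣ w := Int.prime_three.dvd_of_dvd_pow ⟨_, h1⟩
  intro h
  have h2 : 3 * v ^ 2 = 4 * n - t ^ 2 := by linarith
  have h3 : t ^ 2 % 3 = 2 := by omega
  have : t % 3 = 0 ∨ t % 3 = 1 ∨ t % 3 = 2 := by omega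
  rcases this with h | h | h <;> simp [pow_two, Int.mul_emod, h] at h3

lemma isUnit_of_mul_conjO {a : 𝓞 D.k0} (h : a * D.conjO a = (1 : ℕ)) : IsUnit a :=
  IsUnit.of_mul_eq_one (D.conjO a) (by simpa using h)

lemma natCast_inj {m n : ℕ} (h : (m : 𝓞 D.k0) = n) : m = n := by exact_mod_cast h

lemma exists_norm_of_prime {ℓ : ℕ} (hℓ : ℓ.Prime) {π : 𝓞 D.k0} (hπ : Prime π) (h : π ∣ ℓ) :
    ∃ i, (i = 1 ∨ i = 2) ∧ π * D.conjO π = (ℓ ^ i : ℕ) ∧ (ℓ ^ i) % 3 ≠ 2 := by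
  obtain ⟨b, hb⟩ := h
  obtain ⟨n, hn, hn3⟩ := D.exists_nat_norm π
  obtain ⟨m, hm, -⟩ := D.exists_nat_norm b
  have h1 : n * m = ℓ ^ 2 := by
    apply D.natCast_inj
    push_cast
    rw [← hn, ← hm]
    have : (ℓ : 𝓞 D.k0) ^ 2 = ℓ * D.conjO ℓ := by rw [map_natCast, sq]
    rw [this, hb, map_mul]; ring
  obtain ⟨i, hi, rfl⟩ := (Nat.dvd_prime_pow hℓ).1 (Dvd.intro _ h1)
  refine ⟨i, ?_, hn, hn3⟩
  have : i ≠ 0 := by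
    rintro rfl
    exact hπ.not_isUnit (D.isUnit_of_mul_conjO (by simpa using hn))
  omega

lemma not_isUnit_natCast {ℓ : ℕ} (hℓ : 1 < ℓ) : ¬ IsUnit (ℓ : 𝓞 D.k0) := by
  intro h
  obtain ⟨b, hb⟩ := h.exists_right_inv
  obtain ⟨m, hm, -⟩ := D.exists_nat_norm b
  have h1 : ℓ ^ 2 * m = 1 := by
    apply D.natCast_inj
    push_cast
    have : (ℓ : 𝓞 D.k0) ^ 2 = ℓ * D.conjO ℓ := by rw [map_natCast, sq]
    rw [← hm, this]
    calc _ = (ℓ * b) * D.conjO (ℓ * b) := by rw [map_mul]; ring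
      _ = 1 := by rw [hb]; simp
  exact hℓ.ne' (by simpa using Nat.eq_one_of_mul_eq_one_right h1)

lemma exists_prime_dvd {ℓ : ℕ} (hℓ : ℓ.Prime) : ∃ π : 𝓞 D.k0, Prime π ∧ π ∣ ℓ := by
  have := D.isPrincipalIdealRing
  obtain ⟨π, hπ, h⟩ := WfDvdMonoid.exists_irreducible_factor (a := (ℓ : 𝓞 D.k0))
    (by
      intro h
      exact D.not_isUnit_natCast hℓ.one_lt h) (by exact_mod_cast hℓ.ne_zero)
  exact ⟨π, hπ.prime, h⟩

lemma associated_or_of_dvd {ℓ : ℕ} (hℓ : ℓ.Prime) {π ρ : 𝓞 D.k0} (hπ : Prime π) (h : π ∣ ℓ)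
    (hρ : Prime ρ) (h' : ρ ∣ ℓ) : Associated ρ π ∨ Associated ρ (D.conjO π) := by
  obtain ⟨i, hi, hn, -⟩ := D.exists_norm_of_prime hℓ hπ h
  have h1 : ρ ∣ π * D.conjO π := by
    rw [hn]; push_cast
    exact h'.trans (dvd_pow_self _ (by omega))
  have hπ' : Prime (D.conjO π) := (MulEquiv.prime_iff (D.conjO : 𝓞 D.k0 ≃* 𝓞 D.k0)).2 hπ
  exact (hρ.dvd_or_dvd h1).imp (hρ.associated_of_dvd hπ) (hρ.associated_of_dvd hπ')

/-- `ζ` as an algebraic integer. -/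
lemma exists_zeta : ∃ z : 𝓞 D.k0, ((z : D.k0) : K) = D.ζ := by
  have hz : D.ζ ∈ D.k0 := D.mem_k0.2 D.σ_ζ
  have h_int : IsIntegral ℤ (⟨D.ζ, hz⟩ : D.k0) := by
    refine IsIntegral.of_pow (n := 3) (by norm_num) ?_
    have : (⟨D.ζ, hz⟩ : D.k0) ^ 3 = 1 := Subtype.ext D.ζ_pow
    rw [this]; exact isIntegral_one
  exact ⟨⟨_, h_int⟩, rfl⟩

lemma associated_conjO {c : ℕ} (hc : c.Prime) (hc' : c = 3 ∨ c % 3 = 2) {π : 𝓞 D.k0}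
    (hπ : Prime π) (h : π ∣ c) : Associated (D.conjO π) π := by
  obtain ⟨i, hi, hn, hn3⟩ := D.exists_norm_of_prime hc hπ h
  rcases hc' with rfl | hc'
  · obtain ⟨z, hz⟩ := D.exists_zeta
    have hz1 : z ^ 2 + z + 1 = 0 := by
      apply RingOfIntegers.ext
      apply Subtype.ext
      change ((z : D.k0) : K) ^ 2 + ((z : D.k0) : K) + 1 = 0
      rw [hz]; exact D.ζ_eq
    have hz2 : D.conjO z = z ^ 2 := by
      apply RingOfIntegers.ext
      apply Subtype.ext
      rw [coe_conjO]
      change D.τ ((z : D.k0) : K) = ((z : D.k0) : K) ^ 2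
      rw [hz, D.τ_ζ]
    have hlamn : (1 - z) * D.conjO (1 - z) = 3 := by
      rw [map_sub, map_one, hz2]
      linear_combination (z - 2) * hz1
    have hzu : IsUnit (1 + z) := IsUnit.of_mul_eq_one (-z) (by linear_combination -hz1)
    have hlamc : D.conjO (1 - z) = (1 - z) * (1 + z) := by
      rw [map_sub, map_one, hz2]; ring
    have h3 : π ∣ (1 - z) ^ 2 := by
      have : ((3 : ℕ) : 𝓞 D.k0) = (1 - z) ^ 2 * (1 + z) := by
        push_cast; rw [← hlamn, hlamc]; ring
      rw [this] at h
      exact hzu.dvd_mul_right.1 h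
    obtain ⟨b, hb⟩ := hπ.dvd_of_dvd_pow h3
    obtain ⟨m, hm, -⟩ := D.exists_nat_norm b
    have hnm : 3 ^ i * m = 3 := by
      apply D.natCast_inj
      rw [Nat.cast_mul, ← hn, ← hm]
      calc _ = (π * b) * D.conjO (π * b) := by rw [map_mul]; ring
        _ = _ := by rw [← hb, hlamn]; norm_num
    have hm1 : m = 1 := by
      rcases hi with rfl | rfl <;> omega
    have hbu : IsUnit b := D.isUnit_of_mul_conjO (by rw [hm, hm1])
    have hass : Associated (1 - z) π := by
      rw [hb]; exact (associated_mul_unit_left _ _ hbu)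
    have hass' : Associated (D.conjO (1 - z)) (D.conjO π) := hass.map (D.conjO : 𝓞 D.k0 ≃* 𝓞 D.k0)
    refine hass'.symm.trans (Associated.trans ?_ hass)
    rw [hlamc]; exact associated_mul_unit_left _ _ hzu
  · have hi2 : i = 2 := by
      rcases hi with rfl | rfl
      · simp [hc'] at hn3
      · rfl
    subst hi2
    obtain ⟨b, hb⟩ := h
    obtain ⟨m, hm, -⟩ := D.exists_nat_norm b
    have hnm : c ^ 2 * m = c ^ 2 := by
      apply D.natCast_inj
      rw [Nat.cast_mul, ← hn, ← hm]
      calc _ = (π * b) * D.conjO (π * b) := by rw [map_mul]; ring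
        _ = _ := by rw [← hb, hn, map_natCast]; push_cast; ring
    have hm1 : m = 1 := by
      have : 0 < c ^ 2 := pow_pos hc.pos 2
      exact Nat.eq_of_mul_eq_mul_left this (by simpa using hnm)
    have hbu : IsUnit b := D.isUnit_of_mul_conjO (by rw [hm, hm1])
    have hass : Associated (c : 𝓞 D.k0) π := by
      rw [hb]; exact (associated_mul_unit_left _ _ hbu)
    have hass' : Associated (D.conjO c) (D.conjO π) := hass.map (D.conjO : 𝓞 D.k0 ≃* 𝓞 D.k0)
    rw [map_natCast] at hass'
    exact hass'.symm.trans hass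

lemma nonempty_ramData {p c m : ℕ} (hp : p.Prime) (hc : c.Prime) (hc' : c = 3 ∨ c % 3 = 2)
    {y : 𝓞 K} (hy : y ∈ differentIdeal (𝓞 D.k0) (𝓞 K)) (hym : y ∣ (m : 𝓞 K)) (hm0 : m ≠ 0)
    (hm : ∀ ℓ : ℕ, ℓ.Prime → ℓ ∣ m → ℓ = p ∨ ℓ = c) : Nonempty (D.RamData p c) := by
  obtain ⟨π, hπ, hπp⟩ := D.exists_prime_dvd hp
  obtain ⟨ρ, hρ, hρc⟩ := D.exists_prime_dvd hc
  obtain ⟨i, hi, hni, -⟩ := D.exists_norm_of_prime hp hπ hπp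
  obtain ⟨j, hj, hnj, -⟩ := D.exists_norm_of_prime hc hρ hρc
  have key : ∀ (a : 𝓞 D.k0) (n : ℕ), a * D.conjO a = n →
      ((a : D.k0) : K) * D.τ ((a : D.k0) : K) = algebraMap ℚ K n := by
    intro a n h
    rw [← coe_conjO]
    have := congrArg (fun x : 𝓞 D.k0 => ((x : D.k0) : K)) h
    refine this.trans ?_
    simp
  refine ⟨⟨π, D.conjO π, ρ, hπ.ne_zero, (map_ne_zero_iff _ D.conjO.injective).2 hπ.ne_zero,
    hρ.ne_zero, ?_, i, i, j, 1, 1, 1, one_ne_zero, one_ne_zero, one_ne_zero, by omega, ?_, ?_, ?_⟩⟩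
  · intro ξ hξ h1 h2 h3
    refine D.squarefree_map hξ hy (m := m) (n := 1) (by simpa using hym) fun hdvd => ?_
    have : ∃ ℓ : ℕ, ℓ.Prime ∧ ℓ ∣ m ∧ ξ ∣ (ℓ : 𝓞 D.k0) := by
      rw [← Nat.prod_primeFactorsList hm0, Nat.cast_list_prod] at hdvd
      obtain ⟨x, hx, hx'⟩ := (hξ.dvd_prod_iff).1 hdvd
      obtain ⟨ℓ, hℓ, rfl⟩ := List.mem_map.1 hx
      exact ⟨ℓ, Nat.prime_of_mem_primeFactorsList hℓ, Nat.dvd_of_mem_primeFactorsList hℓ, hx'⟩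
    obtain ⟨ℓ, hℓ, hℓm, hξℓ⟩ := this
    rcases hm ℓ hℓ hℓm with rfl | rfl
    · exact (D.associated_or_of_dvd hℓ hπ hπp hξ hξℓ).elim h1 h2
    · refine h3 ?_
      rcases D.associated_or_of_dvd hℓ hρ hρc hξ hξℓ with h | h
      · exact h
      · exact h.trans (D.associated_conjO hc hc' hρ hρc)
  · refine (key π _ hni).trans ?_
    simp
  · refine (key (D.conjO π) (p ^ i) (by rw [conjO_conjO, mul_comm, hni])).trans ?_
    simp
  · refine (key ρ _ hnj).trans ?_
    simp

lemma exists_θO : ∃ t : 𝓞 K, (t : K) = D.θ := by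
  have h_int : IsIntegral ℤ D.θ := by
    refine IsIntegral.of_pow (n := 3) (by norm_num) ?_
    rw [D.θ_pow]
    simpa using isIntegral_algebraMap (R := ℤ) (A := K) (x := (D.d : ℤ))
  exact ⟨⟨_, h_int⟩, rfl⟩

lemma σ_θ_ne : D.σ D.θ ≠ D.θ := by
  rw [D.σ_θ]
  intro h
  exact D.ζ_ne_one (mul_right_cancel₀ D.θ_ne_zero (by rw [h, one_mul]))

lemma nonempty_ramData_three {p : ℕ} (hp : p.Prime)
    (hd : ∀ ℓ : ℕ, ℓ.Prime → ℓ ∣ D.d → ℓ = p ∨ ℓ = 3) : Nonempty (D.RamData p 3) := by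
  obtain ⟨t, ht⟩ := D.exists_θO
  have ht3 : t ^ 3 = D.d := RingOfIntegers.ext (by
    change (t : K) ^ 3 = ((D.d : 𝓞 K) : K); rw [ht, D.θ_pow]; simp)
  have hy := D.mem_differentIdeal (x := t) (by rw [ht]; exact D.σ_θ_ne) 0 0 (-(D.d : 𝓞 D.k0))
    (by simp [ht3])
  refine D.nonempty_ramData (m := 3 * D.d) hp Nat.prime_three (Or.inl rfl) hy ⟨t, ?_⟩
    (by simp [D.d_ne_zero]) ?_
  · push_cast; rw [← ht3]; ring
  · intro ℓ hℓ h
    rcases hℓ.dvd_mul.1 h with h | h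
    · exact Or.inr ((Nat.prime_dvd_prime_iff_eq hℓ Nat.prime_three).1 h)
    · exact hd ℓ hℓ h

lemma nonempty_ramData_of_mod_nine {p q : ℕ} (hp : p.Prime) (hq : q.Prime) (hq3 : q % 3 = 2)
    (h9 : D.d % 9 = 1 ∨ D.d % 9 = 8)
    (hd : ∀ ℓ : ℕ, ℓ.Prime → ℓ ∣ D.d → ℓ = p ∨ ℓ = q) : Nonempty (D.RamData p q) := by
  obtain ⟨s, m, hs, hsd⟩ : ∃ s m : ℤ, s ^ 2 = 1 ∧ s - D.d = 9 * m := by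
    rcases h9 with h | h
    · exact ⟨1, (1 - D.d) / 9, by norm_num, by omega⟩
    · exact ⟨-1, (-1 - D.d) / 9, by norm_num, by omega⟩
  obtain ⟨z, hz⟩ := D.exists_zeta
  set Z : 𝓞 K := algebraMap (𝓞 D.k0) (𝓞 K) z with hZ
  have hZK : (Z : K) = D.ζ := by rw [← hz]; exact D.coe_algebraMap z
  have hne : D.ζ - 1 ≠ 0 := sub_ne_zero.2 D.ζ_ne_one
  have hs' : (s : K) ^ 2 = 1 := by exact_mod_cast hs
  have hsd' : (s : K) - D.d = 9 * m := by exact_mod_cast hsd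
  have hθ := D.θ_pow
  set β : K := (D.θ - s) / (D.ζ - 1) with hβ
  have hβ' : D.θ = (D.ζ - 1) * β + s := by rw [hβ]; field_simp; ring
  have hβ3 : β ^ 3 - D.ζ ^ 2 * (D.ζ - 1) * s * β ^ 2 - D.ζ ^ 2 * β + D.ζ * (D.ζ - 1) * m = 0 := by
    have h3 : (D.ζ - 1) ^ 3 ≠ 0 := pow_ne_zero _ hne
    have hl : (D.ζ - 1) ^ 2 + 3 * D.ζ = 0 := by linear_combination D.ζ_eq
    have h1 := D.ζ_pow
    apply mul_left_cancel₀ h3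
    rw [hβ'] at hθ
    have e1 : -D.ζ ^ 2 * (D.ζ - 1) ^ 4 = 3 * (D.ζ - 1) ^ 2 := by
      linear_combination -D.ζ ^ 2 * (D.ζ - 1) ^ 2 * hl + 3 * (D.ζ - 1) ^ 2 * h1
    have e2 : -D.ζ ^ 2 * (D.ζ - 1) ^ 3 = 3 * (D.ζ - 1) := by
      linear_combination -D.ζ ^ 2 * (D.ζ - 1) * hl + 3 * (D.ζ - 1) * h1
    have e3 : D.ζ * (D.ζ - 1) ^ 4 = 9 := by
      linear_combination ((D.ζ - 1) ^ 2 - 3 * D.ζ) * D.ζ * hl + 9 * h1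
    linear_combination hθ + s * β ^ 2 * e1 + β * e2 + m * e3 +
      (-3 * (D.ζ - 1) * β - s) * hs' - hsd'
  have hiz : IsIntegral ℤ D.ζ := hZK ▸ RingOfIntegers.isIntegral_coe Z
  have hβi : IsIntegral (𝓞 D.k0) β := by
    refine ⟨Polynomial.X ^ 3 + Polynomial.C (-z ^ 2 * (z - 1) * s) * Polynomial.X ^ 2 +
      Polynomial.C (-z ^ 2) * Polynomial.X + Polynomial.C (z * (z - 1) * m), by monicity!, ?_⟩
    have hzK : algebraMap (𝓞 D.k0) K z = D.ζ := hz
    simp only [Polynomial.eval₂_add, Polynomial.eval₂_mul, Polynomial.eval₂_pow,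
      Polynomial.eval₂_X, Polynomial.eval₂_C]
    simp only [map_mul, map_neg, map_pow, map_sub, map_one,
      map_intCast, hzK]
    linear_combination hβ3
  obtain ⟨b, hb⟩ : ∃ b : 𝓞 K, (b : K) = β := ⟨⟨β, isIntegral_trans (R := ℤ) β hβi⟩, rfl⟩
  obtain ⟨t, ht⟩ := D.exists_θO
  have ht3 : t ^ 3 = D.d := RingOfIntegers.ext (by
    change (t : K) ^ 3 = ((D.d : 𝓞 K) : K); rw [ht, D.θ_pow]; simp)
  have hZ1 : Z ^ 2 + Z + 1 = 0 := RingOfIntegers.ext (by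
    change (Z : K) ^ 2 + (Z : K) + 1 = 0; rw [hZK, D.ζ_eq])
  have htb : t = (Z - 1) * b + s := RingOfIntegers.ext (by
    change (t : K) = ((Z : K) - 1) * (b : K) + ((s : 𝓞 K) : K)
    rw [ht, hZK, hb, hβ']; simp)
  have hs2 : (s : 𝓞 K) ^ 2 = 1 := by exact_mod_cast hs
  have hσβ : D.σ (b : K) ≠ b := by
    rw [hb]
    intro h
    apply D.σ_θ_ne
    rw [hβ']
    simp [h, D.σ_ζ]
  have hy := D.mem_differentIdeal (x := b) hσβ (-z ^ 2 * (z - 1) * s) (-z ^ 2) (z * (z - 1) * m)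
    (RingOfIntegers.ext (by
      simp only [map_mul, map_neg, map_pow, map_sub, map_one, map_intCast, ← hZ]
      change (b : K) ^ 3 + (-(Z : K) ^ 2 * ((Z : K) - 1) * ((s : 𝓞 K) : K)) * (b : K) ^ 2 +
        (-(Z : K) ^ 2) * (b : K) + (Z : K) * ((Z : K) - 1) * ((m : 𝓞 K) : K) = 0
      rw [hZK, hb, show ((s : 𝓞 K) : K) = s from map_intCast (algebraMap (𝓞 K) K) s,
        show ((m : 𝓞 K) : K) = m from map_intCast (algebraMap (𝓞 K) K) m]
      linear_combination hβ3))
  refine D.nonempty_ramData (m := D.d) hp hq (Or.inr hq3) hy ⟨-Z * t, ?_⟩ D.d_ne_zero hd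
  simp only [map_mul, map_neg, map_pow, map_sub, map_one, map_intCast, ← hZ]
  have hZ3 : Z ^ 3 = 1 := by linear_combination (Z - 1) * hZ1
  have hder : 3 * b ^ 2 + 2 * (-Z ^ 2 * (Z - 1) * s) * b + -Z ^ 2 = -Z ^ 2 * t ^ 2 := by
    have hl : -Z ^ 2 * (Z - 1) ^ 2 = 3 := by
      linear_combination -Z ^ 2 * hZ1 + 3 * hZ3
    rw [htb]
    linear_combination -b ^ 2 * hl + Z ^ 2 * hs2
  rw [hder, ← ht3]
  linear_combination -t ^ 3 * hZ3

end PureCubic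

lemma conj_zeta3 : (starRingEnd ℂ) zeta3 = zeta3 ^ 2 := by
  have h : (starRingEnd ℂ) zeta3 * zeta3 = 1 := by
    rw [mul_comm, Complex.mul_conj, Complex.normSq_eq_norm_sq,
      zeta3_isPrimitiveRoot.norm'_eq_one (by norm_num)]
    simp
  have h3 := zeta3_isPrimitiveRoot.pow_eq_one
  calc _ = (starRingEnd ℂ) zeta3 * zeta3 ^ 3 := by rw [h3, mul_one]
    _ = ((starRingEnd ℂ) zeta3 * zeta3) * zeta3 ^ 2 := by ring
    _ = _ := by rw [h, one_mul]

lemma conj_cbrt (d : ℕ) : (starRingEnd ℂ) (cbrt d) = cbrt d := Complex.conj_ofReal _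

/-- Complex conjugation on `ℂ`, as a `ℚ`-algebra homomorphism. -/
def conjQ : ℂ →ₐ[ℚ] ℂ := (Complex.conjAe.restrictScalars ℚ : ℂ ≃ₐ[ℚ] ℂ)

lemma conjQ_apply (z : ℂ) : conjQ z = (starRingEnd ℂ) z := rfl

lemma conjQ_mem (d : ℕ) (x : Kc d) : conjQ x ∈ Kc d := by
  have : Kc d ≤ (Kc d).comap conjQ := by
    rw [Kc, IntermediateField.adjoin_le_iff]
    rintro x (rfl | rfl)
    · change conjQ (cbrt d) ∈ Kc d
      rw [conjQ_apply, conj_cbrt]; exact cbrt_mem d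
    · change conjQ zeta3 ∈ Kc d
      rw [conjQ_apply, conj_zeta3]; exact pow_mem (zeta3_mem d) 2
  exact this x.2

/-- Complex conjugation on `k`. -/
def conjK (d : ℕ) : Kc d ≃ₐ[ℚ] Kc d :=
  AlgEquiv.ofBijective
    ((conjQ.comp (Kc d).val).codRestrict (Kc d).toSubalgebra (conjQ_mem d) : Kc d →ₐ[ℚ] Kc d)
    (Algebra.IsAlgebraic.algHom_bijective _)

lemma conjK_zetaK (d : ℕ) : conjK d (zetaK d) = zetaK d ^ 2 := Subtype.ext conj_zeta3

lemma conjK_cbrtK (d : ℕ) : conjK d (cbrtK d) = cbrtK d := Subtype.ext (conj_cbrt d)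

lemma cbrtK_pow (d : ℕ) : cbrtK d ^ 3 = d := Subtype.ext (by
  change cbrt d ^ 3 = ((d : Kc d) : ℂ)
  rw [cbrt_pow_three]; simp)

lemma zetaK_isPrimitiveRoot (d : ℕ) : IsPrimitiveRoot (zetaK d) 3 :=
  IsPrimitiveRoot.of_map_of_injective (f := (Kc d).val) zeta3_isPrimitiveRoot
    (Kc d).val.injective

lemma adjoin_cbrtK_zetaK (d : ℕ) : Algebra.adjoin ℚ {cbrtK d, zetaK d} = ⊤ := by
  have h : IntermediateField.adjoin ℚ {cbrtK d, zetaK d} = ⊤ := by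
    apply IntermediateField.map_injective (Kc d).val
    refine (IntermediateField.adjoin_map ℚ _ (Kc d).val).trans ?_
    refine Eq.trans ?_ (AlgHom.fieldRange_eq_map (Kc d).val)
    rw [IntermediateField.fieldRange_val, Set.image_pair]
    rfl
  rw [← IntermediateField.adjoin_toSubalgebra_of_isAlgebraic, h]
  · rfl
  · intro x hx
    exact Algebra.IsAlgebraic.isAlgebraic x

lemma exists_pureCubic (d : ℕ) (hnc : ∀ x : ℚ, x ^ 3 ≠ d) (σ : Kc d ≃ₐ[ℚ] Kc d)
    (hσfix : ∀ x : Kc d, x ∈ k0S d → σ x = x) (hσne : σ ≠ 1) :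
    ∃ D : PureCubic (Kc d), D.d = d ∧ D.σ = σ ∧ D.k0 = k0S d ∧ D.L = LS d := by
  have hd0 : d ≠ 0 := by
    rintro rfl
    exact hnc 0 (by simp)
  have hθ := cbrtK_pow d
  have hθ0 : cbrtK d ≠ 0 := by
    intro h
    rw [h] at hθ
    simp at hθ
    exact hd0 (by exact_mod_cast hθ.symm)
  have hσz : σ (zetaK d) = zetaK d := hσfix _ (IntermediateField.mem_adjoin_simple_self ℚ _)
  have hz := zetaK_isPrimitiveRoot d
  set ω : Kc d := σ (cbrtK d) / cbrtK d with hω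
  have hσθ : σ (cbrtK d) = ω * cbrtK d := by rw [hω, div_mul_cancel₀ _ hθ0]
  have hω3 : ω ^ 3 = 1 := by
    rw [hω, div_pow, ← map_pow, hθ, map_natCast, div_self (by exact_mod_cast hd0)]
  have hω1 : ω ≠ 1 := by
    intro h
    apply hσne
    rw [h, one_mul] at hσθ
    have h2 : (σ : Kc d →ₐ[ℚ] Kc d) = AlgHom.id ℚ _ := by
      apply AlgHom.ext_of_adjoin_eq_top (adjoin_cbrtK_zetaK d)
      rintro x (rfl | rfl)
      · exact hσθ
      · exact hσz
    exact AlgEquiv.ext fun x => DFunLike.congr_fun h2 x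
  have hωz : ω = zetaK d ∨ ω = zetaK d ^ 2 := by
    obtain ⟨i, hi, h⟩ := hz.eq_pow_of_pow_eq_one hω3
    interval_cases i
    · exact absurd (by simpa using h.symm) hω1
    · left; simpa using h.symm
    · right; exact h.symm
  have hzω : zetaK d = ω ∨ zetaK d = ω ^ 2 := by
    rcases hωz with h | h
    · exact Or.inl h.symm
    · right
      rw [h]
      linear_combination (-zetaK d) * hz.pow_eq_one
  have hzeq : ω ^ 2 + ω + 1 = 0 := by
    have : (ω - 1) * (ω ^ 2 + ω + 1) = 0 := by linear_combination hω3
    exact (mul_eq_zero.1 this).resolve_left (sub_ne_zero.2 hω1)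
  refine ⟨⟨cbrtK d, ω, d, σ, conjK d, k0S d, LS d, hzeq, hθ, ?_, hσθ, ?_, conjK_cbrtK d, ?_, rfl,
    ?_, hnc⟩, rfl, rfl, rfl, rfl⟩
  · rcases hωz with h | h <;> rw [h]
    · exact hσz
    · rw [map_pow, hσz]
  · rcases hωz with h | h <;> rw [h]
    · exact conjK_zetaK d
    · rw [map_pow, conjK_zetaK]
  · rw [k0S]
    apply le_antisymm <;> rw [IntermediateField.adjoin_simple_le_iff]
    · rcases hzω with h | h <;> rw [h]
      · exact IntermediateField.mem_adjoin_simple_self ℚ _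
      · exact pow_mem (IntermediateField.mem_adjoin_simple_self ℚ _) 2
    · rcases hωz with h | h <;> rw [h]
      · exact IntermediateField.mem_adjoin_simple_self ℚ _
      · exact pow_mem (IntermediateField.mem_adjoin_simple_self ℚ _) 2
  · rw [eq_top_iff, ← adjoin_cbrtK_zetaK d, Algebra.adjoin_le_iff]
    rintro x (rfl | rfl)
    · exact Algebra.subset_adjoin (by simp)
    · rcases hzω with h | h <;> rw [h]
      · exact Algebra.subset_adjoin (by simp)
      · exact pow_mem (Algebra.subset_adjoin (by simp)) 2

lemma rat_pow_three_ne {p d : ℕ} [Fact p.Prime] (h : ¬ 3 ∣ padicValNat p d) (x : ℚ) : x ^ 3 ≠ d := by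
  intro hx
  apply h
  rcases eq_or_ne x 0 with rfl | hx0
  · have : d = 0 := by exact_mod_cast (by simpa using hx.symm : (d : ℚ) = 0)
    simp [this]
  have := congrArg (padicValRat p) hx
  rw [padicValRat.pow, padicValRat.of_nat] at this
  exact Int.natCast_dvd_natCast.1 ⟨_, this.symm⟩

lemma spanSingleton_eq_iff_unit {F : Type*} [Field F] [NumberField F] {x y : F} :
    FractionalIdeal.spanSingleton (𝓞 F)⁰ x = FractionalIdeal.spanSingleton (𝓞 F)⁰ y ↔
      ∃ u : (𝓞 F)ˣ, x = (u : 𝓞 F) * y := by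
  rw [eq_comm, FractionalIdeal.spanSingleton_eq_spanSingleton]
  constructor
  · rintro ⟨u, rfl⟩
    exact ⟨u, rfl⟩
  · rintro ⟨u, rfl⟩
    exact ⟨u, rfl⟩

lemma toPrincipalIdeal_eq_iff_unit {F : Type*} [Field F] [NumberField F] {x y : Fˣ} :
    toPrincipalIdeal (𝓞 F) F x = toPrincipalIdeal (𝓞 F) F y ↔
      ∃ u : (𝓞 F)ˣ, (x : F) = (u : 𝓞 F) * y := by
  rw [toPrincipalIdeal_eq_iff, coe_toPrincipalIdeal, spanSingleton_eq_iff_unit]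

namespace PureCubic

variable {K : Type*} [Field K] [NumberField K] (D : PureCubic K)

lemma mem_ambig_iff_spanSingleton {x : Kˣ} : x ∈ D.ambig ↔
    FractionalIdeal.spanSingleton (𝓞 K)⁰ (D.σ (x : K)) =
      FractionalIdeal.spanSingleton (𝓞 K)⁰ (x : K) := by
  rw [spanSingleton_eq_iff_unit, mem_ambig]

/-- The units of the cubic fields and of `k₀` generate the group `E0`. -/
lemma closure_subfieldUnits (hN : ∀ x : K, x * D.σ x * D.σ (D.σ x) ≠ D.ζ) :
    Subgroup.closure {u : (𝓞 K)ˣ | ((u : 𝓞 K) : K) ∈ D.k0 ∨ ((u : 𝓞 K) : K) ∈ D.L ∨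
      ((u : 𝓞 K) : K) ∈ D.L.map (D.σ : K →ₐ[ℚ] K) ∨
      ((u : 𝓞 K) : K) ∈ D.L.map ((D.σ * D.σ : K ≃ₐ[ℚ] K) : K →ₐ[ℚ] K)} =
    (D.unitAction hN).E0 := by
  rw [UnitAction.E0]
  congr 1
  ext u
  have h1 : ((u : 𝓞 K) : K) ∈ D.L.map (D.σ : K →ₐ[ℚ] K) ↔
      D.σ (D.σ (D.τ ((u : 𝓞 K) : K))) = (u : 𝓞 K) := by
    constructor
    · rintro ⟨x, hx, h⟩
      have h' : D.σ x = (u : 𝓞 K) := h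
      rw [← h', τ_σ, D.σ_σ_σ, D.mem_L.1 hx]
    · intro h
      refine ⟨D.σ (D.σ (u : 𝓞 K)), D.mem_L.2 ?_, D.σ_σ_σ _⟩
      have h3 := congrArg (fun y => D.σ (D.σ y)) h
      simp only [σ_σ_σ] at h3
      rw [← σ_τ]
      exact h3
  have h2 : ((u : 𝓞 K) : K) ∈ D.L.map ((D.σ * D.σ : K ≃ₐ[ℚ] K) : K →ₐ[ℚ] K) ↔
      D.σ (D.τ ((u : 𝓞 K) : K)) = (u : 𝓞 K) := by
    constructor
    · rintro ⟨x, hx, h⟩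
      have h' : D.σ (D.σ x) = (u : 𝓞 K) := h
      rw [← h', ← σ_τ, D.mem_L.1 hx]
    · intro h
      refine ⟨D.σ (u : 𝓞 K), D.mem_L.2 ?_, D.σ_σ_σ _⟩
      rw [τ_σ, h]
  have e : ∀ v : (𝓞 K)ˣ, v = u ↔ ((v : 𝓞 K) : K) = (u : 𝓞 K) :=
    fun v => ⟨fun h => by rw [h], Units.ext_coe⟩
  simp only [Set.mem_ofPred_eq]
  rw [h1, h2, D.mem_k0, D.mem_L, e, e, e, e]
  rfl

lemma index_norm_units (hN : ∀ x : K, x * D.σ x * D.σ (D.σ x) ≠ D.ζ)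
    (F : IntermediateField ℚ K) (hF : D.k0 = F) :
    (Subgroup.closure {u : (𝓞 F)ˣ | ∃ v : (𝓞 K)ˣ,
      Algebra.norm F ((v : 𝓞 K) : K) = ((u : 𝓞 F) : F)}).index = 3 := by
  subst hF
  have coe_inj : ∀ {u v : (𝓞 D.k0)ˣ}, (((u : 𝓞 D.k0) : D.k0) : K) = ((v : 𝓞 D.k0) : D.k0) → u = v :=
    fun h => Units.ext_coe (Subtype.ext h)
  have hpm : ∀ u ∈ Subgroup.closure {u : (𝓞 D.k0)ˣ | ∃ v : (𝓞 K)ˣ,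
      Algebra.norm D.k0 ((v : 𝓞 K) : K) = ((u : 𝓞 D.k0) : D.k0)}, u = 1 ∨ u = -1 := by
    intro u hu
    induction hu using Subgroup.closure_induction with
    | mem u hu =>
      obtain ⟨v, hv⟩ := hu
      have h := congrArg (fun x : D.k0 => (x : K)) hv
      have h' := D.norm_k0 ((v : 𝓞 K) : K)
      rcases D.norm_unit hN v with h2 | h2
      · left; apply coe_inj; rw [← h]; simp [h', h2]
      · right; apply coe_inj; rw [← h]; simp [h', h2]
    | one => exact Or.inl rfl
    | mul x y _ _ hx hy => rcases hx with rfl | rfl <;> rcases hy with rfl | rfl <;> simp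
    | inv x _ hx => rcases hx with rfl | rfl <;> simp
  have hneg : (-1 : (𝓞 D.k0)ˣ) ∈ Subgroup.closure {u : (𝓞 D.k0)ˣ | ∃ v : (𝓞 K)ˣ,
      Algebra.norm D.k0 ((v : 𝓞 K) : K) = ((u : 𝓞 D.k0) : D.k0)} := by
    apply Subgroup.subset_closure
    refine ⟨-1, Subtype.ext ?_⟩
    rw [norm_k0]; simp
  obtain ⟨z, hz⟩ := Units.exists_of_mem D.k0 D.zU (D.mem_k0.2 (by rw [coe_zU, D.σ_ζ]))
  rw [coe_zU] at hz
  set H := Subgroup.closure {u : (𝓞 D.k0)ˣ | ∃ v : (𝓞 K)ˣ,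
      Algebra.norm D.k0 ((v : 𝓞 K) : K) = ((u : 𝓞 D.k0) : D.k0)}
  have hz3 : z ^ 3 = 1 := by
    apply coe_inj
    have := D.ζ_pow
    rw [← hz] at this
    simpa using this
  have hzH : z ∉ H := by
    intro h
    rcases hpm z h with h | h
    · rw [h] at hz; simp at hz; exact D.ζ_ne_one hz.symm
    · rw [h] at hz3
      have := congrArg (fun u : (𝓞 D.k0)ˣ => (((u : 𝓞 D.k0) : D.k0) : K)) hz3
      norm_num at this
  have hord : orderOf (QuotientGroup.mk z : (𝓞 D.k0)ˣ ⧸ H) = 3 := by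
    apply orderOf_eq_prime
    · rw [← QuotientGroup.mk_pow, hz3]; rfl
    · rwa [Ne, QuotientGroup.eq_one_iff]
  have htop : Subgroup.zpowers (QuotientGroup.mk z : (𝓞 D.k0)ˣ ⧸ H) = ⊤ := by
    rw [eq_top_iff]
    rintro x -
    obtain ⟨u, rfl⟩ := QuotientGroup.mk_surjective x
    obtain ⟨i, j, hij⟩ := D.exists_unit_eq
      (u := _root_.Units.map (algebraMap (𝓞 D.k0) (𝓞 K) : 𝓞 D.k0 →* 𝓞 K) u) (D.σ_coe_k0 _)
    have : u = (-1) ^ i * z ^ j := by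
      apply coe_inj
      have := congrArg (fun u : (𝓞 K)ˣ => ((u : 𝓞 K) : K)) hij
      refine this.trans ?_
      simp [hz, coe_zU]
    rw [this, QuotientGroup.mk_mul, QuotientGroup.mk_pow, QuotientGroup.mk_pow,
      (QuotientGroup.eq_one_iff (-1 : (𝓞 D.k0)ˣ)).2 hneg, one_pow, one_mul]
    exact pow_mem (Subgroup.mem_zpowers _) _
  rw [Subgroup.index, ← hord, ← Nat.card_zpowers, htop, Subgroup.card_top]

lemma relIndex_ambigL (hN : ∀ x : K, x * D.σ x * D.σ (D.σ x) ≠ D.ζ)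
    (F : IntermediateField ℚ K) (hF : D.L = F) :
    (Subgroup.closure {I : (FractionalIdeal (𝓞 F)⁰ F)ˣ | ∃ r : ℚˣ,
      I = toPrincipalIdeal (𝓞 F) F (_root_.Units.map (algebraMap ℚ F).toMonoidHom r)}).relIndex
    (Subgroup.closure {I : (FractionalIdeal (𝓞 F)⁰ F)ˣ | ∃ x : Fˣ,
      I = toPrincipalIdeal (𝓞 F) F x ∧
      FractionalIdeal.spanSingleton (𝓞 K)⁰ (D.σ (algebraMap F K (x : F))) =
        FractionalIdeal.spanSingleton (𝓞 K)⁰ (algebraMap F K (x : F))}) =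
    (D.unitAction hN).Y.relIndex (D.unitAction hN).plus := by
  subst hF
  set j : D.Lˣ →* Kˣ := _root_.Units.map (algebraMap D.L K : D.L →* K)
  set f := toPrincipalIdeal (𝓞 D.L) D.L
  have h1 : {I : (FractionalIdeal (𝓞 D.L)⁰ D.L)ˣ | ∃ r : ℚˣ,
      I = f (_root_.Units.map (algebraMap ℚ D.L).toMonoidHom r)} =
      ((f.comp (_root_.Units.map (algebraMap ℚ D.L).toMonoidHom)).range : Set _) := by
    ext I
    simp [eq_comm]
  have h2 : {I : (FractionalIdeal (𝓞 D.L)⁰ D.L)ˣ | ∃ x : D.Lˣ, I = f x ∧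
      FractionalIdeal.spanSingleton (𝓞 K)⁰ (D.σ (algebraMap D.L K (x : D.L))) =
        FractionalIdeal.spanSingleton (𝓞 K)⁰ (algebraMap D.L K (x : D.L))} =
      ((D.ambig.comap j).map f : Set _) := by
    ext I
    constructor
    · rintro ⟨x, rfl, hx⟩
      exact ⟨x, D.mem_ambig_iff_spanSingleton.2 hx, rfl⟩
    · rintro ⟨x, hx, rfl⟩
      exact ⟨x, rfl, D.mem_ambig_iff_spanSingleton.1 hx⟩
  rw [h1, h2, Subgroup.closure_eq, Subgroup.closure_eq, ← Subgroup.relIndex_comap,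
    ← card_map_mk' (D.unitAction hN).Y (D.unitAction hN).plus, ← D.map_ambigL hN]
  set g : D.ambig.comap j →* (𝓞 K)ˣ ⧸ (D.unitAction hN).Y :=
    (D.ψ hN).comp (j.subgroupComap D.ambig)
  have hker : (((f.comp (_root_.Units.map (algebraMap ℚ D.L).toMonoidHom)).range.comap f).subgroupOf
      (D.ambig.comap j)) = g.ker := by
    ext x
    rw [Subgroup.mem_subgroupOf, Subgroup.mem_comap, MonoidHom.mem_ker]
    have hx : j.subgroupComap D.ambig x ∈ D.ambigL := D.mem_L.1 ((x : D.Lˣ) : D.L).2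
    refine Iff.trans ?_ (D.ψ_eq_one_iff_of_mem hN hx).symm
    constructor
    · rintro ⟨r, hr⟩
      obtain ⟨u, hu⟩ := toPrincipalIdeal_eq_iff_unit.1 hr.symm
      refine ⟨r, _root_.Units.map (algebraMap (𝓞 D.L) (𝓞 K) : 𝓞 D.L →* 𝓞 K) u,
        D.mem_L.1 ((u : 𝓞 D.L) : D.L).2, ?_⟩
      have := congrArg (fun y : D.L => (y : K)) hu
      refine this.trans ?_
      rw [mul_comm]
      rfl
    · rintro ⟨r, e, he, h⟩
      obtain ⟨u, hu⟩ := Units.exists_of_mem D.L e (D.mem_L.2 he)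
      have hr : r ≠ 0 := by
        rintro rfl
        rw [map_zero, zero_mul] at h
        exact Units.ne_zero _ h
      refine ⟨Units.mk0 r hr, (toPrincipalIdeal_eq_iff_unit.2 ⟨u, ?_⟩).symm⟩
      apply Subtype.ext
      refine h.trans ?_
      rw [mul_comm, ← hu]
      rfl
  rw [Subgroup.relIndex, hker, Subgroup.index_ker]
  congr 2
  ext y
  constructor
  · rintro ⟨x, rfl⟩
    exact ⟨_, D.mem_L.1 ((x : D.Lˣ) : D.L).2, rfl⟩
  · rintro ⟨x, hx, rfl⟩
    have hxL : ((x : Kˣ) : K) ∈ D.L := D.mem_L.2 hx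
    have hx0 : (⟨_, hxL⟩ : D.L) ≠ 0 := fun h => Units.ne_zero (x : Kˣ) (congrArg Subtype.val h)
    have hj : j (Units.mk0 ⟨_, hxL⟩ hx0) = x := Units.ext rfl
    exact ⟨⟨Units.mk0 ⟨_, hxL⟩ hx0, by rw [Subgroup.mem_comap, hj]; exact x.2⟩,
      congrArg (D.ψ hN) (Subtype.ext hj)⟩

end PureCubic

namespace PureCubic

variable {K : Type*} [Field K] [NumberField K] (D : PureCubic K)

lemma card_relative_norm_kernel (hN : ∀ x : K, x * D.σ x * D.σ (D.σ x) ≠ D.ζ)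
    (F₀ F : IntermediateField ℚ K) (hF₀ : D.k0 = F₀) (hF : D.L = F)
    (P A : Subgroup (FractionalIdeal (𝓞 K)⁰ K)ˣ)
    (hP : P = Subgroup.closure {I | ∃ y : Kˣ, (y : K) ∈ F₀ ∧ I = toPrincipalIdeal (𝓞 K) K y})
    (hA : ∀ x : Kˣ, FractionalIdeal.spanSingleton (𝓞 K)⁰ (D.σ (x : K)) =
      FractionalIdeal.spanSingleton (𝓞 K)⁰ (x : K) → toPrincipalIdeal (𝓞 K) K x ∈ A) :
    Nat.card (Subgroup.closure {c : A ⧸ P.subgroupOf A | ∃ (x : Kˣ)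
      (h : FractionalIdeal.spanSingleton (𝓞 K)⁰ (D.σ (x : K)) =
        FractionalIdeal.spanSingleton (𝓞 K)⁰ (x : K)),
      QuotientGroup.mk (⟨toPrincipalIdeal (𝓞 K) K x, hA x h⟩ : A) = c ∧
      ∃ (r : ℚˣ) (u : (𝓞 F)ˣ),
        Algebra.norm F (x : K) = algebraMap ℚ F (r : ℚ) * ((u : 𝓞 F) : F)}) =
    (D.unitAction hN).Y.relIndex (D.unitAction hN).minus := by
  subst hF₀ hF
  set S := (D.unitAction hN).minus.map (QuotientGroup.mk' (D.unitAction hN).Y)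
  set f : D.ambig →* A :=
    ((toPrincipalIdeal (𝓞 K) K).comp D.ambig.subtype).codRestrict A
      (fun x => hA x (D.mem_ambig_iff_spanSingleton.1 x.2))
  set g : D.ambig →* A ⧸ P.subgroupOf A := (QuotientGroup.mk' _).comp f
  have hgen : {c : A ⧸ P.subgroupOf A | ∃ (x : Kˣ)
      (h : FractionalIdeal.spanSingleton (𝓞 K)⁰ (D.σ (x : K)) =
        FractionalIdeal.spanSingleton (𝓞 K)⁰ (x : K)),
      QuotientGroup.mk (⟨toPrincipalIdeal (𝓞 K) K x, hA x h⟩ : A) = c ∧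
      ∃ (r : ℚˣ) (u : (𝓞 D.L)ˣ),
        Algebra.norm D.L (x : K) = algebraMap ℚ D.L (r : ℚ) * ((u : 𝓞 D.L) : D.L)} =
      ((S.comap (D.ψ hN)).map g : Set _) := by
    ext c
    constructor
    · rintro ⟨x, h, rfl, r, u, hu⟩
      refine ⟨⟨x, D.mem_ambig_iff_spanSingleton.2 h⟩, (D.ψ_mem_map_minus hN).2
        ⟨r, _root_.Units.map (algebraMap (𝓞 D.L) (𝓞 K) : 𝓞 D.L →* 𝓞 K) u,
          D.mem_L.1 ((u : 𝓞 D.L) : D.L).2, ?_⟩, rfl⟩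
      refine (D.norm_L (x : K)).symm.trans ?_
      exact congrArg (fun y : D.L => (y : K)) hu
    · rintro ⟨x, hx, rfl⟩
      obtain ⟨r, e, he, h⟩ := (D.ψ_mem_map_minus hN).1 hx
      obtain ⟨u, hu⟩ := Units.exists_of_mem D.L e (D.mem_L.2 he)
      have hr : r ≠ 0 := by
        rintro rfl
        rw [map_zero, zero_mul] at h
        exact mul_ne_zero (Units.ne_zero _) (by simp) h
      refine ⟨x, D.mem_ambig_iff_spanSingleton.1 x.2, rfl, Units.mk0 r hr, u, Subtype.ext ?_⟩
      refine (D.norm_L _).trans (h.trans ?_)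
      rw [← hu]
      rfl
  have hPmem : ∀ I, I ∈ P ↔ ∃ y : Kˣ, (y : K) ∈ D.k0 ∧ I = toPrincipalIdeal (𝓞 K) K y := by
    intro I
    constructor
    · intro hI
      rw [hP] at hI
      induction hI using Subgroup.closure_induction with
      | mem I hI => exact hI
      | one => exact ⟨1, one_mem _, (map_one _).symm⟩
      | mul I J _ _ hI hJ =>
        obtain ⟨y, hy, rfl⟩ := hI
        obtain ⟨z, hz, rfl⟩ := hJ
        exact ⟨y * z, mul_mem hy hz, (map_mul _ _ _).symm⟩
      | inv I _ hI =>
        obtain ⟨y, hy, rfl⟩ := hI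
        exact ⟨y⁻¹, by simpa using hy, (map_inv _ _).symm⟩
    · intro h
      rw [hP]
      exact Subgroup.subset_closure h
  have hker : g.ker = (D.ψ hN).ker := by
    ext x
    rw [MonoidHom.mem_ker, MonoidHom.mem_ker, ψ_eq_one_iff]
    refine (QuotientGroup.eq_one_iff _).trans (Subgroup.mem_subgroupOf.trans ((hPmem _).trans ?_))
    constructor
    · rintro ⟨y, hy, h⟩
      obtain ⟨u, hu⟩ := toPrincipalIdeal_eq_iff_unit.1 h
      exact ⟨y, u, D.mem_k0.1 hy, hu.trans (mul_comm _ _)⟩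
    · rintro ⟨y, e, hy, h⟩
      have hy0 : y ≠ 0 := by
        rintro rfl
        rw [zero_mul] at h
        exact Units.ne_zero _ h
      exact ⟨Units.mk0 y hy0, D.mem_k0.2 hy,
        toPrincipalIdeal_eq_iff_unit.2 ⟨e, h.trans (mul_comm _ _)⟩⟩
  rw [hgen, Subgroup.closure_eq, ← Subgroup.relIndex_ker, hker, relIndex_ψ,
    Subgroup.map_comap_eq_self_of_surjective (D.ψ_surjective hN), card_map_mk']

end PureCubic

/-- **Corollary 2.6**: for radicands `d = p^{e₁}`, `d = 3^e·p^{e₁}` (with `c = 3`) or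
`d = p^{e₁}q^{f₁} ≡ ±1 (mod 9)` (with `c = q`), where `p ≡ 4, 7 (mod 9)` and
`q ≡ 2, 5 (mod 9)`: `Q = 1` together with `C_{k,3}` cyclic of order `3` holds iff `c` is
not a cubic residue mod `p`; if `Q = 3` and `C_{k,3} ≅ (3,3)` then `c` is a cubic residue
mod `p`; and `L` is of type `α` iff `Q = 1`, of type `β` iff `Q = 3`. -/
theorem correlation_types_unit_index_cubic_residue
    (d p c : ℕ) (hd : 1 < d) (hdcf : IsCubeFree d)
    (hp : p.Prime) (hp9 : p % 9 = 4 ∨ p % 9 = 7)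
    (hcase :
      (∃ e₁ : ℕ, (e₁ = 1 ∨ e₁ = 2) ∧ d = p ^ e₁ ∧ c = 3) ∨
      (∃ e e₁ : ℕ, (e = 1 ∨ e = 2) ∧ (e₁ = 1 ∨ e₁ = 2) ∧ d = 3 ^ e * p ^ e₁ ∧ c = 3) ∨
      (∃ q e₁ f₁ : ℕ, q.Prime ∧ (q % 9 = 2 ∨ q % 9 = 5) ∧ (e₁ = 1 ∨ e₁ = 2) ∧
        (f₁ = 1 ∨ f₁ = 2) ∧ d = p ^ e₁ * q ^ f₁ ∧ (d % 9 = 1 ∨ d % 9 = 8) ∧ c = q))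
    (σ : ↥(Kc d) ≃ₐ[ℚ] ↥(Kc d)) (hσfix : ∀ x : ↥(Kc d), x ∈ k0S d → σ x = x)
    (hσne : σ ≠ 1)
    (U A R : ℕ)
    (hU : 3 ^ U = unitNormIndex d)
    (hA : 3 ^ A = Nat.card (absPrincipalFactors d σ))
    (hR : 3 ^ R = Nat.card ↥(relPrincipalFactors d σ)) :
    ((subfieldUnitIndex d σ = 1 ∧
        Nat.card ↥(CommGroup.primaryComponent (ClassGroup (𝓞 ↥(Kc d))) 3) = 3 ∧
        IsCyclic ↥(CommGroup.primaryComponent (ClassGroup (𝓞 ↥(Kc d))) 3)) ↔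
      ¬ ∃ x : ZMod p, x ^ 3 = (c : ZMod p)) ∧
    ((subfieldUnitIndex d σ = 3 ∧
        Nonempty (↥(CommGroup.primaryComponent (ClassGroup (𝓞 ↥(Kc d))) 3) ≃*
          (Multiplicative (ZMod 3) × Multiplicative (ZMod 3)))) →
      ∃ x : ZMod p, x ^ 3 = (c : ZMod p)) ∧
    ((U = 1 ∧ A = 1 ∧ R = 1) ↔ subfieldUnitIndex d σ = 1) ∧
    ((U = 1 ∧ A = 2 ∧ R = 0) ↔ subfieldUnitIndex d σ = 3) := by
  have := Fact.mk hp
  have hp1 : p % 3 = 1 := by clear hcase; omega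
  have hp0 : p ≠ 0 := hp.ne_zero
  have hp3 : p ≠ 3 := by clear hcase; rintro rfl; omega
  have hval : ∀ e₁ m : ℕ, (e₁ = 1 ∨ e₁ = 2) → ¬ p ∣ m → ¬ 3 ∣ padicValNat p (m * p ^ e₁) := by
    intro e₁ m he hm
    have hm0 : m ≠ 0 := by rintro rfl; exact hm (dvd_zero p)
    rw [padicValNat.mul hm0 (pow_ne_zero _ hp0), padicValNat.prime_pow,
      padicValNat.eq_zero_of_not_dvd hm]
    clear hcase; omega
  have hpow : ∀ {ℓ q e : ℕ}, ℓ.Prime → q.Prime → ℓ ∣ q ^ e → ℓ = q := fun hℓ hq h =>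
    (Nat.prime_dvd_prime_iff_eq hℓ hq).1 (hℓ.dvd_of_dvd_pow h)
  have hpval : ¬ 3 ∣ padicValNat p d := by
    rcases hcase with ⟨e₁, he, rfl, -⟩ | ⟨e, e₁, -, he, rfl, -⟩ | ⟨q, e₁, f₁, hq, hq9, he, -, rfl, -, -⟩
    · simpa using hval e₁ 1 he (by simpa using hp.ne_one)
    · exact hval e₁ _ he fun h => hp3 (hpow hp Nat.prime_three h)
    · rw [mul_comm]
      refine hval e₁ _ he fun h => ?_
      have := hpow hp hq h
      omega
  obtain ⟨D, hDd, rfl, hk0, hL⟩ := exists_pureCubic d (rat_pow_three_ne hpval) σ hσfix hσne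
  have hDval : ¬ 3 ∣ padicValNat p D.d := by rwa [hDd]
  have hN := D.norm_ne_ζ hp9 hDval
  obtain ⟨B⟩ := D.nonempty_badIdeal (p := p) hp1
  obtain ⟨hc, hpc, ⟨P⟩⟩ : c.Prime ∧ p ≠ c ∧ Nonempty (D.RamData p c) := by
    rcases hcase with ⟨e₁, -, h, rfl⟩ | ⟨e, e₁, -, -, h, rfl⟩ |
      ⟨q, e₁, f₁, hq, hq9, -, -, h, h9, rfl⟩
    · refine ⟨Nat.prime_three, hp3, D.nonempty_ramData_three hp fun ℓ hℓ hd => ?_⟩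
      rw [hDd, h] at hd
      exact Or.inl (hpow hℓ hp hd)
    · refine ⟨Nat.prime_three, hp3, D.nonempty_ramData_three hp fun ℓ hℓ hd => ?_⟩
      rw [hDd, h, hℓ.dvd_mul] at hd
      exact hd.symm.imp (hpow hℓ hp) (hpow hℓ Nat.prime_three)
    · refine ⟨hq, by omega, D.nonempty_ramData_of_mod_nine hp hq (by omega) (by rwa [hDd])
        fun ℓ hℓ hd => ?_⟩
      rw [hDd, h, hℓ.dvd_mul] at hd
      exact hd.imp (hpow hℓ hp) (hpow hℓ hq)
  have := Fact.mk hc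
  have hQ : subfieldUnitIndex d D.σ = (D.unitAction hN).E0.index := by
    rw [← D.closure_subfieldUnits hN, hk0, hL]
    rfl
  have hUn : 3 ^ U = 3 ^ 1 := hU.trans (D.index_norm_units hN _ hk0)
  have hAn : 3 ^ A = (D.unitAction hN).Y.relIndex (D.unitAction hN).plus :=
    hA.trans (D.relIndex_ambigL hN _ hL)
  have hRn : 3 ^ R = (D.unitAction hN).Y.relIndex (D.unitAction hN).minus :=
    hR.trans (D.card_relative_norm_kernel hN _ _ hk0 hL (principalFromK0 d) (ambPrincipalK d D.σ)
      rfl fun x h => Subgroup.subset_closure ⟨x, rfl, h⟩)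
  have hinj : ∀ {a b : ℕ}, 3 ^ a = 3 ^ b → a = b :=
    fun h => Nat.pow_right_injective (le_refl 2 |>.trans (by norm_num)) h
  obtain rfl := hinj hUn
  have hcases : (subfieldUnitIndex d D.σ = 1 ∧ A = 1 ∧ R = 1) ∨
      (subfieldUnitIndex d D.σ = 3 ∧ A = 2 ∧ R = 0) := by
    rw [hQ]
    rcases D.unit_index_cases hN with ⟨h1, h2, h3⟩ | ⟨h1, h2, h3⟩
    · exact Or.inl ⟨h1, hinj (hAn.trans h2), hinj (hRn.trans h3)⟩
    · exact Or.inr ⟨h1, hinj (hAn.trans h2), hinj (hRn.trans h3)⟩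
  have hone : (¬ ∃ x : ZMod p, x ^ 3 = (c : ZMod p)) → subfieldUnitIndex d D.σ = 1 := by
    intro h
    have h3 := PureCubic.relIndex_plus_eq_three_of_not_cube hpc hp9 hDval P hN h
    rw [h3] at hAn
    have : A = 1 := hinj hAn
    clear hcase; omega
  refine ⟨⟨?_, ?_⟩, ?_, ?_, ?_⟩
  · rintro ⟨h1, h2, -⟩
    have hA1 : A = 1 := by clear hcase; omega
    rw [hA1] at hAn
    exact PureCubic.not_cube_of_card_eq_three B hpc hp9 hDval P hN hAn.symm h2
  · intro h
    have h3 := PureCubic.card_eq_three_of_not_cube B hpc hp9 hDval P hN h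
    exact ⟨hone h, h3, isCyclic_of_prime_card h3⟩
  · rintro ⟨h, -⟩
    by_contra hcube
    rw [hone hcube] at h
    clear hcase; omega
  · clear hcase; omega
  · clear hcase; omega

end
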